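/- Let S ⊂ ℝⁿ (n ≥ 2) be a centrally symmetric convex body with C² boundary. Then limsup_{δ→0} (d_S(δ) − 1)/δ^{2/(n+1)} ≤ G_max − G_min, where G_max and G_min are the maximum and minimum over ∂S of the function G_S. -/

import Mathlib

open MeasureTheory Metric Set Filter
open scoped RealInnerProductSpace Pointwise Topology

noncomputable section

abbrev Euc (n : ℕ) : Type := EuclideanSpace ℝ (Fin n)

/-- A centrally symmetric convex body in `ℝⁿ`. -/
def IsSymConvexBody {n : ℕ} (S : Set (Euc n)) : Prop :=
  IsCompact S ∧ Convex ℝ S ∧ (interior S).Nonempty ∧ S = -S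

/-- The convex floating body `K_δ`: the intersection of all closed halfspaces whose bounding
hyperplane cuts off a set of volume at most `δ·|K|ₙ` from `K`. -/
def floatingBody {n : ℕ} (K : Set (Euc n)) (δ : ℝ) : Set (Euc n) :=
  ⋂ (v : Euc n) (_ : v ≠ 0) (c : ℝ)
    (_ : volume (K ∩ {y | c ≤ ⟪v, y⟫}) ≤ ENNReal.ofReal δ * volume K),
    {y | ⟪v, y⟫ ≤ c}

/-- The illumination body `K^δ`. -/
def illuminationBody {n : ℕ} (K : Set (Euc n)) (δ : ℝ) : Set (Euc n) :=
  {x | volume (convexHull ℝ (K ∪ {x})) ≤ ENNReal.ofReal (1 + δ) * volume K}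

/-- The polar body `K°`. -/
def polarBody {n : ℕ} (K : Set (Euc n)) : Set (Euc n) :=
  {y | ∀ x ∈ K, ⟪x, y⟫ ≤ 1}

/-- The distance `d(C₁, C₂) = inf {a ≥ 1 : a⁻¹ C₁ ⊆ C₂ ⊆ a C₁}`. -/
def bodyDist {n : ℕ} (C₁ C₂ : Set (Euc n)) : ℝ :=
  sInf {a : ℝ | 1 ≤ a ∧ a⁻¹ • C₁ ⊆ C₂ ∧ C₂ ⊆ a • C₁}

/-- `d_C(δ) = inf_{δ' > 0} d(C_δ, ((C°)^{δ'})°)`. -/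
def dualDist {n : ℕ} (C : Set (Euc n)) (δ : ℝ) : ℝ :=
  sInf {r : ℝ | ∃ δ' > (0:ℝ), r = bodyDist (floatingBody C δ)
      (polarBody (illuminationBody (polarBody C) δ'))}

/-- `ν` is an outer unit normal of `S` at `x`. -/
def IsOuterNormalAt {n : ℕ} (S : Set (Euc n)) (x ν : Euc n) : Prop :=
  ‖ν‖ = 1 ∧ ∀ y ∈ S, ⟪y, ν⟫ ≤ ⟪x, ν⟫

/-- Near `x ∈ ∂S`, the boundary of `S` is the graph of a `C²` function `f` over the tangent
hyperplane at `x` (embedded via a linear isometry `L` orthogonal to the normal `ν`), with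
`f 0 = 0` and vanishing derivative at `0`, and `k` is the determinant of the Hessian of `f`
at `0`, i.e. the Gauss curvature of `∂S` at `x`. -/
def IsGaussCurvatureAt {n : ℕ} (S : Set (Euc n)) (x ν : Euc n) (k : ℝ) : Prop :=
  ∃ (L : Euc (n-1) →ₗᵢ[ℝ] Euc n) (f : Euc (n-1) → ℝ) (τ ε : ℝ),
    0 < τ ∧ 0 < ε ∧
    (∀ v, ⟪L v, ν⟫ = 0) ∧
    ContDiffOn ℝ 2 f (ball 0 τ) ∧
    f 0 = 0 ∧ fderiv ℝ f 0 = 0 ∧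
    frontier S ∩ ball x ε
      = {y | ∃ v ∈ ball (0 : Euc (n-1)) τ, y = x + L v - f v • ν} ∩ ball x ε ∧
    k = (Matrix.of fun i j : Fin (n-1) =>
      iteratedFDeriv ℝ 2 f 0 ![EuclideanSpace.single i 1, EuclideanSpace.single j 1]).det

/-- `S` has `C²` boundary, with outer unit normal map `u` and Gauss curvature function `κ`. -/
def IsC2Body {n : ℕ} (S : Set (Euc n)) (u : Euc n → Euc n) (κ : Euc n → ℝ) : Prop :=
  ∀ x ∈ frontier S, IsOuterNormalAt S x (u x) ∧ IsGaussCurvatureAt S x (u x) (κ x)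

/-- The constant `c(K, n) = ((n+1)^{2/(n+1)}/2)·(|K|ₙ/|B₂^{n−1}|_{n−1})^{2/(n+1)}`. -/
def cConst (n : ℕ) (K : Set (Euc n)) : ℝ :=
  ((n + 1 : ℝ) ^ ((2:ℝ)/(n+1)) / 2) *
    ((volume K).toReal / (volume (ball (0 : Euc (n-1)) 1)).toReal) ^ ((2:ℝ)/(n+1))

/-- The function `G_S(x) = c(S,n)·κ(x)^{1/(n+1)} / ⟨x, u(x)⟩`. -/
def Gfun {n : ℕ} (S : Set (Euc n)) (u : Euc n → Euc n) (κ : Euc n → ℝ) (x : Euc n) : ℝ :=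
  cConst n S * (κ x) ^ ((1:ℝ)/(n+1)) / ⟪x, u x⟫

instance isAddHaarMeasure_volume_prod_real (d : ℕ) :
    (volume : Measure (Euc d × ℝ)).IsAddHaarMeasure :=
  inferInstanceAs ((volume : Measure (Euc d)).prod (volume : Measure ℝ)).IsAddHaarMeasure

/-- The map `(v, s) ↦ L v + s ν` attached to an isometric embedding `L` of a hyperplane and a vector
`ν`. -/
def frameMap {d : ℕ} (L : Euc d →ₗᵢ[ℝ] Euc (d + 1)) (ν : Euc (d + 1)) :
    Euc d × ℝ →ₗ[ℝ] Euc (d + 1) :=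
  L.toLinearMap.coprod (LinearMap.toSpanSingleton ℝ _ ν)

@[simp] theorem frameMap_apply {d : ℕ} (L : Euc d →ₗᵢ[ℝ] Euc (d + 1)) (ν : Euc (d + 1))
    (q : Euc d × ℝ) : frameMap L ν q = L q.1 + q.2 • ν := by
  simp [frameMap]

/-- The frame map of an orthonormal frame, as a linear isometry from the `L²` product. -/
theorem exists_frameIsometry {d : ℕ} (L : Euc d →ₗᵢ[ℝ] Euc (d + 1)) (ν : Euc (d + 1))
    (hν : ‖ν‖ = 1) (hL : ∀ v, ⟪L v, ν⟫ = 0) :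
    ∃ e : WithLp 2 (Euc d × ℝ) ≃ₗᵢ[ℝ] Euc (d + 1), ∀ q, e (WithLp.toLp 2 q) = frameMap L ν q := by
  let f : WithLp 2 (Euc d × ℝ) →ₗ[ℝ] Euc (d + 1) :=
    (frameMap L ν).comp (WithLp.linearEquiv 2 ℝ (Euc d × ℝ)).toLinearMap
  have hf : ∀ x, ‖f x‖ = ‖x‖ := by
    intro x
    have h1 : f x = L x.fst + x.snd • ν := by simp [f]
    have h2 : ‖f x‖ ^ 2 = ‖x‖ ^ 2 := by
      rw [h1, WithLp.prod_norm_sq_eq_of_L2, norm_add_sq_real, real_inner_smul_right, hL, norm_smul,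
        hν, L.norm_map]
      simp
    exact (pow_left_inj₀ (norm_nonneg _) (norm_nonneg _) two_ne_zero).1 h2
  let g : WithLp 2 (Euc d × ℝ) →ₗᵢ[ℝ] Euc (d + 1) := ⟨f, hf⟩
  have hfr : Module.finrank ℝ (WithLp 2 (Euc d × ℝ)) = Module.finrank ℝ (Euc (d + 1)) := by
    rw [(WithLp.linearEquiv 2 ℝ (Euc d × ℝ)).finrank_eq]
    simp
  refine ⟨g.toLinearIsometryEquiv hfr, fun q => ?_⟩
  simp [g, f]

theorem frameMap_surjective {d : ℕ} {L : Euc d →ₗᵢ[ℝ] Euc (d + 1)} {ν : Euc (d + 1)}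
    (hν : ‖ν‖ = 1) (hL : ∀ v, ⟪L v, ν⟫ = 0) (z : Euc (d + 1)) :
    ∃ (v : Euc d) (s : ℝ), z = L v + s • ν := by
  obtain ⟨e, he⟩ := exists_frameIsometry L ν hν hL
  refine ⟨(e.symm z).fst, (e.symm z).snd, ?_⟩
  have := he ((e.symm z).fst, (e.symm z).snd)
  rw [frameMap_apply] at this
  rw [← this]
  exact (e.apply_symm_apply z).symm

theorem volume_image_frameMap {d : ℕ} {L : Euc d →ₗᵢ[ℝ] Euc (d + 1)} {ν : Euc (d + 1)}
    (hν : ‖ν‖ = 1) (hL : ∀ v, ⟪L v, ν⟫ = 0) (M : Set (Euc d × ℝ)) :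
    volume (frameMap L ν '' M) = volume M := by
  obtain ⟨e, he⟩ := exists_frameIsometry L ν hν hL
  have h1 : frameMap L ν '' M = e.symm ⁻¹' (WithLp.ofLp ⁻¹' M) := by
    ext z
    constructor
    · rintro ⟨q, hq, rfl⟩
      simp [← he, hq]
    · intro hz
      refine ⟨_, hz, ?_⟩
      rw [← he]
      exact e.apply_symm_apply z
  rw [h1]
  have h2 := (e.symm.measurePreserving).measure_preimage_equiv (f := e.symm.toMeasurableEquiv)
    (WithLp.ofLp ⁻¹' M)
  have h3 := (WithLp.volume_preserving_symm_measurableEquiv_toLp_prod (Euc d) ℝ).measure_preimage_equiv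
    M
  exact h2.trans h3

/-- The model affine parametrization. -/
def chartMap {d : ℕ} (L : Euc d →ₗᵢ[ℝ] Euc (d + 1)) (ν : Euc (d + 1)) (J : Euc d →ₗ[ℝ] Euc d)
    (c : ℝ) (ℓ : Euc d →ₗ[ℝ] ℝ) (p : Euc d) : Euc d × ℝ →ₗ[ℝ] Euc (d + 1) :=
  (frameMap L ν) ∘ₗ (LinearMap.transvection (LinearMap.snd ℝ (Euc d) ℝ) (p, 0)) ∘ₗ
    (LinearMap.transvection (ℓ ∘ₗ LinearMap.fst ℝ (Euc d) ℝ) (0, 1)) ∘ₗ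
    (LinearMap.prodMap J (c • LinearMap.id))

theorem chartMap_apply {d : ℕ} (L : Euc d →ₗᵢ[ℝ] Euc (d + 1)) (ν : Euc (d + 1))
    (J : Euc d →ₗ[ℝ] Euc d) (c : ℝ) (ℓ : Euc d →ₗ[ℝ] ℝ) (p : Euc d) (q : Euc d × ℝ) :
    chartMap L ν J c ℓ p q
      = L (J q.1 + (c * q.2 + ℓ (J q.1)) • p) + (c * q.2 + ℓ (J q.1)) • ν := by
  simp [chartMap, LinearMap.transvection.apply]

theorem volume_image_chartMap {d : ℕ} {L : Euc d →ₗᵢ[ℝ] Euc (d + 1)} {ν : Euc (d + 1)}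
    (hν : ‖ν‖ = 1) (hL : ∀ v, ⟪L v, ν⟫ = 0) (J : Euc d →ₗ[ℝ] Euc d)
    (c : ℝ) (ℓ : Euc d →ₗ[ℝ] ℝ) (p : Euc d) (x : Euc (d + 1)) (M : Set (Euc d × ℝ)) :
    volume ((fun q => x + chartMap L ν J c ℓ p q) '' M)
      = ENNReal.ofReal (|LinearMap.det J| * |c|) * volume M := by
  have h1 : (fun q => x + chartMap L ν J c ℓ p q) '' M
      = (fun z => x + z) '' (chartMap L ν J c ℓ p '' M) := by
    rw [image_image]
  rw [h1, image_add_left, measure_preimage_add, chartMap]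
  rw [LinearMap.coe_comp, image_comp, volume_image_frameMap hν hL,
    Measure.addHaar_image_linearMap]
  congr 3
  rw [LinearMap.det_comp, LinearMap.det_comp, LinearMap.transvection.det,
    LinearMap.transvection.det, LinearMap.det_prodMap]
  simp [abs_mul]

theorem volume_image_scale {d : ℕ} {a b : ℝ} (ha : 0 ≤ a) (hb : 0 ≤ b) (M : Set (Euc d × ℝ)) :
    volume ((fun q : Euc d × ℝ => (a • q.1, b * q.2)) '' M)
      = ENNReal.ofReal (a ^ d * b) * volume M := by
  have := Measure.addHaar_image_linearMap (volume : Measure (Euc d × ℝ))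
    (LinearMap.prodMap (a • LinearMap.id : Euc d →ₗ[ℝ] Euc d) (b • LinearMap.id : ℝ →ₗ[ℝ] ℝ)) M
  rw [LinearMap.det_prodMap] at this
  simp only [LinearMap.det_smul, LinearMap.det_id, finrank_euclideanSpace_fin, Module.finrank_self,
    mul_one, pow_one] at this
  rw [abs_of_nonneg (by positivity)] at this
  rw [← this]
  congr 1

/-- The exponent `(n + 1) / 2` for `n = d + 1`. -/
def capExp (d : ℕ) : ℝ := ((d : ℝ) + 2) / 2

theorem capExp_pos (d : ℕ) : 0 < capExp d := by
  unfold capExp; positivity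

/-- The cap of height `h` of the standard paraboloid. -/
def capModel (d : ℕ) (h : ℝ) : Set (Euc d × ℝ) := {q | ‖q.1‖ ^ 2 / 2 ≤ q.2 ∧ q.2 ≤ h}

/-- The volume of the cap of height one of the standard paraboloid. -/
def capConst (d : ℕ) : ℝ :=
  (volume (ball (0 : Euc d) 1)).toReal * 2 ^ capExp d / ((d : ℝ) + 2)

theorem volume_unitBall_pos (d : ℕ) : 0 < (volume (ball (0 : Euc d) 1)).toReal :=
  ENNReal.toReal_pos (measure_ball_pos _ _ one_pos).ne' measure_ball_lt_top.ne

theorem capConst_pos (d : ℕ) : 0 < capConst d := by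
  have := volume_unitBall_pos d
  unfold capConst; positivity

theorem isClosed_capModel (d : ℕ) (h : ℝ) : IsClosed (capModel d h) := by
  change IsClosed ({q : Euc d × ℝ | ‖q.1‖ ^ 2 / 2 ≤ q.2} ∩ {q | q.2 ≤ h})
  exact (isClosed_le (by fun_prop) (by fun_prop)).inter (isClosed_le (by fun_prop) (by fun_prop))

theorem volume_capModel (d : ℕ) {h : ℝ} (hh : 0 ≤ h) :
    volume (capModel d h) = ENNReal.ofReal (capConst d * h ^ capExp d) := by
  have hsec : ∀ t : ℝ, volume ((fun v : Euc d => (v, t)) ⁻¹' capModel d h)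
      = (Icc 0 h).indicator (fun t => ENNReal.ofReal
        ((2 * t) ^ ((d : ℝ) / 2) * (volume (ball (0 : Euc d) 1)).toReal)) t := by
    intro t
    by_cases ht : t ∈ Icc 0 h
    · rw [indicator_of_mem ht]
      have h1 : (fun v : Euc d => (v, t)) ⁻¹' capModel d h = closedBall 0 (√(2 * t)) := by
        ext v
        simp only [capModel, mem_preimage, mem_ofPred_eq, mem_closedBall, dist_zero_right]
        rw [Real.le_sqrt (norm_nonneg v) (by linarith [ht.1])]
        constructor
        · rintro ⟨h1, -⟩; linarith
        · intro h1; exact ⟨by linarith, ht.2⟩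
      rw [h1, Measure.addHaar_closedBall _ _ (Real.sqrt_nonneg _), finrank_euclideanSpace_fin,
        ENNReal.ofReal_mul (Real.rpow_nonneg (by linarith [ht.1]) _),
        ENNReal.ofReal_toReal measure_ball_lt_top.ne]
      congr 2
      rw [Real.sqrt_eq_rpow, ← Real.rpow_natCast, ← Real.rpow_mul (by linarith [ht.1])]
      congr 1; ring
    · rw [indicator_of_notMem ht]
      convert measure_empty (μ := (volume : Measure (Euc d)))
      ext v
      simp only [capModel, mem_preimage, mem_ofPred_eq, mem_empty_iff_false, iff_false]
      rintro ⟨h1, h2⟩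
      exact ht ⟨le_trans (by positivity) h1, h2⟩
  have h0 : volume (capModel d h)
      = ∫⁻ t : ℝ, volume ((fun v : Euc d => (v, t)) ⁻¹' capModel d h) :=
    Measure.prod_apply_symm (isClosed_capModel d h).measurableSet
  rw [h0, lintegral_congr hsec, lintegral_indicator measurableSet_Icc]
  rw [← ofReal_integral_eq_lintegral_ofReal]
  · congr 1
    rw [integral_Icc_eq_integral_Ioc, ← intervalIntegral.integral_of_le hh]
    have h2 : ∀ t ∈ uIcc 0 h, (2 * t) ^ ((d : ℝ) / 2) * (volume (ball (0 : Euc d) 1)).toReal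
        = (2 ^ ((d : ℝ) / 2) * (volume (ball (0 : Euc d) 1)).toReal) * t ^ ((d : ℝ) / 2) := by
      intro t ht
      rw [uIcc_of_le hh] at ht
      rw [Real.mul_rpow zero_le_two ht.1]; ring
    rw [intervalIntegral.integral_congr h2, intervalIntegral.integral_const_mul,
      integral_rpow (Or.inl (by have : (0 : ℝ) ≤ (d : ℝ) / 2 := by positivity
                                linarith))]
    have h3 : (d : ℝ) / 2 + 1 = capExp d := by unfold capExp; ring
    have h4 : (2 : ℝ) ^ capExp d = 2 ^ ((d : ℝ) / 2) * 2 := by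
      rw [← h3, Real.rpow_add two_pos, Real.rpow_one]
    rw [h3, Real.zero_rpow (capExp_pos d).ne', capConst, h4]
    have h5 : ((d : ℝ) + 2) = 2 * capExp d := by unfold capExp; ring
    rw [h5]
    have := (capExp_pos d).ne'
    field_simp
    ring
  · have hc : Continuous fun t : ℝ =>
        (2 * t) ^ ((d : ℝ) / 2) * (volume (ball (0 : Euc d) 1)).toReal := by
      refine Continuous.mul (Continuous.rpow_const (by fun_prop) fun t => Or.inr (by positivity))
        continuous_const
    exact hc.continuousOn.integrableOn_Icc
  · refine (ae_restrict_iff' measurableSet_Icc).2 (ae_of_all _ fun t ht => ?_)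
    have := ht.1
    positivity

/-- Outer model of the region between a paraboloid and the cone over it with apex `(0, -1)`. -/
def coneModelOuter (d : ℕ) (R : ℝ) : Set (Euc d × ℝ) :=
  {q | ‖q.1‖ ≤ R ∧ -1 + 2 * ‖q.1‖ ≤ q.2 ∧ q.2 ≤ R ^ 2 * ‖q.1‖ ^ 2}

/-- Inner model of the region between a paraboloid and the cone over it with apex `(0, -1)`. -/
def coneModelInner (d : ℕ) (θ : ℝ) : Set (Euc d × ℝ) :=
  {q | ‖q.1‖ < 1 ∧ -1 + 2 * ‖q.1‖ ≤ q.2 ∧ q.2 < θ * ‖q.1‖ ^ 2}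

/-- The volume between the standard paraboloid and the cone over it with apex `(0, -1)`. -/
def coneConst (d : ℕ) : ℝ := (volume (coneModelOuter d 1)).toReal

theorem volume_coneModelOuter (d : ℕ) (R : ℝ) :
    volume (coneModelOuter d R) = ∫⁻ p : Euc d, (closedBall 0 R).indicator
      (fun p => ENNReal.ofReal (R ^ 2 * ‖p‖ ^ 2 - (-1 + 2 * ‖p‖))) p := by
  have hm : MeasurableSet (coneModelOuter d R) := by
    change MeasurableSet ({q : Euc d × ℝ | ‖q.1‖ ≤ R} ∩ ({q | -1 + 2 * ‖q.1‖ ≤ q.2} ∩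
      {q | q.2 ≤ R ^ 2 * ‖q.1‖ ^ 2}))
    exact ((isClosed_le (by fun_prop) (by fun_prop)).inter
      ((isClosed_le (by fun_prop) (by fun_prop)).inter
        (isClosed_le (by fun_prop) (by fun_prop)))).measurableSet
  refine (Measure.prod_apply hm).trans (lintegral_congr fun p => ?_)
  by_cases hp : p ∈ closedBall (0 : Euc d) R
  · rw [indicator_of_mem hp, ← Real.volume_Icc]
    congr 1
    ext t
    simp [coneModelOuter, mem_closedBall_zero_iff.1 hp]
  · rw [indicator_of_notMem hp]
    convert measure_empty (μ := (volume : Measure ℝ))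
    ext t
    simp only [coneModelOuter, mem_preimage, mem_ofPred_eq, mem_empty_iff_false, iff_false]
    exact fun h => hp (mem_closedBall_zero_iff.2 h.1)

theorem volume_coneModelInner (d : ℕ) (θ : ℝ) :
    volume (coneModelInner d θ) = ∫⁻ p : Euc d, (ball 0 1).indicator
      (fun p => ENNReal.ofReal (θ * ‖p‖ ^ 2 - (-1 + 2 * ‖p‖))) p := by
  have hm : MeasurableSet (coneModelInner d θ) := by
    change MeasurableSet ({q : Euc d × ℝ | ‖q.1‖ < 1} ∩ ({q | -1 + 2 * ‖q.1‖ ≤ q.2} ∩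
      {q | q.2 < θ * ‖q.1‖ ^ 2}))
    exact (measurableSet_lt (by fun_prop) (by fun_prop)).inter
      ((measurableSet_le (by fun_prop) (by fun_prop)).inter
        (measurableSet_lt (by fun_prop) (by fun_prop)))
  refine (Measure.prod_apply hm).trans (lintegral_congr fun p => ?_)
  by_cases hp : p ∈ ball (0 : Euc d) 1
  · rw [indicator_of_mem hp, ← Real.volume_Ico]
    congr 1
    ext t
    simp [coneModelInner, mem_ball_zero_iff.1 hp]
  · rw [indicator_of_notMem hp]
    convert measure_empty (μ := (volume : Measure ℝ))
    ext t
    simp only [coneModelInner, mem_preimage, mem_ofPred_eq, mem_empty_iff_false, iff_false]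
    exact fun h => hp (mem_ball_zero_iff.2 h.1)

theorem volume_coneModelOuter_one_ne_top (d : ℕ) : volume (coneModelOuter d 1) ≠ ⊤ := by
  refine ((measure_mono fun q hq => ?_).trans_lt
    (measure_closedBall_lt_top (x := (0 : Euc d × ℝ)) (r := 1))).ne
  obtain ⟨h1, h2, h3⟩ := hq
  have := norm_nonneg q.1
  rw [mem_closedBall_zero_iff, Prod.norm_def, max_le_iff, Real.norm_eq_abs, abs_le]
  exact ⟨h1, by linarith, by nlinarith⟩

theorem coneConst_pos (d : ℕ) : 0 < coneConst d := by
  refine ENNReal.toReal_pos (fun h => ?_) (volume_coneModelOuter_one_ne_top d)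
  have h2 : volume (ball (0 : Euc d) (1 / 4) ×ˢ Ioo (-1 / 2 : ℝ) 0) = 0 := by
    refine measure_mono_null ?_ h
    rintro q ⟨h1, h2⟩
    rw [mem_ball_zero_iff] at h1
    exact ⟨by linarith, by linarith [h2.1], by nlinarith [h2.2, sq_nonneg ‖q.1‖]⟩
  have h3 : IsOpen (ball (0 : Euc d) (1 / 4) ×ˢ Ioo (-1 / 2 : ℝ) 0) := isOpen_ball.prod isOpen_Ioo
  have h4 := h3.measure_eq_zero_iff (volume : Measure (Euc d × ℝ)) |>.1 h2
  have h5 : ((0 : Euc d), (-1 / 4 : ℝ)) ∈ (∅ : Set (Euc d × ℝ)) := by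
    rw [← h4]
    exact ⟨by simp, by norm_num, by norm_num⟩
  exact h5

theorem exists_volume_coneModelOuter_le (d : ℕ) {C : ℝ} (hC : coneConst d < C) :
    ∃ R > 1, volume (coneModelOuter d R) ≤ ENNReal.ofReal C := by
  have ht : Tendsto (fun R => volume (coneModelOuter d R)) (𝓝[>] 1)
      (𝓝 (volume (coneModelOuter d 1))) := by
    simp_rw [volume_coneModelOuter]
    refine tendsto_lintegral_filter_of_dominated_convergence
      ((closedBall (0 : Euc d) 2).indicator fun _ => ENNReal.ofReal 17) ?_ ?_ ?_ ?_
    · refine Eventually.of_forall fun R => ?_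
      refine Measurable.indicator ?_ measurableSet_closedBall
      fun_prop
    · filter_upwards [Ioo_mem_nhdsGT (show (1 : ℝ) < 2 by norm_num)] with R hR
      refine ae_of_all _ fun p => ?_
      by_cases hp : p ∈ closedBall (0 : Euc d) R
      · have hp2 : p ∈ closedBall (0 : Euc d) 2 := closedBall_subset_closedBall hR.2.le hp
        rw [indicator_of_mem hp, indicator_of_mem hp2]
        refine ENNReal.ofReal_le_ofReal ?_
        rw [mem_closedBall_zero_iff] at hp2
        have h0 := norm_nonneg p
        have h1 : R ^ 2 ≤ 4 := by nlinarith [hR.1, hR.2]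
        have h2 : ‖p‖ ^ 2 ≤ 4 := by nlinarith
        nlinarith [sq_nonneg ‖p‖, sq_nonneg R]
      · rw [indicator_of_notMem hp]; exact zero_le
    · rw [lintegral_indicator measurableSet_closedBall, lintegral_const]
      refine ENNReal.mul_ne_top ENNReal.ofReal_ne_top ?_
      rw [Measure.restrict_apply_univ]
      exact measure_closedBall_lt_top.ne
    · refine ae_of_all _ fun p => ?_
      rcases le_or_gt ‖p‖ 1 with hp | hp
      · rw [indicator_of_mem (mem_closedBall_zero_iff.2 hp)]
        have h1 : Tendsto (fun R : ℝ => ENNReal.ofReal (R ^ 2 * ‖p‖ ^ 2 - (-1 + 2 * ‖p‖))) (𝓝[>] 1)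
            (𝓝 (ENNReal.ofReal (1 ^ 2 * ‖p‖ ^ 2 - (-1 + 2 * ‖p‖)))) := by
          refine ENNReal.tendsto_ofReal (Tendsto.mono_left (Continuous.tendsto ?_ 1)
            nhdsWithin_le_nhds)
          fun_prop
        refine h1.congr' ?_
        filter_upwards [self_mem_nhdsWithin] with R hR
        rw [indicator_of_mem (mem_closedBall_zero_iff.2 (hp.trans (le_of_lt hR)))]
      · rw [indicator_of_notMem (by simpa using hp)]
        refine tendsto_const_nhds.congr' ?_
        filter_upwards [Ioo_mem_nhdsGT hp] with R hR
        rw [indicator_of_notMem (by simpa using hR.2)]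
  have h2 : volume (coneModelOuter d 1) < ENNReal.ofReal C := by
    rw [← ENNReal.ofReal_toReal (volume_coneModelOuter_one_ne_top d)]
    exact (ENNReal.ofReal_lt_ofReal_iff ((coneConst_pos d).trans hC)).2 hC
  obtain ⟨R, hR1, hR2⟩ := ((ht.eventually_lt_const h2).and self_mem_nhdsWithin).exists
  exact ⟨R, hR2, hR1.le⟩

theorem exists_le_volume_coneModelInner (d : ℕ) {C : ℝ} (hC : C < coneConst d) :
    ∃ θ ∈ Ioo (0 : ℝ) 1, ENNReal.ofReal C ≤ volume (coneModelInner d θ) := by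
  have ht : Tendsto (fun θ => volume (coneModelInner d θ)) (𝓝[<] 1)
      (𝓝 (volume (coneModelOuter d 1))) := by
    simp_rw [volume_coneModelInner, volume_coneModelOuter]
    refine tendsto_lintegral_filter_of_dominated_convergence
      ((closedBall (0 : Euc d) 1).indicator fun _ => ENNReal.ofReal 2) ?_ ?_ ?_ ?_
    · refine Eventually.of_forall fun R => ?_
      refine Measurable.indicator ?_ measurableSet_ball
      fun_prop
    · filter_upwards [Ioo_mem_nhdsLT (show (0 : ℝ) < 1 by norm_num)] with θ hθ
      refine ae_of_all _ fun p => ?_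
      by_cases hp : p ∈ ball (0 : Euc d) 1
      · have hp2 : p ∈ closedBall (0 : Euc d) 1 := ball_subset_closedBall hp
        rw [indicator_of_mem hp, indicator_of_mem hp2]
        refine ENNReal.ofReal_le_ofReal ?_
        rw [mem_closedBall_zero_iff] at hp2
        have h0 := norm_nonneg p
        nlinarith [hθ.1, hθ.2, sq_nonneg ‖p‖]
      · rw [indicator_of_notMem hp]; exact zero_le
    · rw [lintegral_indicator measurableSet_closedBall, lintegral_const]
      refine ENNReal.mul_ne_top ENNReal.ofReal_ne_top ?_
      rw [Measure.restrict_apply_univ]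
      exact measure_closedBall_lt_top.ne
    · refine ae_of_all _ fun p => ?_
      rcases lt_trichotomy ‖p‖ 1 with hp | hp | hp
      · rw [indicator_of_mem (mem_closedBall_zero_iff.2 hp.le)]
        simp_rw [indicator_of_mem (mem_ball_zero_iff.2 hp)]
        refine ENNReal.tendsto_ofReal (Tendsto.mono_left ?_ nhdsWithin_le_nhds)
        have hc : Continuous fun θ : ℝ => θ * ‖p‖ ^ 2 - (-1 + 2 * ‖p‖) := by fun_prop
        simpa using hc.tendsto 1
      · rw [indicator_of_mem (mem_closedBall_zero_iff.2 hp.le)]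
        simp_rw [indicator_of_notMem (show p ∉ ball (0 : Euc d) 1 by simp [hp])]
        simp [hp]
        norm_num
      · rw [indicator_of_notMem (by simpa using hp)]
        simp_rw [indicator_of_notMem (show p ∉ ball (0 : Euc d) 1 by simpa using hp.le)]
        exact tendsto_const_nhds
  have h2 : ENNReal.ofReal C < volume (coneModelOuter d 1) := by
    rw [← ENNReal.ofReal_toReal (volume_coneModelOuter_one_ne_top d)]
    exact (ENNReal.ofReal_lt_ofReal_iff (coneConst_pos d)).2 hC
  obtain ⟨θ, hθ1, hθ2⟩ := ((ht.eventually_const_lt h2).and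
    (Ioo_mem_nhdsLT (show (0 : ℝ) < 1 by norm_num))).exists
  exact ⟨θ, hθ2, hθ1.le⟩

section ConeModel

variable {V : Type*} [NormedAddCommGroup V] [NormedSpace ℝ V]

theorem Convex.vertical_mem {K : Set (V × ℝ)} (hK : Convex ℝ K) {P : V} {t₁ t t₂ : ℝ}
    (h₁ : (P, t₁) ∈ K) (h₂ : (P, t₂) ∈ K) (ht₁ : t₁ ≤ t) (ht₂ : t ≤ t₂) : (P, t) ∈ K := by
  have hc : Convex ℝ ((fun s : ℝ => (P, s)) ⁻¹' K) := by
    have : (fun s : ℝ => (P, s)) = fun s => (P, (0 : ℝ)) + LinearMap.inr ℝ V ℝ s := by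
      ext s <;> simp
    rw [this]
    exact (hK.translate_preimage_right (P, 0)).linear_preimage (LinearMap.inr ℝ V ℝ)
  exact hc.ordConnected.out h₁ h₂ ⟨ht₁, ht₂⟩

/-- A convex set lying above a paraboloid near the origin lies above a cone outside of the
neighborhood. -/
theorem mul_norm_le_of_not_local {K : Set (V × ℝ)} (hK : Convex ℝ K) (h0 : (0 : V × ℝ) ∈ K)
    {q r : ℝ} (hr : 0 < r)
    (hout : ∀ k ∈ K, ‖k.1‖ ≤ r → k.2 ≤ r → q / 2 * ‖k.1‖ ^ 2 ≤ k.2)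
    {k : V × ℝ} (hk : k ∈ K) (hloc : ¬ (‖k.1‖ ≤ r ∧ k.2 ≤ r)) :
    min (q * r / 2) 1 * ‖k.1‖ ≤ k.2 := by
  have hx := norm_nonneg k.1
  rcases le_or_gt ‖k.1‖ k.2 with h | h
  · exact (mul_le_of_le_one_left hx (min_le_right _ _)).trans h
  · have hxr : r < ‖k.1‖ := by
      by_contra! hc
      exact hloc ⟨hc, h.le.trans hc⟩
    have hx0 : 0 < ‖k.1‖ := hr.trans hxr
    have hmem : (r / ‖k.1‖) • k ∈ K :=
      hK.smul_mem_of_zero_mem h0 hk ⟨by positivity, (div_le_one hx0).2 hxr.le⟩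
    have hn : ‖((r / ‖k.1‖) • k).1‖ = r := by
      rw [Prod.smul_fst, norm_smul, Real.norm_of_nonneg (by positivity)]
      field_simp
    have h2 : ((r / ‖k.1‖) • k).2 = r / ‖k.1‖ * k.2 := rfl
    have h3 : r / ‖k.1‖ * k.2 ≤ r := by
      rw [div_mul_eq_mul_div, div_le_iff₀ hx0]
      nlinarith
    have := hout _ hmem hn.le (h2 ▸ h3)
    have h5 : r / ‖k.1‖ * k.2 = r * k.2 / ‖k.1‖ := by ring
    rw [hn, h2, h5, le_div_iff₀ hx0] at this
    have h4 : q * r / 2 * ‖k.1‖ ≤ k.2 := by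
      have : r * (q * r / 2 * ‖k.1‖) ≤ r * k.2 := by linarith
      exact le_of_mul_le_mul_left this hr
    exact (mul_le_mul_of_nonneg_right (min_le_left _ _) hx).trans h4

theorem exists_of_mem_convexHull_union_singleton {E : Type*} [AddCommGroup E] [Module ℝ E]
    {K : Set E} (hK : Convex ℝ K) (hne : K.Nonempty) {w z : E}
    (hz : z ∈ convexHull ℝ (K ∪ {w})) :
    ∃ k ∈ K, ∃ a : ℝ, 0 ≤ a ∧ a ≤ 1 ∧ z = a • k + (1 - a) • w := by
  rw [union_singleton, convexHull_insert hne, hK.convexHull_eq, convexJoin_singleton_left] at hz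
  simp only [mem_iUnion] at hz
  obtain ⟨k, hk, a, b, ha, hb, hab, rfl⟩ := hz
  refine ⟨k, hk, b, hb, by linarith, ?_⟩
  rw [show 1 - b = a by linarith, add_comm]

theorem convexHull_diff_subset_of_sandwich {K : Set (V × ℝ)} (hK : Convex ℝ K)
    (h0 : (0 : V × ℝ) ∈ K) {q q' r R ρ : ℝ}
    (hr : 0 < r) (hq : 0 < q) (hR : 1 < R) (hqq : q' ≤ (R + 1 / R - 1) * q)
    (hout : ∀ k ∈ K, ‖k.1‖ ≤ r → k.2 ≤ r → q / 2 * ‖k.1‖ ^ 2 ≤ k.2)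
    (hin : ∀ P : V, ‖P‖ ≤ r → (P, q' / 2 * ‖P‖ ^ 2) ∈ K)
    (hρ : 0 < ρ) (hρr : R * ρ ≤ r) (hρq : (R + 1 / R) * (q * ρ / 2) ≤ min (q * r / 2) 1) :
    convexHull ℝ (K ∪ {(0, -(q * ρ ^ 2 / 2))}) \ K ⊆
      {z | ‖z.1‖ ≤ R * ρ ∧ -(q * ρ ^ 2 / 2) + q * ρ * ‖z.1‖ ≤ z.2
        ∧ z.2 ≤ q' / 2 * ‖z.1‖ ^ 2} := by
  rintro z ⟨hz, hzK⟩
  obtain ⟨k, hk, a, ha0, ha1, rfl⟩ := exists_of_mem_convexHull_union_singleton hK ⟨0, h0⟩ hz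
  obtain ⟨P, t⟩ := k
  set l : ℝ := q * ρ ^ 2 / 2 with hl
  have hl0 : 0 < l := by positivity
  have hRR : 2 < R + 1 / R := by
    have h1 : R * (1 / R) = 1 := by field_simp
    have h2 : 0 < 1 / R := by positivity
    nlinarith [sq_nonneg (R - 1)]
  have hx := norm_nonneg P
  have hz1 : (a • (P, t) + (1 - a) • ((0 : V), -l)) = (a • P, a * (t + l) - l) := by
    ext
    · simp
    · simp only [Prod.snd_add, Prod.smul_snd, smul_eq_mul]; ring
  rw [hz1] at hzK ⊢
  have hA : q * ρ * ‖P‖ ≤ t + l := by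
    by_cases hloc : ‖P‖ ≤ r ∧ t ≤ r
    · have := hout _ hk hloc.1 hloc.2
      simp only at this
      nlinarith [sq_nonneg (‖P‖ - ρ)]
    · have h1 := mul_norm_le_of_not_local hK h0 hr hout hk hloc
      have h2 : q * ρ ≤ min (q * r / 2) 1 := by
        refine le_trans ?_ hρq
        nlinarith [mul_pos hq hρ]
      simp only at h1
      nlinarith
  have haK : (a • P, a * t) ∈ K := hK.smul_mem_of_zero_mem h0 hk ⟨ha0, ha1⟩
  have hnorm : ‖a • P‖ = a * ‖P‖ := by rw [norm_smul, Real.norm_of_nonneg ha0]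
  have hB : ‖a • P‖ ≤ R * ρ := by
    by_contra! hc
    rw [hnorm] at hc
    have hxa : a * ‖P‖ ≤ ‖P‖ := mul_le_of_le_one_left hx ha1
    have hρR : ρ < R * ρ := by nlinarith
    have hxρ : ρ < ‖P‖ := by linarith
    have hx0 : 0 < ‖P‖ := by linarith
    have hslope : t + l < (R + 1 / R) * (q * ρ / 2) * ‖P‖ := by
      by_contra! hs
      apply hzK
      set c := ρ / ‖P‖ with hc_def
      have hcx : c * ‖P‖ = ρ := by rw [hc_def]; field_simp
      have hc0 : 0 < c := by positivity
      have hc1 : c < 1 := (div_lt_one hx0).2 hxρ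
      have hcn : ‖c • P‖ = ρ := by rw [norm_smul, Real.norm_of_nonneg hc0.le, hcx]
      have hb := hin (c • P) (by rw [hcn]; linarith)
      rw [hcn] at hb
      have htop : (c • P, c * t) ∈ K := hK.smul_mem_of_zero_mem h0 hk ⟨hc0.le, hc1.le⟩
      have hq0 : (c • P, c * (t + l) - l) ∈ K := by
        refine hK.vertical_mem hb htop ?_ (by nlinarith)
        have h1 : c * ((R + 1 / R) * (q * ρ / 2) * ‖P‖) ≤ c * (t + l) :=
          mul_le_mul_of_nonneg_left hs hc0.le
        have h2 : c * ((R + 1 / R) * (q * ρ / 2) * ‖P‖) = (R + 1 / R) * l := by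
          rw [hl, ← hcx]; ring
        have h3 : q' / 2 * ρ ^ 2 ≤ (R + 1 / R - 1) * l := by
          rw [hl]; nlinarith [sq_nonneg ρ]
        linarith
      have hac : c < a := by
        have : c * ‖P‖ < a * ‖P‖ := by rw [hcx]; linarith
        exact lt_of_mul_lt_mul_right this hx
      have hs0 : 0 ≤ (a - c) / (1 - c) := div_nonneg (by linarith) (by linarith)
      have hs1 : (a - c) / (1 - c) ≤ 1 := (div_le_one (by linarith)).2 (by linarith)
      have hne : (1 - c) ≠ 0 := by linarith
      have := hK hk hq0 hs0 (sub_nonneg.2 hs1) (by ring)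
      convert this using 1
      have hcomb : (a - c) / (1 - c) + (1 - (a - c) / (1 - c)) * c = a := by
        field_simp; ring
      ext
      · simp only [Prod.fst_add, Prod.smul_fst]
        rw [smul_smul, ← add_smul, hcomb]
      · simp only [Prod.snd_add, Prod.smul_snd, smul_eq_mul]
        linear_combination (-(t + l)) * hcomb
    by_cases hloc : ‖P‖ ≤ r ∧ t ≤ r
    · have h1 := hout _ hk hloc.1 hloc.2
      simp only at h1
      have h2 : ‖P‖ ^ 2 + ρ ^ 2 < (R + 1 / R) * ρ * ‖P‖ := by
        rw [hl] at hslope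
        have : q * (‖P‖ ^ 2 + ρ ^ 2) < q * ((R + 1 / R) * ρ * ‖P‖) := by nlinarith
        exact lt_of_mul_lt_mul_left this hq.le
      have h3 : (‖P‖ - R * ρ) * (‖P‖ - 1 / R * ρ) < 0 := by
        have : R * (1 / R) = 1 := by field_simp
        nlinarith
      have h4 : 1 / R * ρ ≤ ρ := by
        have : 1 / R ≤ 1 := (div_le_one (by linarith)).2 hR.le
        nlinarith
      have h5 : 0 ≤ (‖P‖ - R * ρ) * (‖P‖ - 1 / R * ρ) :=
        mul_nonneg (by linarith) (by linarith)
      linarith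
    · have h1 := mul_norm_le_of_not_local hK h0 hr hout hk hloc
      simp only at h1
      have := mul_le_mul_of_nonneg_right hρq hx
      linarith
  refine ⟨hB, ?_, ?_⟩
  · simp only [hnorm]
    nlinarith
  · by_contra! hc
    refine hzK (hK.vertical_mem (hin (a • P) (hB.trans hρr)) haK hc.le (by nlinarith))

theorem subset_convexHull_diff_of_sandwich {K : Set (V × ℝ)} {q q' r ρ : ℝ} (hq : 0 < q)
    (hqq : q ≤ q')
    (hout : ∀ k ∈ K, ‖k.1‖ ≤ r → k.2 ≤ r → q / 2 * ‖k.1‖ ^ 2 ≤ k.2)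
    (hin : ∀ P : V, ‖P‖ ≤ r → (P, q' / 2 * ‖P‖ ^ 2) ∈ K)
    (hρ : 0 < ρ) (hρr : ρ ≤ r) (hρq : q / 2 * ρ ^ 2 ≤ r) :
    {z : V × ℝ | ‖z.1‖ < ρ ∧ -(q' * ρ ^ 2 / 2) + q' * ρ * ‖z.1‖ ≤ z.2
        ∧ z.2 < q / 2 * ‖z.1‖ ^ 2} ⊆ convexHull ℝ (K ∪ {(0, -(q' * ρ ^ 2 / 2))}) \ K := by
  rintro ⟨P, t⟩ ⟨h1, h2, h3⟩
  simp only at h1 h2 h3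
  have hx := norm_nonneg P
  have hsub : K ⊆ convexHull ℝ (K ∪ {(0, -(q' * ρ ^ 2 / 2))}) :=
    subset_union_left.trans (subset_convexHull ℝ _)
  have hw : ((0 : V), -(q' * ρ ^ 2 / 2)) ∈ convexHull ℝ (K ∪ {(0, -(q' * ρ ^ 2 / 2))}) :=
    subset_convexHull ℝ _ (Or.inr rfl)
  have hconv := convex_convexHull ℝ (K ∪ {((0 : V), -(q' * ρ ^ 2 / 2))})
  constructor
  · have hxx : ‖P‖ ^ 2 ≤ ρ ^ 2 := by nlinarith
    have htop : t ≤ q' / 2 * ‖P‖ ^ 2 := by nlinarith [sq_nonneg ‖P‖]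
    refine hconv.vertical_mem (t₁ := -(q' * ρ ^ 2 / 2) + q' * ρ * ‖P‖) ?_
      (hsub (hin P (by linarith))) h2 htop
    rcases eq_or_ne P 0 with rfl | hP
    · simpa using hw
    · have hx0 : 0 < ‖P‖ := norm_pos_iff.2 hP
      have hb := hsub (hin ((ρ / ‖P‖) • P) (by
        rw [norm_smul, Real.norm_of_nonneg (by positivity)]; field_simp; exact hρr))
      have hn : ‖(ρ / ‖P‖) • P‖ = ρ := by
        rw [norm_smul, Real.norm_of_nonneg (by positivity)]; field_simp
      rw [hn] at hb
      have hc1 : ‖P‖ / ρ ≤ 1 := (div_le_one hρ).2 h1.le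
      have := hconv hb hw (show 0 ≤ ‖P‖ / ρ by positivity) (sub_nonneg.2 hc1) (by ring)
      convert this using 1
      ext
      · simp only [Prod.fst_add, Prod.smul_fst, smul_zero, add_zero, smul_smul]
        rw [show ‖P‖ / ρ * (ρ / ‖P‖) = 1 by field_simp, one_smul]
      · simp only [Prod.snd_add, Prod.smul_snd, smul_eq_mul]
        field_simp
        ring
  · intro hmem
    have hxx : ‖P‖ ^ 2 ≤ ρ ^ 2 := by nlinarith
    have := hout _ hmem (by simp only; linarith) (by simp only; nlinarith)
    simp only at this
    linarith

end ConeModel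

theorem volume_convexHull_diff_le {d : ℕ} {K : Set (Euc d × ℝ)} (hK : Convex ℝ K)
    (h0 : (0 : Euc d × ℝ) ∈ K) {q q' r R ρ : ℝ}
    (hr : 0 < r) (hq : 0 < q) (hR : 1 < R) (hqq : q' ≤ (R + 1 / R - 1) * q)
    (hout : ∀ k ∈ K, ‖k.1‖ ≤ r → k.2 ≤ r → q / 2 * ‖k.1‖ ^ 2 ≤ k.2)
    (hin : ∀ P : Euc d, ‖P‖ ≤ r → (P, q' / 2 * ‖P‖ ^ 2) ∈ K)
    (hρ : 0 < ρ) (hρr : R * ρ ≤ r) (hρq : (R + 1 / R) * (q * ρ / 2) ≤ min (q * r / 2) 1) :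
    volume (convexHull ℝ (K ∪ {(0, -(q * ρ ^ 2 / 2))}) \ K)
      ≤ ENNReal.ofReal (ρ ^ d * (q * ρ ^ 2 / 2)) * volume (coneModelOuter d R) := by
  rw [← volume_image_scale hρ.le (by positivity)]
  refine measure_mono ((convexHull_diff_subset_of_sandwich hK h0 hr hq hR hqq hout hin hρ hρr
    hρq).trans ?_)
  rintro ⟨P, t⟩ ⟨h1, h2, h3⟩
  simp only at h1 h2 h3
  have hl : 0 < q * ρ ^ 2 / 2 := by positivity
  refine ⟨(ρ⁻¹ • P, t / (q * ρ ^ 2 / 2)), ⟨?_, ?_, ?_⟩, ?_⟩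
  · simp only [norm_smul, norm_inv, Real.norm_of_nonneg hρ.le]
    rw [inv_mul_le_iff₀ hρ]; linarith
  · simp only [norm_smul, norm_inv, Real.norm_of_nonneg hρ.le]
    rw [le_div_iff₀ hl]
    refine le_trans (le_of_eq ?_) h2
    field_simp
  · simp only [norm_smul, norm_inv, Real.norm_of_nonneg hρ.le]
    rw [div_le_iff₀ hl]
    refine h3.trans ?_
    have h4 : R ^ 2 * (ρ⁻¹ * ‖P‖) ^ 2 * (q * ρ ^ 2 / 2) = R ^ 2 * q / 2 * ‖P‖ ^ 2 := by
      field_simp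
    rw [h4]
    have h5 : R + 1 / R - 1 ≤ R ^ 2 := by
      have : 1 / R ≤ 1 := (div_le_one (by linarith)).2 hR.le
      nlinarith
    have h6 : q' ≤ R ^ 2 * q := hqq.trans (mul_le_mul_of_nonneg_right h5 hq.le)
    nlinarith [sq_nonneg ‖P‖]
  · ext1
    · simp only [smul_smul]; rw [mul_inv_cancel₀ hρ.ne', one_smul]
    · simp only; field_simp

theorem le_volume_convexHull_diff {d : ℕ} {K : Set (Euc d × ℝ)} {q q' r ρ θ : ℝ} (hq : 0 < q)
    (hqq : q ≤ q') (hθ : θ * q' ≤ q)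
    (hout : ∀ k ∈ K, ‖k.1‖ ≤ r → k.2 ≤ r → q / 2 * ‖k.1‖ ^ 2 ≤ k.2)
    (hin : ∀ P : Euc d, ‖P‖ ≤ r → (P, q' / 2 * ‖P‖ ^ 2) ∈ K)
    (hρ : 0 < ρ) (hρr : ρ ≤ r) (hρq : q / 2 * ρ ^ 2 ≤ r) :
    ENNReal.ofReal (ρ ^ d * (q' * ρ ^ 2 / 2)) * volume (coneModelInner d θ)
      ≤ volume (convexHull ℝ (K ∪ {(0, -(q' * ρ ^ 2 / 2))}) \ K) := by
  have hq' : 0 < q' := hq.trans_le hqq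
  rw [← volume_image_scale hρ.le (by positivity)]
  refine measure_mono (Subset.trans ?_ (subset_convexHull_diff_of_sandwich hq hqq hout hin hρ
    hρr hρq))
  rintro _ ⟨⟨P, t⟩, ⟨h1, h2, h3⟩, rfl⟩
  simp only at h1 h2 h3
  have hl : 0 < q' * ρ ^ 2 / 2 := by positivity
  refine ⟨?_, ?_, ?_⟩
  · simp only [norm_smul, Real.norm_of_nonneg hρ.le]; nlinarith
  · simp only [norm_smul, Real.norm_of_nonneg hρ.le]; nlinarith
  · simp only [norm_smul, Real.norm_of_nonneg hρ.le]
    have h4 := mul_lt_mul_of_pos_left h3 hl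
    have h5 := mul_le_mul_of_nonneg_right hθ (show 0 ≤ ρ ^ 2 * ‖P‖ ^ 2 / 2 by positivity)
    nlinarith

section GraphRegion

variable {d : ℕ}

/-- The point at signed depth `t` below the point `x₀ + L v` of the tangent hyperplane. -/
def graphPoint (L : Euc d →ₗᵢ[ℝ] Euc (d + 1)) (ν x₀ : Euc (d + 1)) (v : Euc d) (t : ℝ) :
    Euc (d + 1) :=
  x₀ + L v - t • ν

theorem inner_graphPoint {L : Euc d →ₗᵢ[ℝ] Euc (d + 1)} {ν : Euc (d + 1)} (hν : ‖ν‖ = 1)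
    (hL : ∀ v, ⟪L v, ν⟫ = 0) (x₀ : Euc (d + 1)) (v : Euc d) (t : ℝ) :
    ⟪graphPoint L ν x₀ v t, ν⟫ = ⟪x₀, ν⟫ - t := by
  simp only [graphPoint, inner_sub_left, inner_add_left, hL, real_inner_smul_left,
    real_inner_self_eq_norm_sq, hν]
  ring

theorem exists_mem_frontier {X : Type*} [TopologicalSpace X] {S T : Set X} (hT : IsPreconnected T)
    (hS : IsClosed S) (h₁ : (T ∩ S).Nonempty) (h₂ : (T ∩ Sᶜ).Nonempty) :
    (T ∩ frontier S).Nonempty := by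
  by_contra hc
  have hc' : ∀ z ∈ T, z ∈ S → z ∈ interior S := fun z hzT hzS => by
    by_contra h
    exact hc ⟨z, hzT, subset_closure hzS, h⟩
  obtain ⟨z, hzT, hz⟩ := h₁
  obtain ⟨y, -, hy, hy'⟩ := hT _ _ isOpen_interior hS.isOpen_compl
    (fun z hz => (em (z ∈ S)).imp (hc' z hz) id) ⟨z, hzT, hc' z hzT hz⟩ h₂
  exact hy' (interior_subset hy)

theorem graphPoint_inj {L : Euc d →ₗᵢ[ℝ] Euc (d + 1)} {ν : Euc (d + 1)} (hν : ‖ν‖ = 1)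
    (hL : ∀ v, ⟪L v, ν⟫ = 0) {x₀ : Euc (d + 1)} {v v' : Euc d} {t t' : ℝ}
    (h : graphPoint L ν x₀ v t = graphPoint L ν x₀ v' t') : v = v' ∧ t = t' := by
  have ht : t = t' := by
    have := congrArg (fun z => ⟪z, ν⟫) h
    simp only [inner_graphPoint hν hL] at this
    linarith
  subst ht
  refine ⟨L.injective ?_, rfl⟩
  simpa [graphPoint] using h

theorem norm_graphPoint_sub_le {L : Euc d →ₗᵢ[ℝ] Euc (d + 1)} {ν : Euc (d + 1)} (hν : ‖ν‖ = 1)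
    (x₀ : Euc (d + 1)) (v : Euc d) (t : ℝ) :
    ‖graphPoint L ν x₀ v t - x₀‖ ≤ ‖v‖ + |t| := by
  have : graphPoint L ν x₀ v t - x₀ = L v - t • ν := by simp [graphPoint]; abel
  rw [this]
  refine (norm_sub_le _ _).trans ?_
  rw [L.norm_map, norm_smul, hν, mul_one, Real.norm_eq_abs]

theorem norm_le_norm_graphPoint_sub {L : Euc d →ₗᵢ[ℝ] Euc (d + 1)} {ν : Euc (d + 1)}
    (hL : ∀ v, ⟪L v, ν⟫ = 0) (x₀ : Euc (d + 1)) (v : Euc d) (t : ℝ) :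
    ‖v‖ ≤ ‖graphPoint L ν x₀ v t - x₀‖ := by
  have : graphPoint L ν x₀ v t - x₀ = L v - t • ν := by simp [graphPoint]; abel
  rw [this, ← L.norm_map v]
  have h := norm_sub_sq_real (L v) (t • ν)
  rw [real_inner_smul_right, hL] at h
  refine le_of_sq_le_sq ?_ (norm_nonneg _)
  nlinarith [sq_nonneg ‖t • ν‖]

theorem inner_pos_of_isOuterNormalAt {n : ℕ} {S : Set (Euc n)} (h0 : (0 : Euc n) ∈ interior S)
    {x ν : Euc n} (hν : IsOuterNormalAt S x ν) : 0 < ⟪x, ν⟫ := by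
  obtain ⟨ρ, hρ, hb⟩ := Metric.mem_nhds_iff.1 (mem_interior_iff_mem_nhds.1 h0)
  have hmem : (ρ / 2) • ν ∈ S := by
    refine hb ?_
    rw [mem_ball_zero_iff, norm_smul, hν.1, Real.norm_of_nonneg (by positivity)]
    linarith
  have := hν.2 _ hmem
  rw [real_inner_smul_left, real_inner_self_eq_norm_sq, hν.1] at this
  linarith

/-- Near a boundary point, a convex body whose boundary is a graph coincides with the epigraph. -/
theorem exists_epigraph_region {S : Set (Euc (d + 1))} (hcl : IsClosed S) (hconv : Convex ℝ S)
    (h0 : (0 : Euc (d + 1)) ∈ interior S) {x₀ ν : Euc (d + 1)} (hx₀ : x₀ ∈ frontier S)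
    (hν : IsOuterNormalAt S x₀ ν) {L : Euc d →ₗᵢ[ℝ] Euc (d + 1)} {f : Euc d → ℝ} {τ ε : ℝ}
    (hτ : 0 < τ) (hε : 0 < ε) (hL : ∀ v, ⟪L v, ν⟫ = 0) (hf : ContinuousOn f (ball 0 τ))
    (hf0 : f 0 = 0) (hf' : HasFDerivAt f (0 : Euc d →L[ℝ] ℝ) 0)
    (hfr : frontier S ∩ ball x₀ ε
      = {y | ∃ v ∈ ball (0 : Euc d) τ, y = x₀ + L v - f v • ν} ∩ ball x₀ ε) :
    ∃ r > 0, r ≤ τ ∧ ∃ t₁ > 0,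
      (∀ v ∈ ball (0 : Euc d) r, ∀ t, graphPoint L ν x₀ v t ∈ S → f v ≤ t) ∧
      (∀ v ∈ ball (0 : Euc d) r, ∀ t, f v ≤ t → t ≤ t₁ → graphPoint L ν x₀ v t ∈ S) ∧
      (∀ v ∈ ball (0 : Euc d) r, graphPoint L ν x₀ v (f v) ∈ frontier S) := by
  have hm := inner_pos_of_isOuterNormalAt h0 hν
  set m := ⟪x₀, ν⟫ with hm_def
  have hx₀S : x₀ ∈ S := hcl.frontier_subset hx₀
  have hfcont : ContinuousAt f 0 := hf'.continuousAt
  obtain ⟨b, m', hb⟩ := frameMap_surjective hν.1 (L := L) hL x₀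
  have hmm : m' = m := by
    rw [hm_def, hb, inner_add_left, real_inner_smul_left, real_inner_self_eq_norm_sq, hν.1]
    have := hL b
    simp only [this]; ring
  have hsmall : ∀ᶠ v in 𝓝 (0 : Euc d), |f v| < ε / 6 := by
    have := hfcont.abs
    rw [ContinuousAt, hf0, abs_zero] at this
    exact this.eventually_lt_const (by positivity)
  obtain ⟨r₁, hr₁, hr₁f⟩ := Metric.eventually_nhds_iff_ball.1 hsmall
  set r := min τ (min r₁ (ε / 3)) with hr_def
  have hr : 0 < r := by positivity
  have hrτ : r ≤ τ := min_le_left _ _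
  have hrr₁ : r ≤ r₁ := (min_le_right _ _).trans (min_le_left _ _)
  have hrε : r ≤ ε / 3 := (min_le_right _ _).trans (min_le_right _ _)
  have hfv : ∀ v ∈ ball (0 : Euc d) r, |f v| < ε / 6 := fun v hv =>
    hr₁f v (ball_subset_ball hrr₁ hv)
  have hball : ∀ v ∈ ball (0 : Euc d) r, ∀ s, |s| < ε / 3 →
      graphPoint L ν x₀ v (f v + s) ∈ ball x₀ ε := by
    intro v hv s hs
    rw [mem_ball_iff_norm]
    have h1 := norm_graphPoint_sub_le hν.1 (L := L) x₀ v (f v + s)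
    have h2 := abs_add_le (f v) s
    have h3 := hfv v hv
    rw [mem_ball_zero_iff] at hv
    linarith
  have hnotfr : ∀ v ∈ ball (0 : Euc d) r, ∀ s, |s| < ε / 3 → s ≠ 0 →
      graphPoint L ν x₀ v (f v + s) ∉ frontier S := by
    intro v hv s hs hs0 hmem
    have : graphPoint L ν x₀ v (f v + s) ∈ frontier S ∩ ball x₀ ε := ⟨hmem, hball v hv s hs⟩
    rw [hfr] at this
    obtain ⟨⟨v', -, hv'⟩, -⟩ := this
    obtain ⟨rfl, h⟩ := graphPoint_inj hν.1 hL (x₀ := x₀) (t' := f v') hv'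
    exact hs0 (by linarith)
  have hfrmem : ∀ v ∈ ball (0 : Euc d) r, graphPoint L ν x₀ v (f v) ∈ frontier S := by
    intro v hv
    have h1 : graphPoint L ν x₀ v (f v) ∈ ball x₀ ε := by
      simpa using hball v hv 0 (by simpa using by positivity)
    have : graphPoint L ν x₀ v (f v) ∈
        {y | ∃ v ∈ ball (0 : Euc d) τ, y = x₀ + L v - f v • ν} ∩ ball x₀ ε :=
      ⟨⟨v, ball_subset_ball hrτ hv, rfl⟩, h1⟩
    rw [← hfr] at this
    exact this.1
  have hcontmap : ContinuousOn (fun q : Euc d × ℝ => graphPoint L ν x₀ q.1 (f q.1 + q.2))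
      (ball 0 r ×ˢ univ) := by
    have h1 : ContinuousOn (fun q : Euc d × ℝ => f q.1) (ball 0 r ×ˢ univ) :=
      (hf.mono (ball_subset_ball hrτ)).comp continuousOn_fst (fun q hq => hq.1)
    have h2 : Continuous fun q : Euc d × ℝ => x₀ + L q.1 := by
      have := L.continuous
      fun_prop
    exact h2.continuousOn.sub ((h1.add continuousOn_snd).smul continuousOn_const)
  have hdich : ∀ I : Set ℝ, IsPreconnected I → (∀ s ∈ I, |s| < ε / 3 ∧ s ≠ 0) →
      ∀ v ∈ ball (0 : Euc d) r, ∀ s ∈ I, ∀ v' ∈ ball (0 : Euc d) r, ∀ s' ∈ I,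
      graphPoint L ν x₀ v (f v + s) ∈ S → graphPoint L ν x₀ v' (f v' + s') ∈ S := by
    intro I hI hIs v hv s hs v' hv' s' hs' hmem
    by_contra hc
    have hpre : IsPreconnected ((fun q : Euc d × ℝ => graphPoint L ν x₀ q.1 (f q.1 + q.2)) ''
        (ball 0 r ×ˢ I)) :=
      (((convex_ball _ _).isPreconnected).prod hI).image _
        (hcontmap.mono (prod_mono_right (subset_univ _)))
    obtain ⟨z, ⟨q, hq, rfl⟩, hz⟩ := exists_mem_frontier hpre hcl
      ⟨_, ⟨(v, s), ⟨hv, hs⟩, rfl⟩, hmem⟩ ⟨_, ⟨(v', s'), ⟨hv', hs'⟩, rfl⟩, hc⟩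
    exact hnotfr q.1 hq.1 q.2 (hIs _ hq.2).1 (hIs _ hq.2).2 hz
  refine ⟨r, hr, hrτ, ε / 6, by positivity, ?_, ?_, hfrmem⟩
  · intro v hv t ht
    by_contra! hlt
    have ht0 : 0 ≤ t := by
      have := hν.2 _ ht
      rw [inner_graphPoint hν.1 hL] at this
      linarith
    have hfv' := abs_lt.1 (hfv v hv)
    have := hdich (Ioo (-(ε / 3)) 0) isPreconnected_Ioo
      (fun s hs => ⟨abs_lt.2 ⟨hs.1, by linarith [hs.2]⟩, hs.2.ne⟩) v hv (t - f v)
      ⟨by linarith, by linarith⟩ 0 (mem_ball_self hr) (-(ε / 6)) ⟨by linarith, by linarith⟩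
      (by simpa using ht)
    have := hν.2 _ this
    rw [inner_graphPoint hν.1 hL, hf0] at this
    linarith
  · intro v hv t hft ht
    rcases hft.eq_or_lt with rfl | hft
    · exact hcl.frontier_subset (hfrmem v hv)
    have hlo : ∀ᶠ v in 𝓝 (0 : Euc d), ‖f v‖ ≤ m / (2 * (‖b‖ + 1)) * ‖v‖ := by
      have := hf'.isLittleO
      simp only [hf0, sub_zero, zero_apply] at this
      exact this.def (by positivity)
    have hθ : ∀ᶠ θ in 𝓝[>] (0 : ℝ), ‖f (-(θ • b))‖ ≤ m / (2 * (‖b‖ + 1)) * ‖-(θ • b)‖ ∧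
        -(θ • b) ∈ ball (0 : Euc d) r ∧ θ < 1 ∧ θ * m < ε / 6 := by
      have ht : Tendsto (fun θ : ℝ => -(θ • b)) (𝓝[>] 0) (𝓝 0) := by
        have : Continuous fun θ : ℝ => -(θ • b) := by fun_prop
        have := this.tendsto 0
        simp only [zero_smul, neg_zero] at this
        exact this.mono_left nhdsWithin_le_nhds
      have h2 : Tendsto (fun θ : ℝ => θ * m) (𝓝[>] 0) (𝓝 0) := by
        have : Continuous fun θ : ℝ => θ * m := by fun_prop
        have := this.tendsto 0
        simp only [zero_mul] at this
        exact this.mono_left nhdsWithin_le_nhds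
      have h3 : Tendsto (fun θ : ℝ => θ) (𝓝[>] 0) (𝓝 0) := tendsto_id.mono_left nhdsWithin_le_nhds
      exact (ht.eventually hlo).and ((ht.eventually (ball_mem_nhds _ hr)).and
        ((h3.eventually_lt_const one_pos).and (h2.eventually_lt_const (by positivity))))
    obtain ⟨θ, ⟨h1, h2, h3, h4⟩, h5⟩ := (hθ.and self_mem_nhdsWithin).exists
    have h5 : 0 < θ := h5
    have hθm : |f (-(θ • b))| < θ * m := by
      rw [← Real.norm_eq_abs]
      refine h1.trans_lt ?_
      rw [norm_neg, norm_smul, Real.norm_of_nonneg h5.le, div_mul_eq_mul_div,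
        div_lt_iff₀ (by positivity)]
      have := mul_pos h5 hm
      nlinarith [norm_nonneg b]
    have hθm' := abs_lt.1 hθm
    have hfθ := abs_lt.1 (hfv _ h2)
    have hfv' := abs_lt.1 (hfv v hv)
    have hmem : graphPoint L ν x₀ (-(θ • b)) (θ * m) ∈ S := by
      have h6 : graphPoint L ν x₀ (-(θ • b)) (θ * m) = (1 - θ) • x₀ + θ • (0 : Euc (d + 1)) := by
        rw [graphPoint, map_neg, map_smul, smul_zero, add_zero, sub_smul, one_smul]
        conv_rhs => rw [show θ • x₀ = θ • (L b + m • ν) by rw [hb, hmm]]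
        rw [smul_add, smul_smul]
        abel
      rw [h6]
      exact hconv hx₀S (interior_subset h0) (by linarith) h5.le (by ring)
    have := hdich (Ioo 0 (ε / 3)) isPreconnected_Ioo
      (fun s hs => ⟨abs_lt.2 ⟨by linarith [hs.1], hs.2⟩, hs.1.ne'⟩) _ h2
      (θ * m - f (-(θ • b))) ⟨by linarith, by linarith⟩ v hv (t - f v)
      ⟨by linarith, by linarith⟩ (by simpa using hmem)
    simpa using this

end GraphRegion

section SecondOrder

theorem exists_taylor_bound {E : Type*} [NormedAddCommGroup E] [NormedSpace ℝ E] {f : E → ℝ}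
    (hf : ContDiffAt ℝ 2 f 0) {η : ℝ} (hη : 0 < η) :
    ∃ r > 0, ∀ v ∈ ball (0 : E) r, ∀ w ∈ ball (0 : E) r,
      |f v - f w - fderiv ℝ f w (v - w) - fderiv ℝ (fderiv ℝ f) 0 (v - w) (v - w) / 2|
        ≤ η * ‖v - w‖ ^ 2 := by
  set A := fderiv ℝ (fderiv ℝ f) 0 with hA
  have hsymm : ∀ v w, A v w = A w v := fun v w => (hf.isSymmSndFDerivAt (by simp)) v w
  have hstrict : HasStrictFDerivAt (fderiv ℝ f) A 0 :=
    (hf.fderiv_right (m := 1) (by norm_num)).hasStrictFDerivAt (by norm_num)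
  have h1 := hstrict.isLittleO.def hη
  have h2 : ∀ᶠ v in 𝓝 (0 : E), DifferentiableAt ℝ f v :=
    (hf.eventually (by simp)).mono fun v hv => hv.differentiableAt (by norm_num)
  obtain ⟨r₁, hr₁, h1⟩ := Metric.eventually_nhds_iff_ball.1 h1
  obtain ⟨r₂, hr₂, h2⟩ := Metric.eventually_nhds_iff_ball.1 h2
  refine ⟨min r₁ r₂, lt_min hr₁ hr₂, fun v hv w hw => ?_⟩
  have hsub : segment ℝ w v ⊆ ball (0 : E) (min r₁ r₂) := (convex_ball _ _).segment_subset hw hv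
  have hder : ∀ z ∈ segment ℝ w v, HasFDerivWithinAt
      (fun z => f z - f w - fderiv ℝ f w (z - w) - A (z - w) (z - w) / 2)
      (fderiv ℝ f z - fderiv ℝ f w - A (z - w)) (segment ℝ w v) z := by
    intro z hz
    have hz2 : DifferentiableAt ℝ f z :=
      h2 z (ball_subset_ball (min_le_right _ _) (hsub hz))
    have hid : HasFDerivAt (fun z : E => z - w) (ContinuousLinearMap.id ℝ E) z :=
      (hasFDerivAt_id z).sub_const w
    have hA1 : HasFDerivAt (fun z => A (z - w)) (A.comp (ContinuousLinearMap.id ℝ E)) z :=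
      A.hasFDerivAt.comp z hid
    have hA2 := hA1.clm_apply hid
    have hA3 := hA2.mul_const (1 / 2 : ℝ)
    have hlin : HasFDerivAt (fun z => fderiv ℝ f w (z - w))
        ((fderiv ℝ f w).comp (ContinuousLinearMap.id ℝ E)) z :=
      (fderiv ℝ f w).hasFDerivAt.comp z hid
    have := ((hz2.hasFDerivAt.sub_const (f w)).sub hlin).sub hA3
    refine (this.congr_fderiv ?_).hasFDerivWithinAt.congr_of_eventuallyEq
      (Eventually.of_forall fun z => ?_) ?_
    · ext y
      have := hsymm y (z - w)
      simp at this ⊢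
      linarith
    · simp; ring
    · simp; ring
  have hbound : ∀ z ∈ segment ℝ w v,
      ‖fderiv ℝ f z - fderiv ℝ f w - A (z - w)‖ ≤ η * ‖v - w‖ := by
    intro z hz
    have hzr := ball_subset_ball (min_le_left _ _) (hsub hz)
    have hwr := ball_subset_ball (min_le_left _ _) hw
    have h3 := h1 (z, w) (by
      rw [mem_ball, Prod.dist_eq, max_lt_iff]
      exact ⟨hzr, hwr⟩)
    refine h3.trans (mul_le_mul_of_nonneg_left ?_ hη.le)
    have := norm_sub_le_of_mem_segment hz
    exact this
  have := (convex_segment w v).norm_image_sub_le_of_norm_hasFDerivWithin_le hder hbound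
    (left_mem_segment ℝ w v) (right_mem_segment ℝ w v)
  simp only [sub_self, map_zero, zero_div, sub_zero] at this
  rw [← Real.norm_eq_abs]
  refine this.trans (le_of_eq ?_)
  ring

end SecondOrder

section Factor

open scoped MatrixOrder Matrix

theorem exists_linearEquiv_of_posSemidef {d : ℕ} {M : Matrix (Fin d) (Fin d) ℝ}
    (hM : M.PosSemidef) (hdet : 0 < M.det) :
    ∃ J : Euc d ≃ₗ[ℝ] Euc d, LinearMap.det (J : Euc d →ₗ[ℝ] Euc d) ^ 2 = M.det ∧
      ∀ v : Euc d, ‖J v‖ ^ 2 = v.ofLp ⬝ᵥ M *ᵥ v.ofLp := by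
  set B := CFC.sqrt M with hB
  have hBB : B * B = M := CFC.sqrt_mul_sqrt_self M hM.nonneg
  have hBH : Bᵀ = B := by
    have := (Matrix.nonneg_iff_posSemidef.1 (CFC.sqrt_nonneg M)).isHermitian
    simpa [Matrix.IsHermitian] using this
  have hdB : B.det ^ 2 = M.det := by rw [← hBB, Matrix.det_mul, sq]
  have hdet' : LinearMap.det (Matrix.toEuclideanLin B) = B.det := by
    simp
  have hu : LinearMap.det (Matrix.toEuclideanLin B) ≠ 0 := by
    rw [hdet']
    intro h
    rw [h] at hdB
    simp only [ne_eq, OfNat.ofNat_ne_zero, not_false_eq_true, zero_pow] at hdB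
    linarith
  refine ⟨LinearMap.equivOfDetNeZero _ hu, ?_, fun v => ?_⟩
  · rw [LinearMap.equivOfDetNeZero, LinearEquiv.coe_ofIsUnitDet, hdet', hdB]
  · change ‖Matrix.toEuclideanLin B v‖ ^ 2 = _
    rw [EuclideanSpace.real_norm_sq_eq, ← hBB]
    nth_rewrite 2 [← hBH]
    rw [← Matrix.mulVec_mulVec, Matrix.dotProduct_mulVec, Matrix.vecMul_transpose]
    simp [dotProduct, sq]

/-- Factorization of a (possibly perturbed) positive semidefinite bilinear form. -/
theorem exists_linearEquiv_of_bilin {d : ℕ} {A : Euc d →L[ℝ] Euc d →L[ℝ] ℝ}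
    (hsymm : ∀ v w, A v w = A w v) (hnn : ∀ v, 0 ≤ A v v) {k : ℝ}
    (hk : k = (Matrix.of fun i j : Fin d =>
      A (EuclideanSpace.single i 1) (EuclideanSpace.single j 1)).det) :
    0 ≤ k ∧
    (0 < k → ∃ J : Euc d ≃ₗ[ℝ] Euc d, LinearMap.det (J : Euc d →ₗ[ℝ] Euc d) ^ 2 = k ∧
      ∀ v : Euc d, ‖J v‖ ^ 2 = A v v) ∧
    ∀ k' > k, ∃ J : Euc d ≃ₗ[ℝ] Euc d, LinearMap.det (J : Euc d →ₗ[ℝ] Euc d) ^ 2 ≤ k' ∧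
      ∃ η > 0, ∀ v : Euc d, ‖J v‖ ^ 2 = A v v + η * ‖v‖ ^ 2 := by
  set M : Matrix (Fin d) (Fin d) ℝ := Matrix.of fun i j : Fin d =>
      A (EuclideanSpace.single i 1) (EuclideanSpace.single j 1) with hM_def
  have hMA : ∀ v : Euc d, v.ofLp ⬝ᵥ M *ᵥ v.ofLp = A v v := by
    intro v
    have hv : v = ∑ i, v i • EuclideanSpace.single i (1 : ℝ) := by
      have := (EuclideanSpace.basisFun (Fin d) ℝ).sum_repr v
      simpa using this.symm
    conv_rhs => rw [hv]
    simp only [map_sum, map_smul, sum_apply, smul_apply,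
      smul_eq_mul, dotProduct, Matrix.mulVec, hM_def, Matrix.of_apply, Finset.mul_sum]
    rw [Finset.sum_comm]
    refine Finset.sum_congr rfl fun i _ => Finset.sum_congr rfl fun j _ => ?_
    ring
  have hpsd : M.PosSemidef := by
    refine .of_dotProduct_mulVec_nonneg ?_ fun x => ?_
    · ext i j
      simp [hM_def, hsymm (EuclideanSpace.single i 1)]
    · have := hMA (WithLp.toLp 2 x)
      simp only at this
      rw [star_trivial, this]
      exact hnn _
  refine ⟨hk ▸ hpsd.det_nonneg, fun h => ?_, fun k' hk' => ?_⟩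
  · obtain ⟨J, hJ, hJ'⟩ := exists_linearEquiv_of_posSemidef hpsd (hk ▸ h)
    exact ⟨J, hJ.trans hk.symm, fun v => (hJ' v).trans (hMA v)⟩
  · have hcont : Continuous fun η : ℝ => (M + η • (1 : Matrix (Fin d) (Fin d) ℝ)).det := by
      fun_prop
    have h0 : ∀ᶠ η in 𝓝[>] (0 : ℝ), (M + η • (1 : Matrix (Fin d) (Fin d) ℝ)).det < k' := by
      have := hcont.tendsto 0
      simp only [zero_smul, add_zero, ← hk] at this
      exact (this.eventually_lt_const hk').filter_mono nhdsWithin_le_nhds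
    obtain ⟨η, h1, hη⟩ := (h0.and self_mem_nhdsWithin).exists
    have hη : 0 < η := hη
    have hpd : (M + η • (1 : Matrix (Fin d) (Fin d) ℝ)).PosDef :=
      Matrix.PosDef.posSemidef_add hpsd (Matrix.PosDef.one.smul hη)
    obtain ⟨J, hJ, hJ'⟩ := exists_linearEquiv_of_posSemidef hpd.posSemidef hpd.det_pos
    refine ⟨J, hJ.le.trans h1.le, η, hη, fun v => ?_⟩
    rw [hJ', Matrix.add_mulVec, dotProduct_add, hMA, Matrix.smul_mulVec, Matrix.one_mulVec,
      dotProduct_smul, EuclideanSpace.real_norm_sq_eq]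
    simp [dotProduct, sq]

end Factor

section LocalModel

variable {d : ℕ}

/-- Affine coordinates `(u, τ)` around a boundary point `x` at which `ν + L p` is an outer normal;
`τ` measures the depth below the supporting hyperplane. -/
def localMap (L : Euc d →ₗᵢ[ℝ] Euc (d + 1)) (ν : Euc (d + 1)) (J : Euc d ≃ₗ[ℝ] Euc d)
    (x : Euc (d + 1)) (p : Euc d) (q : Euc d × ℝ) : Euc (d + 1) :=
  x + chartMap L ν J.symm.toLinearMap (-1) (-(innerₛₗ ℝ p)) 0 q

theorem localMap_apply (L : Euc d →ₗᵢ[ℝ] Euc (d + 1)) (ν : Euc (d + 1)) (J : Euc d ≃ₗ[ℝ] Euc d)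
    (x : Euc (d + 1)) (p : Euc d) (q : Euc d × ℝ) :
    localMap L ν J x p q = x + L (J.symm q.1) - (q.2 + ⟪p, J.symm q.1⟫) • ν := by
  rw [localMap, chartMap_apply]
  simp only [LinearEquiv.coe_coe, smul_zero, add_zero, LinearMap.neg_apply, innerₛₗ_apply_apply]
  module

/-- In the coordinates `localMap` the body `S` lies between two paraboloids near `x`, and `y` is the
polar point dual to `x`. -/
structure LocalModel (S : Set (Euc (d + 1))) (L : Euc d →ₗᵢ[ℝ] Euc (d + 1)) (ν : Euc (d + 1))
    (J : Euc d ≃ₗ[ℝ] Euc d) (x y : Euc (d + 1)) (p : Euc d) (g cm cp r : ℝ) : Prop where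
  pos : 0 < g
  inner_eq : ⟪x, ν + L p⟫ = g
  dual_eq : y = g⁻¹ • (ν + L p)
  upper : ∀ u τ, ‖u‖ ≤ r → cp / 2 * ‖u‖ ^ 2 ≤ τ → τ ≤ r → localMap L ν J x p (u, τ) ∈ S
  lower : ∀ u τ, localMap L ν J x p (u, τ) ∈ S → ‖u‖ ≤ r → cm / 2 * ‖u‖ ^ 2 ≤ τ

theorem exists_localModel {S : Set (Euc (d + 1))} (hcl : IsClosed S) (hconv : Convex ℝ S)
    (h0 : (0 : Euc (d + 1)) ∈ interior S) {x₀ ν : Euc (d + 1)} (hx₀ : x₀ ∈ frontier S)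
    (hν : IsOuterNormalAt S x₀ ν) {L : Euc d →ₗᵢ[ℝ] Euc (d + 1)} {f : Euc d → ℝ} {τ ε : ℝ}
    (hτ : 0 < τ) (hε : 0 < ε) (hL : ∀ v, ⟪L v, ν⟫ = 0) (hf : ContDiffOn ℝ 2 f (ball 0 τ))
    (hf0 : f 0 = 0) (hf' : fderiv ℝ f 0 = 0)
    (hfr : frontier S ∩ ball x₀ ε
      = {y | ∃ v ∈ ball (0 : Euc d) τ, y = x₀ + L v - f v • ν} ∩ ball x₀ ε)
    (J : Euc d ≃ₗ[ℝ] Euc d) {cm cp : ℝ}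
    (hrem : ∃ r₀ > 0, ∀ v ∈ ball (0 : Euc d) r₀, ∀ w ∈ ball (0 : Euc d) r₀,
      cm / 2 * ‖J (v - w)‖ ^ 2 ≤ f v - f w - fderiv ℝ f w (v - w) ∧
      f v - f w - fderiv ℝ f w (v - w) ≤ cp / 2 * ‖J (v - w)‖ ^ 2) :
    ∃ r > 0, ∀ γ > 0, ∀ᶠ x in 𝓝[frontier S] x₀, ∀ y ∈ polarBody S, ⟪x, y⟫ = 1 →
      ∃ p g, LocalModel S L ν J x y p g cm cp r ∧ |g - ⟪x₀, ν⟫| < γ := by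
  have hm := inner_pos_of_isOuterNormalAt h0 hν
  have hcd : ContDiffAt ℝ 2 f 0 := hf.contDiffAt (ball_mem_nhds _ hτ)
  have hd0 : HasFDerivAt f (0 : Euc d →L[ℝ] ℝ) 0 := by
    rw [← hf']
    exact (hcd.differentiableAt (by norm_num)).hasFDerivAt
  obtain ⟨r₁, hr₁, hr₁τ, t₁, ht₁, hlow, hup, hfrm⟩ :=
    exists_epigraph_region hcl hconv h0 hx₀ hν hτ hε hL hf.continuousOn hf0 hd0 hfr
  obtain ⟨r₀, hr₀, hrem⟩ := hrem
  obtain ⟨C, hC, hJC⟩ : ∃ C > 0, ∀ u, ‖J.symm u‖ ≤ C * ‖u‖ := by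
    obtain ⟨C, hC, h⟩ := (LinearMap.toContinuousLinearMap J.symm.toLinearMap).bound
    exact ⟨C, hC, h⟩
  set ρ := min r₀ r₁ / 2 with hρ_def
  have hρ : 0 < ρ := by positivity
  have hρ0 : 2 * ρ ≤ r₀ := by rw [hρ_def]; linarith [min_le_left r₀ r₁]
  have hρ1 : 2 * ρ ≤ r₁ := by rw [hρ_def]; linarith [min_le_right r₀ r₁]
  set r := min (ρ / (2 * C)) (t₁ / 2) with hr_def
  have hr : 0 < r := by positivity
  have hrC : C * r < ρ := by
    have : r ≤ ρ / (2 * C) := min_le_left _ _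
    rw [le_div_iff₀ (by positivity)] at this
    nlinarith
  have hrt : r ≤ t₁ / 2 := min_le_right _ _
  refine ⟨r, hr, fun γ hγ => ?_⟩
  set G : Euc d → Euc d := fun v => (InnerProductSpace.toDual ℝ (Euc d)).symm (fderiv ℝ f v)
    with hG_def
  have hGi : ∀ v w, ⟪G v, w⟫ = fderiv ℝ f v w := fun v w => by
    simp [hG_def]
  have hfc : ContinuousAt f 0 := hd0.continuousAt
  have hf'c : ContinuousAt (fderiv ℝ f) 0 :=
    (hcd.fderiv_right (m := 1) (by norm_num)).continuousAt
  have hGc : ContinuousAt G 0 :=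
    ((InnerProductSpace.toDual ℝ (Euc d)).symm.continuous.continuousAt).comp hf'c
  have hG0 : G 0 = 0 := by simp [hG_def, hf']
  have hgc : ContinuousAt (fun v => ⟪graphPoint L ν x₀ v (f v), ν + L (G v)⟫) 0 := by
    have h1 : ContinuousAt (fun v => L (G v)) 0 := L.continuous.continuousAt.comp hGc
    have h2 : ContinuousAt (fun v => graphPoint L ν x₀ v (f v)) 0 := by
      have : ContinuousAt (fun v => x₀ + L v) 0 :=
        (continuous_const.add L.continuous).continuousAt
      exact this.sub (hfc.smul continuousAt_const)
    exact h2.inner (continuousAt_const.add h1)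
  have hev : ∀ᶠ v in 𝓝 (0 : Euc d), |f v| < t₁ / 4 ∧ ‖G v‖ < t₁ / (4 * ρ) ∧
      |⟪graphPoint L ν x₀ v (f v), ν + L (G v)⟫ - ⟪x₀, ν⟫| < min γ ⟪x₀, ν⟫ ∧
      v ∈ ball (0 : Euc d) ρ := by
    refine .and ?_ (.and ?_ (.and ?_ (ball_mem_nhds _ hρ)))
    · have := hfc.abs.tendsto
      simp only [hf0, abs_zero] at this
      exact this.eventually_lt_const (by positivity)
    · have := hGc.norm.tendsto
      simp only [hG0, norm_zero] at this
      exact this.eventually_lt_const (by positivity)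
    · have := hgc.tendsto
      simp only [hf0, hG0, graphPoint, map_zero, zero_smul, add_zero, sub_zero] at this
      exact this.eventually (ball_mem_nhds _ (lt_min hγ hm))
  obtain ⟨ρ', hρ', hev⟩ := Metric.eventually_nhds_iff_ball.1 hev
  have hnear : ∀ᶠ x in 𝓝[frontier S] x₀, x ∈ frontier S ∩ ball x₀ (min ε ρ') :=
    inter_mem self_mem_nhdsWithin (mem_nhdsWithin_of_mem_nhds (ball_mem_nhds _ (by positivity)))
  filter_upwards [hnear]
  rintro x ⟨hxf, hxb⟩ y hy hxy
  have hxε : x ∈ frontier S ∩ ball x₀ ε := ⟨hxf, ball_subset_ball (min_le_left _ _) hxb⟩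
  rw [hfr] at hxε
  obtain ⟨⟨v₁, hv₁τ, hxv⟩, -⟩ := hxε
  change x = graphPoint L ν x₀ v₁ (f v₁) at hxv
  have hv₁ : v₁ ∈ ball (0 : Euc d) ρ' := by
    rw [mem_ball_zero_iff]
    refine (norm_le_norm_graphPoint_sub hL x₀ v₁ (f v₁)).trans_lt ?_
    rw [← hxv, ← mem_ball_iff_norm]
    exact ball_subset_ball (min_le_right _ _) hxb
  obtain ⟨hfv, hGv, hgv, hvρ⟩ := hev v₁ hv₁
  rw [← hxv] at hgv
  rw [mem_ball_zero_iff] at hvρ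
  have hg : 0 < ⟪x, ν + L (G v₁)⟫ := by
    have := (abs_lt.1 (hgv.trans_le (min_le_right _ _))).1
    linarith
  have hv₁r₀ : v₁ ∈ ball (0 : Euc d) r₀ := by rw [mem_ball_zero_iff]; linarith
  have hv₁r₁ : v₁ ∈ ball (0 : Euc d) r₁ := by rw [mem_ball_zero_iff]; linarith
  have hloc : ∀ u t, localMap L ν J x (G v₁) (u, t)
      = graphPoint L ν x₀ (v₁ + J.symm u) (f v₁ + t + fderiv ℝ f v₁ (J.symm u)) := by
    intro u t
    rw [localMap_apply, hxv, hGi]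
    simp only [graphPoint, map_add]
    module
  have hball : ∀ u, ‖u‖ ≤ r → ‖J.symm u‖ < ρ := fun u hu =>
    ((hJC u).trans (mul_le_mul_of_nonneg_left hu hC.le)).trans_lt hrC
  refine ⟨G v₁, _, ⟨hg, rfl, ?_, ?_, ?_⟩, hgv.trans_le (min_le_left _ _)⟩
  · obtain ⟨w, c, hwc⟩ := frameMap_surjective hν.1 hL y
    have hdv : DifferentiableAt ℝ f v₁ :=
      (hf.contDiffAt (isOpen_ball.mem_nhds hv₁τ)).differentiableAt (by norm_num)
    have hval : ∀ v, ⟪graphPoint L ν x₀ v (f v), y⟫ = ⟪x₀, y⟫ + (⟪w, v⟫ - c * f v) := by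
      intro v
      have hL' : ∀ v, ⟪ν, L v⟫ = 0 := fun v => by rw [real_inner_comm, hL]
      rw [hwc]
      simp only [graphPoint, inner_sub_left, inner_add_left, inner_add_right, real_inner_smul_left,
        real_inner_smul_right, hL, hL', real_inner_self_eq_norm_sq, hν.1, L.inner_map_map,
        real_inner_comm w v]
      ring
    have hmax : IsLocalMax (fun v => ⟪w, v⟫ - c * f v) v₁ := by
      filter_upwards [isOpen_ball.mem_nhds hv₁r₁] with v hv
      have h1 := hy _ (hcl.frontier_subset (hfrm v hv))
      have h2 : ⟪graphPoint L ν x₀ v₁ (f v₁), y⟫ = 1 := by rw [← hxv, hxy]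
      rw [hval] at h1 h2
      linarith
    have hder : HasFDerivAt (fun v => ⟪w, v⟫ - c * f v) (innerSL ℝ w - c • fderiv ℝ f v₁) v₁ :=
      (innerSL ℝ w).hasFDerivAt.sub (hdv.hasFDerivAt.const_mul c)
    have hzero := hmax.hasFDerivAt_eq_zero hder
    have hw : w = c • G v₁ := by
      refine ext_inner_right ℝ fun z => ?_
      have := congrArg (fun φ : Euc d →L[ℝ] ℝ => φ z) hzero
      simp at this
      rw [real_inner_smul_left, hGi]
      linarith
    have hyc : y = c • (ν + L (G v₁)) := by
      rw [hwc, hw, map_smul, smul_add]; exact add_comm _ _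
    have hc : c = ⟪x, ν + L (G v₁)⟫⁻¹ := by
      rw [hyc, real_inner_smul_right] at hxy
      exact eq_inv_of_mul_eq_one_left hxy
    rw [← hc]; exact hyc
  · intro u t hu h1 h2
    rw [hloc]
    have hb := hball u hu
    have hn : ‖v₁ + J.symm u‖ < 2 * ρ := (norm_add_le _ _).trans_lt (by linarith)
    have hr := (hrem (v₁ + J.symm u) (by rw [mem_ball_zero_iff]; linarith) v₁ hv₁r₀).2
    rw [add_sub_cancel_left, J.apply_symm_apply] at hr
    refine hup _ (by rw [mem_ball_zero_iff]; linarith) _ (by linarith) ?_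
    have h3 : fderiv ℝ f v₁ (J.symm u) ≤ t₁ / 4 := by
      rw [← hGi]
      refine (real_inner_le_norm _ _).trans ?_
      calc ‖G v₁‖ * ‖J.symm u‖ ≤ t₁ / (4 * ρ) * ρ := by gcongr
        _ = t₁ / 4 := by field_simp
    linarith [le_abs_self (f v₁)]
  · intro u t hmem hu
    rw [hloc] at hmem
    have hb := hball u hu
    have hn : ‖v₁ + J.symm u‖ < 2 * ρ := (norm_add_le _ _).trans_lt (by linarith)
    have hr := (hrem (v₁ + J.symm u) (by rw [mem_ball_zero_iff]; linarith) v₁ hv₁r₀).1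
    rw [add_sub_cancel_left, J.apply_symm_apply] at hr
    have := hlow _ (by rw [mem_ball_zero_iff]; linarith) _ hmem
    linarith

end LocalModel

section AdaptedFrame

variable {d : ℕ}

theorem hessian_nonneg {E : Type*} [NormedAddCommGroup E] [NormedSpace ℝ E] {f : E → ℝ}
    (hf : ContDiffAt ℝ 2 f 0) (hf0 : f 0 = 0) (hf' : fderiv ℝ f 0 = 0)
    (hnn : ∀ᶠ v in 𝓝 0, 0 ≤ f v) (z : E) : 0 ≤ fderiv ℝ (fderiv ℝ f) 0 z z := by
  set A := fderiv ℝ (fderiv ℝ f) 0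
  have key : ∀ η > 0, 0 ≤ A z z / 2 + η * ‖z‖ ^ 2 := by
    intro η hη
    obtain ⟨r, hr, h⟩ := exists_taylor_bound hf hη
    have ht : Tendsto (fun s : ℝ => s • z) (𝓝[>] 0) (𝓝 0) := by
      have : Continuous fun s : ℝ => s • z := by fun_prop
      have := this.tendsto 0
      rw [zero_smul] at this
      exact this.mono_left nhdsWithin_le_nhds
    obtain ⟨s, ⟨hs1, hs2⟩, hs⟩ := ((ht.eventually (hnn.and (ball_mem_nhds _ hr))).and
      self_mem_nhdsWithin).exists
    have hs : 0 < s := hs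
    have h1 := (abs_le.1 (h _ hs2 0 (mem_ball_self hr))).2
    simp only [sub_zero, hf0, hf', zero_apply, map_smul, smul_apply, smul_eq_mul, norm_smul,
      Real.norm_of_nonneg hs.le] at h1
    have h2 : 0 ≤ s ^ 2 * (A z z / 2 + η * ‖z‖ ^ 2) := by nlinarith
    exact nonneg_of_mul_nonneg_right h2 (by positivity)
  by_contra! hneg
  have := key (-(A z z) / (4 * (‖z‖ ^ 2 + 1))) (by
    have : 0 < -(A z z) := by linarith
    positivity)
  rw [div_mul_eq_mul_div] at this
  have h3 : -(A z z) * ‖z‖ ^ 2 / (4 * (‖z‖ ^ 2 + 1)) ≤ -(A z z) / 4 := by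
    rw [div_le_div_iff₀ (by positivity) (by norm_num)]
    nlinarith
  linarith

/-- At every boundary point of a convex body with `C²` boundary there are linear coordinates in
which the body is approximated by paraboloids, uniformly in a neighborhood of the point; the
determinant of the coordinate change is controlled by the curvature. -/
theorem exists_adapted_frame {S : Set (Euc (d + 1))} (hcl : IsClosed S) (hconv : Convex ℝ S)
    (h0 : (0 : Euc (d + 1)) ∈ interior S) {x₀ ν : Euc (d + 1)} (hx₀ : x₀ ∈ frontier S)
    (hν : IsOuterNormalAt S x₀ ν) {k : ℝ} (hk : IsGaussCurvatureAt S x₀ ν k) :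
    0 ≤ k ∧ ∃ L : Euc d →ₗᵢ[ℝ] Euc (d + 1), (∀ v, ⟪L v, ν⟫ = 0) ∧
      (0 < k → ∃ J : Euc d ≃ₗ[ℝ] Euc d, LinearMap.det (J : Euc d →ₗ[ℝ] Euc d) ^ 2 = k ∧
        ∀ η > 0, ∃ r > 0, ∀ γ > 0, ∀ᶠ x in 𝓝[frontier S] x₀, ∀ y ∈ polarBody S, ⟪x, y⟫ = 1 →
          ∃ p g, LocalModel S L ν J x y p g (1 - η) (1 + η) r ∧ |g - ⟪x₀, ν⟫| < γ) ∧
      ∀ k' > k, ∃ J : Euc d ≃ₗ[ℝ] Euc d, LinearMap.det (J : Euc d →ₗ[ℝ] Euc d) ^ 2 ≤ k' ∧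
        ∃ r > 0, ∃ cm, ∀ γ > 0, ∀ᶠ x in 𝓝[frontier S] x₀, ∀ y ∈ polarBody S, ⟪x, y⟫ = 1 →
          ∃ p g, LocalModel S L ν J x y p g cm 1 r ∧ |g - ⟪x₀, ν⟫| < γ := by
  obtain ⟨L, f, τ, ε, hτ, hε, hL, hf, hf0, hf', hfr, hk⟩ := hk
  change Euc d →ₗᵢ[ℝ] Euc (d + 1) at L
  change Euc d → ℝ at f
  have hcd : ContDiffAt ℝ 2 f 0 := hf.contDiffAt (ball_mem_nhds _ hτ)
  have hd0 : HasFDerivAt f (0 : Euc d →L[ℝ] ℝ) 0 := by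
    rw [← hf']
    exact (hcd.differentiableAt (by norm_num)).hasFDerivAt
  have hnn : ∀ᶠ v in 𝓝 (0 : Euc d), 0 ≤ f v := by
    obtain ⟨r₁, hr₁, -, -, -, -, -, hfrm⟩ :=
      exists_epigraph_region hcl hconv h0 hx₀ hν hτ hε hL hf.continuousOn hf0 hd0 hfr
    filter_upwards [ball_mem_nhds _ hr₁] with v hv
    have := hν.2 _ (hcl.frontier_subset (hfrm v hv))
    rw [inner_graphPoint hν.1 hL] at this
    linarith
  set A := fderiv ℝ (fderiv ℝ f) 0 with hA
  have hsymm : ∀ v w, A v w = A w v := fun v w => (hcd.isSymmSndFDerivAt (by simp)) v w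
  have hAnn : ∀ v, 0 ≤ A v v := hessian_nonneg hcd hf0 hf' hnn
  have hk' : k = (Matrix.of fun i j : Fin d =>
      A (EuclideanSpace.single i 1) (EuclideanSpace.single j 1)).det := by
    rw [hk]
    congr 1
    ext i j
    simp only [Matrix.of_apply]
    rw [iteratedFDeriv_two_apply]
    rfl
  obtain ⟨hk0, hpos, hgt⟩ := exists_linearEquiv_of_bilin hsymm hAnn hk'
  refine ⟨hk0, L, hL, fun hk => ?_, fun k' hk' => ?_⟩
  · obtain ⟨J, hJ, hJA⟩ := hpos hk
    refine ⟨J, hJ, fun η hη => exists_localModel hcl hconv h0 hx₀ hν hτ hε hL hf hf0 hf' hfr J ?_⟩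
    obtain ⟨C, hC, hJC⟩ := (LinearMap.toContinuousLinearMap J.symm.toLinearMap).bound
    obtain ⟨r₀, hr₀, h⟩ := exists_taylor_bound hcd (show 0 < η / (2 * C ^ 2) by positivity)
    refine ⟨r₀, hr₀, fun v hv w hw => ?_⟩
    have h1 := abs_le.1 (h v hv w hw)
    have h2 : ‖v - w‖ ≤ C * ‖J (v - w)‖ := by
      have := hJC (J (v - w))
      simpa using this
    have h3 : η / (2 * C ^ 2) * ‖v - w‖ ^ 2 ≤ η / 2 * ‖J (v - w)‖ ^ 2 := by
      calc η / (2 * C ^ 2) * ‖v - w‖ ^ 2 ≤ η / (2 * C ^ 2) * (C * ‖J (v - w)‖) ^ 2 := by gcongr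
        _ = η / 2 * ‖J (v - w)‖ ^ 2 := by field_simp
    have h4 := hJA (v - w)
    constructor <;> linarith
  · obtain ⟨J, hJ, η, hη, hJA⟩ := hgt k' hk'
    obtain ⟨C, hC, hJC⟩ := (LinearMap.toContinuousLinearMap J.symm.toLinearMap).bound
    obtain ⟨r₀, hr₀, h⟩ := exists_taylor_bound hcd (show 0 < η / 2 by positivity)
    refine ⟨J, hJ, ?_⟩
    have := exists_localModel hcl hconv h0 hx₀ hν hτ hε hL hf hf0 hf' hfr J
      (cm := -(η * C ^ 2)) (cp := 1) ⟨r₀, hr₀, fun v hv w hw => ?_⟩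
    · obtain ⟨r, hr, h⟩ := this
      exact ⟨r, hr, _, h⟩
    have h1 := abs_le.1 (h v hv w hw)
    have h2 : ‖v - w‖ ≤ C * ‖J (v - w)‖ := by
      have := hJC (J (v - w))
      simpa using this
    have h3 : ‖v - w‖ ^ 2 ≤ C ^ 2 * ‖J (v - w)‖ ^ 2 := by
      rw [← mul_pow]; gcongr
    have h4 := hJA (v - w)
    have h5 := hAnn (v - w)
    constructor
    · nlinarith
    · linarith

end AdaptedFrame

section Caps

variable {d : ℕ} {S : Set (Euc (d + 1))} {L : Euc d →ₗᵢ[ℝ] Euc (d + 1)} {ν x y : Euc (d + 1)}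
  {J : Euc d ≃ₗ[ℝ] Euc d} {p : Euc d} {g cm cp r : ℝ}

theorem volume_image_localMap (hν : ‖ν‖ = 1) (hL : ∀ v, ⟪L v, ν⟫ = 0) (J : Euc d ≃ₗ[ℝ] Euc d)
    (x : Euc (d + 1)) (p : Euc d) (M : Set (Euc d × ℝ)) :
    volume (localMap L ν J x p '' M)
      = ENNReal.ofReal |LinearMap.det (J : Euc d →ₗ[ℝ] Euc d)|⁻¹ * volume M := by
  have := volume_image_chartMap hν hL J.symm.toLinearMap (-1) (-(innerₛₗ ℝ p)) 0 x M
  rw [show (localMap L ν J x p) = fun q => x + chartMap L ν J.symm.toLinearMap (-1)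
    (-(innerₛₗ ℝ p)) 0 q from rfl, this]
  congr 2
  rw [abs_neg, abs_one, mul_one]
  rw [← abs_inv]
  congr 1
  have := LinearEquiv.det_mul_det_symm J
  exact eq_inv_of_mul_eq_one_right this

theorem LocalModel.inner_localMap (hM : LocalModel S L ν J x y p g cm cp r) (hν : ‖ν‖ = 1)
    (hL : ∀ v, ⟪L v, ν⟫ = 0) (q : Euc d × ℝ) :
    ⟪y, localMap L ν J x p q⟫ = 1 - q.2 / g := by
  have hL' : ∀ v, ⟪ν, L v⟫ = 0 := fun v => by rw [real_inner_comm, hL]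
  have hg := hM.pos
  have h : ⟪ν, x⟫ + ⟪L p, x⟫ = g := by
    rw [← inner_add_left, real_inner_comm, hM.inner_eq]
  rw [hM.dual_eq, localMap_apply, real_inner_smul_left]
  simp only [inner_sub_right, inner_add_right, inner_add_left, real_inner_smul_right, hL, hL',
    real_inner_self_eq_norm_sq, hν, L.inner_map_map]
  field_simp
  linarith

theorem localMap_surjective (hν : ‖ν‖ = 1) (hL : ∀ v, ⟪L v, ν⟫ = 0) (J : Euc d ≃ₗ[ℝ] Euc d)
    (x : Euc (d + 1)) (p : Euc d) : Function.Surjective (localMap L ν J x p) := by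
  intro z
  obtain ⟨v, s, h⟩ := frameMap_surjective hν hL (z - x)
  refine ⟨(J v, -s - ⟪p, v⟫), ?_⟩
  rw [localMap_apply]
  simp only [J.symm_apply_apply]
  rw [show z = x + (z - x) by abel, h]
  module

theorem localMap_zero (L : Euc d →ₗᵢ[ℝ] Euc (d + 1)) (ν : Euc (d + 1)) (J : Euc d ≃ₗ[ℝ] Euc d)
    (x : Euc (d + 1)) (p : Euc d) : localMap L ν J x p 0 = x := by
  simp [localMap_apply]

theorem convex_preimage_localMap (hconv : Convex ℝ S) :
    Convex ℝ (localMap L ν J x p ⁻¹' S) := by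
  intro a ha b hb s t hs ht hst
  have : localMap L ν J x p (s • a + t • b)
      = s • localMap L ν J x p a + t • localMap L ν J x p b := by
    have h : t = 1 - s := by linarith
    subst h
    simp only [localMap, map_add, map_smul]
    module
  rw [mem_preimage, this]
  exact hconv ha hb hs ht hst

theorem LocalModel.le_volume_cap (hM : LocalModel S L ν J x y p g cm 1 r) (hν : ‖ν‖ = 1)
    (hL : ∀ v, ⟪L v, ν⟫ = 0) {h c : ℝ} (hr : 0 ≤ r) (hh : 0 ≤ h) (h1 : h ≤ r) (h2 : 2 * h ≤ r ^ 2)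
    (hc : c ≤ 1 - h / g) :
    ENNReal.ofReal (|LinearMap.det (J : Euc d →ₗ[ℝ] Euc d)|⁻¹ * (capConst d * h ^ capExp d))
      ≤ volume (S ∩ {z | c ≤ ⟪y, z⟫}) := by
  rw [ENNReal.ofReal_mul (by positivity), ← volume_capModel d hh,
    ← volume_image_localMap hν hL J x p]
  refine measure_mono ?_
  rintro _ ⟨⟨v, t⟩, ⟨hq1, hq2⟩, rfl⟩
  dsimp at hq1 hq2
  refine ⟨hM.upper _ _ ?_ ?_ (hq2.trans h1), ?_⟩
  · exact abs_le_of_sq_le_sq' (by linarith) hr |>.2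
  · linarith
  · change c ≤ _
    rw [hM.inner_localMap hν hL]
    have : t / g ≤ h / g := div_le_div_of_nonneg_right hq2 hM.pos.le
    linarith

theorem LocalModel.lower_of_lt (hM : LocalModel S L ν J x y p g cm cp r) (hconv : Convex ℝ S)
    (hx : x ∈ S) (hr : 0 < r) {v : Euc d} {t : ℝ} (hz : localMap L ν J x p (v, t) ∈ S)
    (hv : r < ‖v‖) : cm * r / 2 * ‖v‖ ≤ t := by
  have hv0 : 0 < ‖v‖ := hr.trans hv
  have hcv : Convex ℝ (localMap L ν J x p ⁻¹' S) := convex_preimage_localMap hconv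
  have h0 : (0 : Euc d × ℝ) ∈ localMap L ν J x p ⁻¹' S := by
    rw [mem_preimage, localMap_zero]; exact hx
  have hle1 : r / ‖v‖ ≤ 1 := (div_le_one hv0).2 hv.le
  have hmem : ((r / ‖v‖) • v, (r / ‖v‖) * t) ∈ localMap L ν J x p ⁻¹' S :=
    hcv.smul_mem_of_zero_mem h0 (show (v, t) ∈ localMap L ν J x p ⁻¹' S from hz)
      ⟨by positivity, hle1⟩
  have hn : ‖(r / ‖v‖) • v‖ = r := by
    rw [norm_smul, Real.norm_of_nonneg (by positivity)]; field_simp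
  have := hM.lower _ _ hmem hn.le
  rw [hn, div_mul_eq_mul_div r, le_div_iff₀ hv0] at this
  refine le_of_mul_le_mul_left ?_ hr
  linarith

theorem LocalModel.volume_cap_le (hM : LocalModel S L ν J x y p g cm cp r) (hν : ‖ν‖ = 1)
    (hL : ∀ v, ⟪L v, ν⟫ = 0) (hconv : Convex ℝ S) (hx : x ∈ S) (hy : y ∈ polarBody S)
    {h c : ℝ} (hr : 0 < r) (hcm : 0 < cm) (hh : 0 ≤ h) (h2 : h < cm / 2 * r ^ 2)
    (hc : 1 - h / g ≤ c) :
    volume (S ∩ {z | c ≤ ⟪y, z⟫})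
      ≤ ENNReal.ofReal (|LinearMap.det (J : Euc d →ₗ[ℝ] Euc d)|⁻¹ *
        (cm * (capConst d * (h / cm) ^ capExp d))) := by
  have hg := hM.pos
  have hvol := volume_image_scale (d := d) zero_le_one hcm.le (capModel d (h / cm))
  rw [volume_capModel d (by positivity), one_pow, one_mul,
    ← ENNReal.ofReal_mul hcm.le] at hvol
  rw [ENNReal.ofReal_mul (by positivity), ← hvol, ← volume_image_localMap hν hL J x p]
  refine measure_mono ?_
  rintro z ⟨hz, hcz⟩
  obtain ⟨⟨v, t⟩, rfl⟩ := localMap_surjective hν hL J x p z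
  change c ≤ _ at hcz
  have hle := hy _ hz
  rw [real_inner_comm] at hle
  rw [hM.inner_localMap hν hL] at hcz hle
  dsimp at hcz hle
  have ht0 : 0 ≤ t := by
    have : 0 ≤ t / g := by linarith
    by_contra hneg
    push Not at hneg
    linarith [div_neg_of_neg_of_pos hneg hg]
  have hth : t ≤ h := by
    have : t / g ≤ h / g := by linarith
    exact (div_le_div_iff_of_pos_right hg).1 this
  refine mem_image_of_mem _ ⟨(v, t / cm), ⟨?_, ?_⟩, ?_⟩
  · dsimp
    by_cases hv : ‖v‖ ≤ r
    · have := hM.lower v t hz hv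
      rw [le_div_iff₀ hcm]; linarith
    · exfalso
      push Not at hv
      have := hM.lower_of_lt hconv hx hr hz hv
      nlinarith [mul_pos hcm hr]
  · exact div_le_div_of_nonneg_right hth hcm.le
  · ext1
    · simp
    · dsimp; field_simp

end Caps

section CapLimits

variable {d : ℕ} {S : Set (Euc (d + 1))} {x₀ ν : Euc (d + 1)} {k β : ℝ}

theorem eventually_mul_le_nhdsGT {a b : ℝ} (hb : 0 < b) : ∀ᶠ s in 𝓝[>] (0 : ℝ), a * s < b := by
  have : Tendsto (fun s : ℝ => a * s) (𝓝 0) (𝓝 (a * 0)) := (continuous_const_mul a).tendsto 0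
  rw [mul_zero] at this
  exact (this.eventually_lt_const hb).filter_mono nhdsWithin_le_nhds

theorem exists_pos_forall_of_eventually_nhds {m : ℝ} {P : ℝ → Prop} (h : ∀ᶠ g in 𝓝 m, P g) :
    ∃ γ > 0, ∀ g, |g - m| < γ → P g := by
  obtain ⟨γ, hγ, h⟩ := Metric.eventually_nhds_iff.1 h
  exact ⟨γ, hγ, fun g hg => h hg⟩

theorem eventually_le_of_volume_cap_le (hS : IsCompact S) (hconv : Convex ℝ S)
    (h0 : (0 : Euc (d + 1)) ∈ interior S) (hx₀ : x₀ ∈ frontier S) (hν : IsOuterNormalAt S x₀ ν)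
    (hk : IsGaussCurvatureAt S x₀ ν k) (hβ : 0 < β)
    (h : √k * (volume S).toReal < capConst d * (β * ⟪x₀, ν⟫) ^ capExp d) :
    ∀ᶠ q : ℝ × Euc (d + 1) in 𝓝[>] 0 ×ˢ 𝓝[frontier S] x₀, ∀ y ∈ polarBody S, ⟪q.2, y⟫ = 1 →
      ∀ c, volume (S ∩ {z | c ≤ ⟪y, z⟫}) ≤ ENNReal.ofReal (q.1 ^ capExp d) * volume S →
        1 - β * q.1 ≤ c := by
  obtain ⟨-, L, hL, -, hfr⟩ := exists_adapted_frame hS.isClosed hconv h0 hx₀ hν hk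
  have hα := capExp_pos d
  have hC := capConst_pos d
  set m := ⟪x₀, ν⟫
  set V := (volume S).toReal with hV
  obtain ⟨k', hk', h⟩ : ∃ k' > k, √k' * V < capConst d * (β * m) ^ capExp d := by
    have h1 : ContinuousAt (fun k' => √k' * V) k := by fun_prop
    have h2 : ∀ᶠ k' in 𝓝[>] k, √k' * V < capConst d * (β * m) ^ capExp d :=
      (h1.tendsto.eventually_lt_const h).filter_mono nhdsWithin_le_nhds
    obtain ⟨k', h3, h4⟩ := (h2.and self_mem_nhdsWithin).exists
    exact ⟨k', h4, h3⟩
  obtain ⟨J, hJ, r, hr, cm, hfr⟩ := hfr k' hk'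
  obtain ⟨γ, hγ, hγ'⟩ := exists_pos_forall_of_eventually_nhds (m := m)
      (P := fun g => √k' * V < capConst d * (β * g) ^ capExp d ∧ g < m + 1) (by
    refine .and ?_ (Iio_mem_nhds (by linarith))
    have h1 : ContinuousAt (fun g => capConst d * (β * g) ^ capExp d) m :=
      continuousAt_const.mul ((continuousAt_const.mul continuousAt_id).rpow_const (Or.inr hα.le))
    exact h1.tendsto.eventually_const_lt h)
  have hs : ∀ᶠ s in 𝓝[>] (0 : ℝ), 0 < s ∧ (β * (m + 1)) * s < min r (r ^ 2 / 2) :=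
    Eventually.and self_mem_nhdsWithin (eventually_mul_le_nhdsGT (by positivity))
  filter_upwards [hs.prod_mk (hfr γ hγ)]
  rintro ⟨s, x⟩ ⟨⟨hs0, hs⟩, hx⟩ y hy hxy c hc
  dsimp only at *
  obtain ⟨p, g, hM, hg⟩ := hx y hy hxy
  obtain ⟨hg1, hg2⟩ := hγ' g hg
  have hg0 := hM.pos
  by_contra hlt
  push Not at hlt
  have hle : β * g * s ≤ min r (r ^ 2 / 2) := by
    refine le_trans ?_ hs.le
    gcongr
  have h1 : β * g * s ≤ r := hle.trans (min_le_left _ _)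
  have h2 : β * g * s ≤ r ^ 2 / 2 := hle.trans (min_le_right _ _)
  have key := (hM.le_volume_cap hν.1 hL (c := c) hr.le (by positivity : 0 ≤ β * g * s) h1
    (by linarith) (by
      rw [show β * g * s / g = β * s by field_simp]; exact hlt.le)).trans hc
  rw [← ENNReal.ofReal_toReal hS.measure_lt_top.ne, ← hV, ← ENNReal.ofReal_mul (by positivity),
    ENNReal.ofReal_le_ofReal_iff (by positivity), Real.mul_rpow (by positivity) hs0.le] at key
  have hsα : 0 < s ^ capExp d := Real.rpow_pos_of_pos hs0 _
  have hdet : 0 < |LinearMap.det (J : Euc d →ₗ[ℝ] Euc d)| :=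
    abs_pos.2 J.isUnit_det'.ne_zero
  have hdet' : |LinearMap.det (J : Euc d →ₗ[ℝ] Euc d)| ≤ √k' := Real.abs_le_sqrt hJ
  rw [inv_mul_le_iff₀ hdet] at key
  have : capConst d * (β * g) ^ capExp d ≤ |LinearMap.det (J : Euc d →ₗ[ℝ] Euc d)| * V := by
    refine le_of_mul_le_mul_right ?_ hsα
    linarith
  have hV0 : 0 ≤ V := ENNReal.toReal_nonneg
  nlinarith

theorem eventually_volume_cap_le (hS : IsCompact S) (hconv : Convex ℝ S)
    (h0 : (0 : Euc (d + 1)) ∈ interior S) (hx₀ : x₀ ∈ frontier S) (hν : IsOuterNormalAt S x₀ ν)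
    (hk : IsGaussCurvatureAt S x₀ ν k) (hk0 : 0 < k) (hβ : 0 < β)
    (h : capConst d * (β * ⟪x₀, ν⟫) ^ capExp d < √k * (volume S).toReal) :
    ∀ᶠ q : ℝ × Euc (d + 1) in 𝓝[>] 0 ×ˢ 𝓝[frontier S] x₀, ∀ y ∈ polarBody S, ⟪q.2, y⟫ = 1 →
      volume (S ∩ {z | 1 - β * q.1 ≤ ⟪y, z⟫}) ≤ ENNReal.ofReal (q.1 ^ capExp d) * volume S := by
  obtain ⟨-, L, hL, hfr, -⟩ := exists_adapted_frame hS.isClosed hconv h0 hx₀ hν hk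
  have hα := capExp_pos d
  have hC := capConst_pos d
  set m := ⟪x₀, ν⟫
  set V := (volume S).toReal with hV
  obtain ⟨J, hJ, hfr⟩ := hfr hk0
  obtain ⟨η, hη0, hη1, h⟩ : ∃ η > 0, η < 1 ∧
      (1 - η) * (capConst d * (β * m / (1 - η)) ^ capExp d) < √k * V := by
    have h1 : ContinuousAt (fun η => (1 - η) * (capConst d * (β * m / (1 - η)) ^ capExp d)) 0 := by
      refine .mul (by fun_prop) (continuousAt_const.mul (.rpow_const ?_ (Or.inr hα.le)))
      exact continuousAt_const.div (by fun_prop) (by norm_num)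
    have h2 : ∀ᶠ η in 𝓝[>] (0 : ℝ),
        (1 - η) * (capConst d * (β * m / (1 - η)) ^ capExp d) < √k * V :=
      (h1.tendsto.eventually_lt_const (by simpa using h)).filter_mono nhdsWithin_le_nhds
    obtain ⟨η, h5, h3, h4⟩ := (h2.and (Ioo_mem_nhdsGT one_pos)).exists
    exact ⟨η, h3, h4, h5⟩
  obtain ⟨r, hr, hfr⟩ := hfr η hη0
  obtain ⟨γ, hγ, hγ'⟩ := exists_pos_forall_of_eventually_nhds (m := m)
      (P := fun g => (1 - η) * (capConst d * (β * g / (1 - η)) ^ capExp d) < √k * V ∧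
        g < m + 1) (by
    refine .and ?_ (Iio_mem_nhds (by linarith))
    have h1 : ContinuousAt (fun g => (1 - η) * (capConst d * (β * g / (1 - η)) ^ capExp d)) m :=
      continuousAt_const.mul <| continuousAt_const.mul <|
        ((continuousAt_const.mul continuousAt_id).div_const _).rpow_const (Or.inr hα.le)
    exact h1.tendsto.eventually_lt_const h)
  have h1η : 0 < 1 - η := by linarith
  have hs : ∀ᶠ s in 𝓝[>] (0 : ℝ), 0 < s ∧ (β * (m + 1)) * s < (1 - η) / 2 * r ^ 2 :=
    Eventually.and self_mem_nhdsWithin (eventually_mul_le_nhdsGT (by positivity))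
  filter_upwards [hs.prod_mk ((hfr γ hγ).and eventually_mem_nhdsWithin)]
  rintro ⟨s, x⟩ ⟨⟨hs0, hs⟩, hx, hxS⟩ y hy hxy
  dsimp only at *
  obtain ⟨p, g, hM, hg⟩ := hx y hy hxy
  obtain ⟨hg1, hg2⟩ := hγ' g hg
  have hg0 := hM.pos
  have hle : β * g * s < (1 - η) / 2 * r ^ 2 := by
    refine lt_of_le_of_lt ?_ hs
    gcongr
  refine (hM.volume_cap_le hν.1 hL hconv (hS.isClosed.frontier_subset hxS) hy hr h1η
    (by positivity : 0 ≤ β * g * s) hle (by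
      rw [show β * g * s / g = β * s by field_simp])).trans ?_
  rw [← ENNReal.ofReal_toReal hS.measure_lt_top.ne, ← hV, ← ENNReal.ofReal_mul (by positivity)]
  refine ENNReal.ofReal_le_ofReal ?_
  have hdet : |LinearMap.det (J : Euc d →ₗ[ℝ] Euc d)| = √k := by
    rw [← hJ, Real.sqrt_sq_eq_abs]
  rw [hdet, inv_mul_le_iff₀ (Real.sqrt_pos.2 hk0),
    show β * g * s / (1 - η) = β * g / (1 - η) * s by ring, Real.mul_rpow (by positivity) hs0.le]
  have hsα : 0 < s ^ capExp d := Real.rpow_pos_of_pos hs0 _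
  nlinarith

end CapLimits

section DualChart

variable {d : ℕ} {S : Set (Euc (d + 1))} {L : Euc d →ₗᵢ[ℝ] Euc (d + 1)} {ν x y : Euc (d + 1)}
  {J : Euc d ≃ₗ[ℝ] Euc d} {p : Euc d} {g cm cp r : ℝ}

/-- Affine coordinates `(P, t)` around the polar point `y`, dual to `localMap`. -/
def dualMap (L : Euc d →ₗᵢ[ℝ] Euc (d + 1)) (ν : Euc (d + 1)) (J : Euc d ≃ₗ[ℝ] Euc d)
    (x y : Euc (d + 1)) (p : Euc d) (g : ℝ) : Euc d × ℝ →ᵃ[ℝ] Euc (d + 1) :=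
  (chartMap L ν (LinearMap.adjoint J.toLinearMap) (-g⁻¹)
    (-(g⁻¹ • (innerₛₗ ℝ x ∘ₗ L.toLinearMap))) p).toAffineMap + AffineMap.const ℝ _ y

theorem dualMap_apply (L : Euc d →ₗᵢ[ℝ] Euc (d + 1)) (ν : Euc (d + 1)) (J : Euc d ≃ₗ[ℝ] Euc d)
    (x y : Euc (d + 1)) (p : Euc d) (g : ℝ) (q : Euc d × ℝ) :
    dualMap L ν J x y p g q = y + chartMap L ν (LinearMap.adjoint J.toLinearMap) (-g⁻¹)
      (-(g⁻¹ • (innerₛₗ ℝ x ∘ₗ L.toLinearMap))) p q := by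
  simp [dualMap, add_comm]

theorem LocalModel.dualMap_eq (hM : LocalModel S L ν J x y p g cm cp r) (P : Euc d) (t : ℝ) :
    dualMap L ν J x y p g (P, t) =
      L (LinearMap.adjoint J.toLinearMap P
        + ((1 - t - ⟪x, L (LinearMap.adjoint J.toLinearMap P)⟫) / g) • p)
        + ((1 - t - ⟪x, L (LinearMap.adjoint J.toLinearMap P)⟫) / g) • ν := by
  rw [dualMap_apply, chartMap_apply, hM.dual_eq]
  simp only [LinearMap.neg_apply, LinearMap.smul_apply, LinearMap.comp_apply,
    innerₛₗ_apply_apply, LinearIsometry.coe_toLinearMap, map_add, map_smul, smul_eq_mul]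
  module

theorem LocalModel.inner_dualMap (hM : LocalModel S L ν J x y p g cm cp r) (hν : ‖ν‖ = 1)
    (hL : ∀ v, ⟪L v, ν⟫ = 0) (u : Euc d) (τ : ℝ) (P : Euc d) (t : ℝ) :
    ⟪localMap L ν J x p (u, τ), dualMap L ν J x y p g (P, t)⟫ =
      1 - t + ⟪u, P⟫ - (1 - t - ⟪x, L (LinearMap.adjoint J.toLinearMap P)⟫) / g * τ := by
  have hL' : ∀ v, ⟪ν, L v⟫ = 0 := fun v => by rw [real_inner_comm, hL]
  have hg := hM.pos
  have hx : ⟪x, ν⟫ = g - ⟪x, L p⟫ := by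
    rw [← hM.inner_eq, inner_add_right]; ring
  have hP : ⟪J.symm u, LinearMap.adjoint J.toLinearMap P⟫ = ⟪u, P⟫ := by
    rw [LinearMap.adjoint_inner_right]; simp
  rw [hM.dualMap_eq, localMap_apply]
  set A := LinearMap.adjoint J.toLinearMap P
  simp only [inner_sub_left, inner_add_left, inner_add_right, real_inner_smul_left,
    real_inner_smul_right, hL, hL', real_inner_self_eq_norm_sq, hν, L.inner_map_map, map_add,
    map_smul, hP, hx, real_inner_comm p]
  field_simp
  ring

theorem adjoint_injective (J : Euc d ≃ₗ[ℝ] Euc d) :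
    Function.Injective (LinearMap.adjoint J.toLinearMap) := by
  rw [← LinearMap.ker_eq_bot, LinearMap.ker_eq_bot']
  intro P hP
  refine inner_self_eq_zero (𝕜 := ℝ).1 ?_
  have := LinearMap.adjoint_inner_right J.toLinearMap (J.symm P) P
  rw [hP] at this
  simpa using this.symm

theorem bijective_dualMap (hν : ‖ν‖ = 1) (hL : ∀ v, ⟪L v, ν⟫ = 0) (hg : 0 < g) :
    Function.Bijective (dualMap L ν J x y p g) := by
  set T := chartMap L ν (LinearMap.adjoint J.toLinearMap) (-g⁻¹)
      (-(g⁻¹ • (innerₛₗ ℝ x ∘ₗ L.toLinearMap))) p with hT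
  have hinj : Function.Injective T := by
    rw [← LinearMap.ker_eq_bot, LinearMap.ker_eq_bot']
    rintro ⟨P, t⟩ h
    rw [hT, chartMap_apply] at h
    have h1 := congrArg (fun z => ⟪z, ν⟫) h
    simp only [inner_add_left, hL, real_inner_smul_left, real_inner_self_eq_norm_sq, hν,
      inner_zero_left] at h1
    rw [zero_add, one_pow, mul_one] at h1
    rw [h1, zero_smul, zero_smul, add_zero, add_zero] at h
    have hA : LinearMap.adjoint J.toLinearMap P = 0 := by
      rw [← L.map_zero] at h
      exact L.injective h
    have hP : P = 0 := adjoint_injective J (by rw [hA, map_zero])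
    rw [hA, map_zero] at h1
    have ht : t = 0 := by
      simpa [hg.ne'] using h1
    rw [hP, ht]; rfl
  have hsurj : Function.Surjective T :=
    (LinearMap.injective_iff_surjective_of_finrank_eq_finrank (by simp)).1 hinj
  have : ⇑(dualMap L ν J x y p g) = (fun z => y + z) ∘ T :=
    funext fun q => dualMap_apply L ν J x y p g q
  rw [this]
  exact (AddGroup.addLeft_bijective y).comp ⟨hinj, hsurj⟩

theorem det_adjoint_real (f : Euc d →ₗ[ℝ] Euc d) :
    LinearMap.det (LinearMap.adjoint f) = LinearMap.det f := by
  set b := stdOrthonormalBasis ℝ (Euc d)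
  rw [← LinearMap.det_toMatrix b.toBasis, LinearMap.toMatrix_adjoint b b,
    Matrix.det_conjTranspose, LinearMap.det_toMatrix, star_trivial]

theorem volume_image_dualMap (hν : ‖ν‖ = 1) (hL : ∀ v, ⟪L v, ν⟫ = 0) (hg : 0 < g)
    (M : Set (Euc d × ℝ)) :
    volume (dualMap L ν J x y p g '' M)
      = ENNReal.ofReal (|LinearMap.det (J : Euc d →ₗ[ℝ] Euc d)| / g) * volume M := by
  have := volume_image_chartMap hν hL (LinearMap.adjoint J.toLinearMap) (-g⁻¹)
    (-(g⁻¹ • (innerₛₗ ℝ x ∘ₗ L.toLinearMap))) p y M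
  simp_rw [← dualMap_apply] at this
  rw [this]
  congr 2
  rw [abs_neg, abs_of_pos (inv_pos.2 hg), det_adjoint_real]
  rfl

theorem LocalModel.volume_convexHull_polarBody_diff (hM : LocalModel S L ν J x y p g cm cp r)
    (hν : ‖ν‖ = 1) (hL : ∀ v, ⟪L v, ν⟫ = 0) (t : ℝ) :
    volume (convexHull ℝ (polarBody S ∪ {(1 + t) • y}) \ polarBody S)
      = ENNReal.ofReal (|LinearMap.det (J : Euc d →ₗ[ℝ] Euc d)| / g) *
        volume (convexHull ℝ (dualMap L ν J x y p g ⁻¹' polarBody S ∪ {(0, -t)}) \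
          dualMap L ν J x y p g ⁻¹' polarBody S) := by
  have hb := bijective_dualMap (J := J) (x := x) (y := y) (p := p) hν hL hM.pos
  have h0 : dualMap L ν J x y p g (0, -t) = (1 + t) • y := by
    rw [hM.dualMap_eq, hM.dual_eq]
    simp only [map_zero, inner_zero_right, map_add, map_smul]
    module
  rw [← volume_image_dualMap hν hL hM.pos, image_sdiff hb.1, AffineMap.image_convexHull, image_union,
    image_singleton, h0, image_preimage_eq _ hb.2]

end DualChart

section DualSandwich

variable {d : ℕ} {S : Set (Euc (d + 1))} {L : Euc d →ₗᵢ[ℝ] Euc (d + 1)} {ν x y : Euc (d + 1)}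
  {J : Euc d ≃ₗ[ℝ] Euc d} {p : Euc d} {g cm cp r B q r' : ℝ}

theorem LocalModel.dual_lower (hM : LocalModel S L ν J x y p g cm cp r) (hν : ‖ν‖ = 1)
    (hL : ∀ v, ⟪L v, ν⟫ = 0) (hx : x ∈ S) (hcp : 0 < cp)
    (hB : ∀ P, |⟪x, L (LinearMap.adjoint J.toLinearMap P)⟫| ≤ B * ‖P‖) (hB0 : 0 ≤ B) (hq : 0 < q)
    (h1 : q * r' ≤ r) (h2 : cp / 2 * (q * r') ^ 2 ≤ r) (h3 : (1 + B * r') * cp * q ≤ g)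
    {P : Euc d} {t : ℝ} (hP : (P, t) ∈ dualMap L ν J x y p g ⁻¹' polarBody S) (hPr : ‖P‖ ≤ r') :
    q / 2 * ‖P‖ ^ 2 ≤ t := by
  have hg := hM.pos
  have ht : 0 ≤ t := by
    have h := hP _ (show localMap L ν J x p (0, 0) ∈ S by
      change localMap L ν J x p 0 ∈ S
      rw [localMap_zero]; exact hx)
    rw [hM.inner_dualMap hν hL] at h
    simp at h
    exact h
  have hn : ‖q • P‖ = q * ‖P‖ := by rw [norm_smul, Real.norm_of_nonneg hq.le]
  have hqP : q * ‖P‖ ≤ q * r' := by gcongr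
  have hτ : cp / 2 * (q * ‖P‖) ^ 2 ≤ r := by
    refine le_trans ?_ h2
    gcongr
  have h := hP _ (hM.upper (q • P) _ (by rw [hn]; exact hqP.trans h1) le_rfl (by rwa [hn]))
  rw [hM.inner_dualMap hν hL, hn, real_inner_smul_left, real_inner_self_eq_norm_sq] at h
  have hb : (1 - t - ⟪x, L (LinearMap.adjoint J.toLinearMap P)⟫) / g * (cp * q) ≤ 1 := by
    rw [div_mul_eq_mul_div, div_le_one hg]
    refine le_trans ?_ h3
    rw [mul_assoc (1 + B * r')]
    refine mul_le_mul_of_nonneg_right ?_ (by positivity)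
    have := (abs_le.1 (hB P)).1
    have : B * ‖P‖ ≤ B * r' := by gcongr
    linarith
  have hb' := mul_le_mul_of_nonneg_right hb (show 0 ≤ q / 2 * ‖P‖ ^ 2 by positivity)
  nlinarith

theorem LocalModel.mem_dual (hM : LocalModel S L ν J x y p g cm cp r) (hν : ‖ν‖ = 1)
    (hL : ∀ v, ⟪L v, ν⟫ = 0) (hconv : Convex ℝ S) (hx : x ∈ S) (hr : 0 < r)
    (hcm : 0 < cm) (hB : ∀ P, |⟪x, L (LinearMap.adjoint J.toLinearMap P)⟫| ≤ B * ‖P‖)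
    (hB0 : 0 ≤ B) (hq : 0 < q) (h1 : 2 * q * r' ≤ r)
    (h2 : g ≤ (1 - q / 2 * r' ^ 2 - B * r') * cm * q) {P : Euc d} (hPr : ‖P‖ ≤ r') :
    (P, q / 2 * ‖P‖ ^ 2) ∈ dualMap L ν J x y p g ⁻¹' polarBody S := by
  have hg := hM.pos
  have hr' : 0 ≤ r' := (norm_nonneg _).trans hPr
  rw [mem_preimage]
  intro z hz
  obtain ⟨⟨u, τ⟩, rfl⟩ := localMap_surjective hν hL J x p z
  rw [hM.inner_dualMap hν hL]
  set b := (1 - q / 2 * ‖P‖ ^ 2 - ⟪x, L (LinearMap.adjoint J.toLinearMap P)⟫) / g with hb_def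
  have hb : 1 ≤ b * (cm * q) := by
    rw [hb_def, div_mul_eq_mul_div, one_le_div hg]
    refine h2.trans ?_
    rw [mul_assoc]
    refine mul_le_mul_of_nonneg_right ?_ (by positivity)
    have h3 := (abs_le.1 (hB P)).2
    have h4 : B * ‖P‖ ≤ B * r' := by gcongr
    have h5 : q / 2 * ‖P‖ ^ 2 ≤ q / 2 * r' ^ 2 := by gcongr
    linarith
  have hb0 : 0 < b := by
    by_contra hneg
    push Not at hneg
    nlinarith [mul_pos hcm hq]
  have hcs : ⟪u, P⟫ ≤ ‖u‖ * ‖P‖ := real_inner_le_norm _ _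
  suffices ‖u‖ * ‖P‖ ≤ q / 2 * ‖P‖ ^ 2 + b * τ by linarith
  by_cases hu : ‖u‖ ≤ r
  · have hτ := hM.lower _ _ hz hu
    have h3 : ‖u‖ ^ 2 ≤ 2 * q * (b * τ) := by
      have h4 : b * q * (cm / 2 * ‖u‖ ^ 2) ≤ b * q * τ := by gcongr
      nlinarith [sq_nonneg ‖u‖]
    refine le_of_mul_le_mul_left ?_ hq
    nlinarith [sq_nonneg (‖u‖ - q * ‖P‖)]
  · push Not at hu
    have hτ := hM.lower_of_lt hconv hx hr hz hu
    have h4 : b * q * (cm * r / 2 * ‖u‖) ≤ b * q * τ := by gcongr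
    have h5 : r / 2 * ‖u‖ ≤ q * (b * τ) := by
      nlinarith [mul_nonneg hr.le (norm_nonneg u)]
    have h6 : q * (‖u‖ * ‖P‖) ≤ r / 2 * ‖u‖ := by
      have : q * ‖P‖ ≤ r / 2 := by nlinarith
      nlinarith [norm_nonneg u]
    have h7 : ‖u‖ * ‖P‖ ≤ b * τ := le_of_mul_le_mul_left (h6.trans h5) hq
    have : 0 ≤ q / 2 * ‖P‖ ^ 2 := by positivity
    linarith

end DualSandwich

section ConeLimits

variable {d : ℕ} {S : Set (Euc (d + 1))} {x₀ ν : Euc (d + 1)} {k Γ : ℝ}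

theorem convex_polarBody {n : ℕ} (S : Set (Euc n)) : Convex ℝ (polarBody S) := by
  intro a ha b hb s t hs ht hst z hz
  rw [inner_add_right, real_inner_smul_right, real_inner_smul_right]
  nlinarith [ha z hz, hb z hz]

theorem exists_dual_sandwich (hcl : IsClosed S) (hconv : Convex ℝ S)
    (h0 : (0 : Euc (d + 1)) ∈ interior S) (hx₀ : x₀ ∈ frontier S) (hν : IsOuterNormalAt S x₀ ν)
    (hk : IsGaussCurvatureAt S x₀ ν k) (hk0 : 0 < k) {q q' : ℝ} (hq : 0 < q) (hqm : q < ⟪x₀, ν⟫)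
    (hqm' : ⟪x₀, ν⟫ < q') :
    ∃ r > 0, ∀ γ > 0, ∀ᶠ x in 𝓝[frontier S] x₀, ∀ y ∈ polarBody S, ⟪x, y⟫ = 1 →
      ∃ g, 0 < g ∧ |g - ⟪x₀, ν⟫| < γ ∧ ∃ K : Set (Euc d × ℝ), Convex ℝ K ∧ 0 ∈ K ∧
        (∀ k ∈ K, ‖k.1‖ ≤ r → k.2 ≤ r → q / 2 * ‖k.1‖ ^ 2 ≤ k.2) ∧
        (∀ P, ‖P‖ ≤ r → (P, q' / 2 * ‖P‖ ^ 2) ∈ K) ∧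
        ∀ t, volume (convexHull ℝ (polarBody S ∪ {(1 + t) • y}) \ polarBody S)
          = ENNReal.ofReal (√k / g) * volume (convexHull ℝ (K ∪ {(0, -t)}) \ K) := by
  obtain ⟨-, L, hL, hfr, -⟩ := exists_adapted_frame hcl hconv h0 hx₀ hν hk
  set m := ⟪x₀, ν⟫
  obtain ⟨J, hJ, hfr⟩ := hfr hk0
  have hq' : 0 < q' := by linarith
  obtain ⟨η, ⟨h1, h2⟩, hη0, hη1⟩ : ∃ η, ((1 + η) * q < m ∧ m < (1 - η) * q') ∧ 0 < η ∧ η < 1 := by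
    have h1 : ContinuousAt (fun η : ℝ => (1 + η) * q) 0 := by fun_prop
    have h2 : ContinuousAt (fun η : ℝ => (1 - η) * q') 0 := by fun_prop
    have h3 : ∀ᶠ η in 𝓝[>] (0 : ℝ), (1 + η) * q < m ∧ m < (1 - η) * q' :=
      ((h1.tendsto.eventually_lt_const (by simpa using hqm)).and
        (h2.tendsto.eventually_const_lt (by simpa using hqm'))).filter_mono nhdsWithin_le_nhds
    exact (h3.and (Ioo_mem_nhdsGT one_pos)).exists
  obtain ⟨r, hr, hfr⟩ := hfr η hη0
  obtain ⟨C, hC, hAC⟩ : ∃ C > 0, ∀ P, ‖LinearMap.adjoint J.toLinearMap P‖ ≤ C * ‖P‖ := by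
    obtain ⟨C, hC, h⟩ :=
      (LinearMap.toContinuousLinearMap (LinearMap.adjoint J.toLinearMap)).bound
    exact ⟨C, hC, h⟩
  set B := (‖x₀‖ + 1) * C with hB_def
  have hB : 0 ≤ B := by positivity
  obtain ⟨r', ⟨h3, h4, h5, h6, h7⟩, hr'⟩ : ∃ r', (q * r' < r ∧ (1 + η) / 2 * (q * r') ^ 2 < r ∧
      2 * q' * r' < r ∧ (1 + B * r') * (1 + η) * q < m ∧
      m < (1 - q' / 2 * r' ^ 2 - B * r') * (1 - η) * q') ∧ 0 < r' := by
    have h3 : ContinuousAt (fun r' : ℝ => q * r') 0 := by fun_prop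
    have h4 : ContinuousAt (fun r' : ℝ => (1 + η) / 2 * (q * r') ^ 2) 0 := by fun_prop
    have h5 : ContinuousAt (fun r' : ℝ => 2 * q' * r') 0 := by fun_prop
    have h6 : ContinuousAt (fun r' : ℝ => (1 + B * r') * (1 + η) * q) 0 := by fun_prop
    have h7 : ContinuousAt (fun r' : ℝ => (1 - q' / 2 * r' ^ 2 - B * r') * (1 - η) * q') 0 := by
      fun_prop
    refine (Eventually.and (.filter_mono nhdsWithin_le_nhds
      (.and (h3.tendsto.eventually_lt_const ?_) <| .and (h4.tendsto.eventually_lt_const ?_) <|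
      .and (h5.tendsto.eventually_lt_const ?_) <| .and (h6.tendsto.eventually_lt_const ?_) <|
      h7.tendsto.eventually_const_lt ?_)) (self_mem_nhdsWithin (s := Ioi (0 : ℝ)))).exists
    · simpa using hr
    · simpa using hr
    · simpa using hr
    · simpa using h1
    · simpa using h2
  refine ⟨r', hr', fun γ hγ => ?_⟩
  obtain ⟨γ', hγ', hg'⟩ := exists_pos_forall_of_eventually_nhds (m := m)
    (((eventually_gt_nhds h6).and (eventually_lt_nhds h7)))
  have hx₁ : ∀ᶠ x in 𝓝[frontier S] x₀, ‖x‖ < ‖x₀‖ + 1 :=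
    (continuous_norm.continuousAt.tendsto.eventually_lt_const (by linarith)).filter_mono
      nhdsWithin_le_nhds
  filter_upwards [hfr (min γ γ') (by positivity), hx₁, eventually_mem_nhdsWithin]
    with x hx hxn hxS y hy hxy
  obtain ⟨p, g, hM, hg⟩ := hx y hy hxy
  obtain ⟨h8, h9⟩ := hg' g (hg.trans_le (min_le_right _ _))
  have hxS := hcl.frontier_subset hxS
  have hBx : ∀ P, |⟪x, L (LinearMap.adjoint J.toLinearMap P)⟫| ≤ B * ‖P‖ := by
    intro P
    refine (abs_real_inner_le_norm _ _).trans ?_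
    rw [L.norm_map, hB_def, mul_assoc]
    exact mul_le_mul hxn.le (hAC P) (norm_nonneg _) (by positivity)
  have hin : ∀ P, ‖P‖ ≤ r' →
      (P, q' / 2 * ‖P‖ ^ 2) ∈ dualMap L ν J x y p g ⁻¹' polarBody S := fun P hP =>
    hM.mem_dual hν.1 hL hconv hxS hr (by linarith) hBx hB hq' h5.le h9.le hP
  have hdet : |LinearMap.det (J : Euc d →ₗ[ℝ] Euc d)| = √k := by
    rw [← hJ, Real.sqrt_sq_eq_abs]
  refine ⟨g, hM.pos, hg.trans_le (min_le_left _ _), dualMap L ν J x y p g ⁻¹' polarBody S,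
    (convex_polarBody S).affine_preimage _, ?_, ?_, hin, fun t => ?_⟩
  · have := hin 0 (by simpa using hr'.le)
    simp only [norm_zero, ne_eq, OfNat.ofNat_ne_zero, not_false_eq_true, zero_pow, mul_zero] at this
    exact this
  · rintro ⟨P, t⟩ hP hPr -
    exact hM.dual_lower hν.1 hL hxS (by linarith) hBx hB hq h3.le h4.le h8.le hP hPr
  · rw [← hdet]
    exact hM.volume_convexHull_polarBody_diff hν.1 hL t

theorem sqrt_pow_mul_eq (d : ℕ) {q t : ℝ} (hq : 0 < q) (ht : 0 < t) :
    √(2 * t / q) ^ d * t = (2 / q) ^ ((d : ℝ) / 2) * t ^ capExp d := by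
  rw [show 2 * t / q = 2 / q * t by ring, Real.sqrt_eq_rpow, ← Real.rpow_natCast,
    ← Real.rpow_mul (by positivity), Real.mul_rpow (by positivity) ht.le, mul_assoc,
    ← Real.rpow_add_one ht.ne']
  congr 2
  · ring
  · rw [capExp]; ring

theorem rpow_capExp_eq (d : ℕ) {m : ℝ} (hm : 0 < m) :
    m ^ capExp d = m ^ ((d : ℝ) / 2) * m := by
  rw [← Real.rpow_add_one hm.ne', capExp]
  congr 1; ring

theorem eventually_volume_convexHull_diff_le (hcl : IsClosed S) (hconv : Convex ℝ S)
    (h0 : (0 : Euc (d + 1)) ∈ interior S) (hx₀ : x₀ ∈ frontier S) (hν : IsOuterNormalAt S x₀ ν)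
    (hk : IsGaussCurvatureAt S x₀ ν k) (hk0 : 0 < k)
    (h : √k * (2 ^ ((d : ℝ) / 2) * coneConst d) < Γ * ⟪x₀, ν⟫ ^ capExp d) :
    ∀ᶠ q : ℝ × Euc (d + 1) in 𝓝[>] 0 ×ˢ 𝓝[frontier S] x₀, ∀ y ∈ polarBody S, ⟪q.2, y⟫ = 1 →
      volume (convexHull ℝ (polarBody S ∪ {(1 + q.1) • y}) \ polarBody S)
        ≤ ENNReal.ofReal (Γ * q.1 ^ capExp d) := by
  have hm := inner_pos_of_isOuterNormalAt h0 hν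
  obtain ⟨C, hC, hCc⟩ : ∃ C, √k * (2 ^ ((d : ℝ) / 2) * C) < Γ * ⟪x₀, ν⟫ ^ capExp d ∧
      coneConst d < C := by
    have h1 : ContinuousAt (fun C => √k * (2 ^ ((d : ℝ) / 2) * C)) (coneConst d) := by fun_prop
    exact (((h1.tendsto.eventually_lt_const h).filter_mono nhdsWithin_le_nhds).and
      (self_mem_nhdsWithin (s := Ioi (coneConst d)))).exists
  have hC0 : 0 < C := (coneConst_pos d).trans hCc
  obtain ⟨R, hR, hRC⟩ := exists_volume_coneModelOuter_le d hCc
  set m := ⟪x₀, ν⟫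
  have hR2 : 1 < R + 1 / R - 1 := by
    have : 0 < R + 1 / R - 2 := by
      have : R + 1 / R - 2 = (R - 1) ^ 2 / R := by field_simp; ring
      rw [this]
      have : 0 < R - 1 := by linarith
      positivity
    linarith
  obtain ⟨q, ⟨h1, h2⟩, hq0, hqm⟩ : ∃ q, (√k * ((2 / q) ^ ((d : ℝ) / 2) * C) < Γ * m ∧
      m < (R + 1 / R - 1) * q) ∧ 0 < q ∧ q < m := by
    have h1 : ContinuousAt (fun q => √k * ((2 / q) ^ ((d : ℝ) / 2) * C)) m :=
      continuousAt_const.mul <| .mul (.rpow_const (continuousAt_const.div continuousAt_id hm.ne')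
        (Or.inr (by positivity))) continuousAt_const
    have h2 : ContinuousAt (fun q => (R + 1 / R - 1) * q) m := by fun_prop
    refine (Eventually.and (.filter_mono nhdsWithin_le_nhds
      (.and (h1.tendsto.eventually_lt_const ?_) (h2.tendsto.eventually_const_lt ?_)))
      (Ioo_mem_nhdsLT hm)).exists
    · rw [rpow_capExp_eq d hm] at hC
      rw [Real.div_rpow (by norm_num) hm.le]
      have : 0 < m ^ ((d : ℝ) / 2) := by positivity
      refine lt_of_mul_lt_mul_right ?_ this.le
      calc _ = √k * (2 ^ ((d : ℝ) / 2) * C) := by field_simp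
        _ < _ := hC
        _ = _ := by ring
    · nlinarith
  obtain ⟨r, hr, hfr⟩ := exists_dual_sandwich hcl hconv h0 hx₀ hν hk hk0 hq0 hqm h2
  obtain ⟨γ, hγ, hγ'⟩ := exists_pos_forall_of_eventually_nhds (m := m)
      (P := fun g => √k * ((2 / q) ^ ((d : ℝ) / 2) * C) < Γ * g)
      ((continuousAt_const.mul continuousAt_id).tendsto.eventually_const_lt h1)
  have hs : ∀ᶠ t in 𝓝[>] (0 : ℝ), (R * √(2 * t / q) < r ∧
      (R + 1 / R) * (q * √(2 * t / q) / 2) < min (q * r / 2) 1) ∧ 0 < t := by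
    have h3 : ContinuousAt (fun t => R * √(2 * t / q)) 0 := by fun_prop
    have h4 : ContinuousAt (fun t => (R + 1 / R) * (q * √(2 * t / q) / 2)) 0 := by fun_prop
    refine Eventually.and (.filter_mono nhdsWithin_le_nhds
      (.and (h3.tendsto.eventually_lt_const ?_) (h4.tendsto.eventually_lt_const ?_)))
      self_mem_nhdsWithin
    · simpa using hr
    · simpa using mul_pos hq0 hr
  filter_upwards [hs.prod_mk (hfr γ hγ)]
  rintro ⟨t, x⟩ ⟨⟨⟨ht1, ht2⟩, ht⟩, hx⟩ y hy hxy
  dsimp only at *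
  obtain ⟨g, hg, hgm, K, hK, hK0, hout, hin, hvol⟩ := hx y hy hxy
  have hρ : 0 < √(2 * t / q) := Real.sqrt_pos.2 (by positivity)
  have hρt : q * √(2 * t / q) ^ 2 / 2 = t := by
    rw [Real.sq_sqrt (by positivity)]; field_simp
  have key := volume_convexHull_diff_le hK hK0 hr hq0 hR le_rfl hout hin hρ ht1.le ht2.le
  rw [hρt, sqrt_pow_mul_eq d hq0 ht] at key
  rw [hvol]
  calc _ ≤ ENNReal.ofReal (√k / g) * (ENNReal.ofReal ((2 / q) ^ ((d : ℝ) / 2) * t ^ capExp d)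
        * ENNReal.ofReal C) := by gcongr; exact key.trans (by gcongr)
    _ = ENNReal.ofReal (√k / g * ((2 / q) ^ ((d : ℝ) / 2) * t ^ capExp d * C)) := by
      rw [← ENNReal.ofReal_mul (by positivity), ← ENNReal.ofReal_mul (by positivity)]
    _ ≤ _ := by
      refine ENNReal.ofReal_le_ofReal ?_
      rw [div_mul_eq_mul_div, div_le_iff₀ hg]
      have h5 := mul_le_mul_of_nonneg_right (hγ' g hgm).le (Real.rpow_nonneg ht.le (capExp d))
      linarith

theorem eventually_le_volume_convexHull_diff (hcl : IsClosed S) (hconv : Convex ℝ S)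
    (h0 : (0 : Euc (d + 1)) ∈ interior S) (hx₀ : x₀ ∈ frontier S) (hν : IsOuterNormalAt S x₀ ν)
    (hk : IsGaussCurvatureAt S x₀ ν k) (hk0 : 0 < k)
    (h : Γ * ⟪x₀, ν⟫ ^ capExp d < √k * (2 ^ ((d : ℝ) / 2) * coneConst d)) :
    ∀ᶠ q : ℝ × Euc (d + 1) in 𝓝[>] 0 ×ˢ 𝓝[frontier S] x₀, ∀ y ∈ polarBody S, ⟪q.2, y⟫ = 1 →
      ENNReal.ofReal (Γ * q.1 ^ capExp d) ≤
        volume (convexHull ℝ (polarBody S ∪ {(1 + q.1) • y}) \ polarBody S) := by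
  have hm := inner_pos_of_isOuterNormalAt h0 hν
  obtain ⟨C, hC, hCc⟩ : ∃ C, Γ * ⟪x₀, ν⟫ ^ capExp d < √k * (2 ^ ((d : ℝ) / 2) * C) ∧
      C < coneConst d := by
    have h1 : ContinuousAt (fun C => √k * (2 ^ ((d : ℝ) / 2) * C)) (coneConst d) := by fun_prop
    exact (((h1.tendsto.eventually_const_lt h).filter_mono nhdsWithin_le_nhds).and
      (self_mem_nhdsWithin (s := Iio (coneConst d)))).exists
  obtain ⟨θ, ⟨hθ0, hθ1⟩, hθC⟩ := exists_le_volume_coneModelInner d hCc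
  set m := ⟪x₀, ν⟫
  obtain ⟨q, ⟨h1, h2⟩, hqm⟩ : ∃ q, (Γ * m < √k * ((2 / q) ^ ((d : ℝ) / 2) * C) ∧
      θ * q < m) ∧ m < q := by
    have h1 : ContinuousAt (fun q => √k * ((2 / q) ^ ((d : ℝ) / 2) * C)) m :=
      continuousAt_const.mul <| .mul (.rpow_const (continuousAt_const.div continuousAt_id hm.ne')
        (Or.inr (by positivity))) continuousAt_const
    have h2 : ContinuousAt (fun q => θ * q) m := by fun_prop
    refine (Eventually.and (.filter_mono nhdsWithin_le_nhds
      (.and (h1.tendsto.eventually_const_lt ?_) (h2.tendsto.eventually_lt_const ?_)))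
      (self_mem_nhdsWithin (s := Ioi m))).exists
    · rw [rpow_capExp_eq d hm] at hC
      rw [Real.div_rpow (by norm_num) hm.le]
      have : 0 < m ^ ((d : ℝ) / 2) := by positivity
      refine lt_of_mul_lt_mul_right ?_ this.le
      calc _ = Γ * (m ^ ((d : ℝ) / 2) * m) := by ring
        _ < _ := hC
        _ = _ := by field_simp
    · nlinarith
  have hq0 : 0 < q := hm.trans hqm
  obtain ⟨r, hr, hfr⟩ :=
    exists_dual_sandwich hcl hconv h0 hx₀ hν hk hk0 (mul_pos hθ0 hq0) h2 hqm
  obtain ⟨γ, hγ, hγ'⟩ := exists_pos_forall_of_eventually_nhds (m := m)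
      (P := fun g => Γ * g < √k * ((2 / q) ^ ((d : ℝ) / 2) * C))
      ((continuousAt_const.mul continuousAt_id).tendsto.eventually_lt_const h1)
  have hs : ∀ᶠ t in 𝓝[>] (0 : ℝ), (√(2 * t / q) < r ∧
      θ * q / 2 * √(2 * t / q) ^ 2 < r) ∧ 0 < t := by
    have h3 : ContinuousAt (fun t => √(2 * t / q)) 0 := by fun_prop
    have h4 : ContinuousAt (fun t => θ * q / 2 * √(2 * t / q) ^ 2) 0 := by fun_prop
    refine Eventually.and (.filter_mono nhdsWithin_le_nhds
      (.and (h3.tendsto.eventually_lt_const ?_) (h4.tendsto.eventually_lt_const ?_)))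
      self_mem_nhdsWithin
    · simpa using hr
    · simpa using hr
  filter_upwards [hs.prod_mk (hfr γ hγ)]
  rintro ⟨t, x⟩ ⟨⟨⟨ht1, ht2⟩, ht⟩, hx⟩ y hy hxy
  dsimp only at *
  obtain ⟨g, hg, hgm, K, hK, hK0, hout, hin, hvol⟩ := hx y hy hxy
  have hρ : 0 < √(2 * t / q) := Real.sqrt_pos.2 (by positivity)
  have hρt : q * √(2 * t / q) ^ 2 / 2 = t := by
    rw [Real.sq_sqrt (by positivity)]; field_simp
  have key := le_volume_convexHull_diff (mul_pos hθ0 hq0) (h2.trans hqm).le le_rfl hout hin hρ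
    ht1.le ht2.le
  rw [hρt, sqrt_pow_mul_eq d hq0 ht] at key
  rw [hvol]
  calc _ ≤ ENNReal.ofReal (√k / g * ((2 / q) ^ ((d : ℝ) / 2) * t ^ capExp d * C)) := by
        refine ENNReal.ofReal_le_ofReal ?_
        rw [div_mul_eq_mul_div, le_div_iff₀ hg]
        have h5 := mul_le_mul_of_nonneg_right (hγ' g hgm).le (Real.rpow_nonneg ht.le (capExp d))
        linarith
    _ = ENNReal.ofReal (√k / g) * (ENNReal.ofReal ((2 / q) ^ ((d : ℝ) / 2) * t ^ capExp d)
        * ENNReal.ofReal C) := by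
      rw [← ENNReal.ofReal_mul (by positivity), ← ENNReal.ofReal_mul (by positivity)]
    _ ≤ _ := by
      gcongr
      refine le_trans ?_ key
      gcongr

end ConeLimits

section Constants

variable {d : ℕ} {S : Set (Euc (d + 1))} {u : Euc (d + 1) → Euc (d + 1)} {κ : Euc (d + 1) → ℝ}
  {x : Euc (d + 1)}

theorem two_div_mul_capExp (d : ℕ) : (2 : ℝ) / (((d + 1 : ℕ) : ℝ) + 1) * capExp d = 1 := by
  rw [capExp]; push_cast; field_simp; ring

theorem one_div_mul_capExp (d : ℕ) : (1 : ℝ) / (((d + 1 : ℕ) : ℝ) + 1) * capExp d = 1 / 2 := by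
  have := two_div_mul_capExp d
  linear_combination this / 2

theorem volume_toReal_pos {n : ℕ} {S : Set (Euc n)} (hS : IsCompact S)
    (h : (interior S).Nonempty) : 0 < (volume S).toReal :=
  ENNReal.toReal_pos (Measure.measure_pos_of_nonempty_interior _ h).ne' hS.measure_lt_top.ne

theorem cConst_pos (hV : 0 < (volume S).toReal) : 0 < cConst (d + 1) S := by
  have hω : 0 < (volume (ball (0 : Euc (d + 1 - 1)) 1)).toReal := volume_unitBall_pos d
  rw [cConst]
  positivity

theorem capConst_mul_cConst_rpow (hV : 0 < (volume S).toReal) :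
    capConst d * cConst (d + 1) S ^ capExp d = (volume S).toReal := by
  have hω : 0 < (volume (ball (0 : Euc d) 1)).toReal := volume_unitBall_pos d
  have h : cConst (d + 1) S = ((((d + 1 : ℕ) : ℝ) + 1) ^ ((2 : ℝ) / (((d + 1 : ℕ) : ℝ) + 1)) / 2) *
    ((volume S).toReal / (volume (ball (0 : Euc d) 1)).toReal) ^
      ((2 : ℝ) / (((d + 1 : ℕ) : ℝ) + 1)) := rfl
  rw [h, Real.mul_rpow (by positivity) (by positivity), Real.div_rpow (by positivity) (by norm_num),
    ← Real.rpow_mul (by positivity), ← Real.rpow_mul (by positivity), two_div_mul_capExp,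
    Real.rpow_one, Real.rpow_one, capConst]
  push_cast
  field_simp
  ring

theorem capConst_mul_Gfun_rpow (hV : 0 < (volume S).toReal) (hκ : 0 ≤ κ x)
    (hm : 0 < ⟪x, u x⟫) :
    capConst d * (Gfun S u κ x * ⟪x, u x⟫) ^ capExp d = √(κ x) * (volume S).toReal := by
  rw [Gfun, div_mul_cancel₀ _ hm.ne', Real.mul_rpow (cConst_pos hV).le (by positivity),
    ← Real.rpow_mul hκ, one_div_mul_capExp, ← mul_assoc, capConst_mul_cConst_rpow hV,
    Real.sqrt_eq_rpow, mul_comm]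

theorem Gfun_nonneg (hV : 0 < (volume S).toReal) (hκ : 0 ≤ κ x) (hm : 0 < ⟪x, u x⟫) :
    0 ≤ Gfun S u κ x := by
  have := cConst_pos hV
  rw [Gfun]
  positivity

theorem pos_of_Gfun_pos (hκ : 0 ≤ κ x) (h : 0 < Gfun S u κ x) : 0 < κ x := by
  refine hκ.lt_of_ne fun h0 => h.ne' ?_
  rw [Gfun, ← h0, Real.zero_rpow (by positivity), mul_zero, zero_div]

end Constants

section Bodies

variable {d n : ℕ} {S : Set (Euc (d + 1))} {u : Euc (d + 1) → Euc (d + 1)}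
  {κ : Euc (d + 1) → ℝ} {x₀ : Euc (d + 1)} {β b : ℝ}

theorem IsSymConvexBody.zero_mem_interior {T : Set (Euc n)} (hT : IsSymConvexBody T) :
    (0 : Euc n) ∈ interior T := by
  obtain ⟨-, hconv, ⟨z, hz⟩, hsymm⟩ := hT
  have hz' : -z ∈ interior T := by
    have h : interior T = -interior T := by
      conv_lhs => rw [hsymm]
      exact ((Homeomorph.neg (Euc n)).preimage_interior T).symm
    rw [h]; simpa using hz
  have := hconv.interior hz hz' (by norm_num : (0 : ℝ) ≤ 1 / 2) (by norm_num : (0 : ℝ) ≤ 1 / 2)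
    (by norm_num)
  simpa using this

theorem exists_ball_subset_polarBody {T : Set (Euc n)} (hT : IsCompact T) :
    ∃ ρ > 0, ball (0 : Euc n) ρ ⊆ polarBody T := by
  obtain ⟨R, hR, hTR⟩ := hT.isBounded.exists_pos_norm_le
  refine ⟨1 / R, by positivity, fun y hy x hx => ?_⟩
  rw [mem_ball_zero_iff, lt_div_iff₀ hR] at hy
  have := real_inner_le_norm x y
  have := hTR x hx
  nlinarith [norm_nonneg y]

theorem isClosed_polarBody (T : Set (Euc n)) : IsClosed (polarBody T) := by
  have : polarBody T = ⋂ x ∈ T, {y | ⟪x, y⟫ ≤ 1} := by ext; simp [polarBody]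
  rw [this]
  exact isClosed_biInter fun x _ => isClosed_le (by fun_prop) continuous_const

theorem isCompact_polarBody {T : Set (Euc n)} (h0 : (0 : Euc n) ∈ interior T) :
    IsCompact (polarBody T) := by
  refine isCompact_of_isClosed_isBounded (isClosed_polarBody T) ?_
  obtain ⟨ρ, hρ, hT⟩ := Metric.mem_nhds_iff.1 (mem_interior_iff_mem_nhds.1 h0)
  refine isBounded_iff_forall_norm_le.2 ⟨2 / ρ, fun y hy => ?_⟩
  rcases eq_or_ne y 0 with rfl | hy0
  · rw [norm_zero]; positivity
  have hn : 0 < ‖y‖ := norm_pos_iff.2 hy0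
  have := hy ((ρ / 2 / ‖y‖) • y) (hT (by
    rw [mem_ball_zero_iff, norm_smul, Real.norm_of_nonneg (by positivity)]
    field_simp; norm_num))
  rw [real_inner_smul_left, real_inner_self_eq_norm_sq] at this
  rw [le_div_iff₀ hρ]
  field_simp at this
  linarith

theorem volume_polarBody_toReal_pos {T : Set (Euc n)} (hT : IsSymConvexBody T) :
    0 < (volume (polarBody T)).toReal := by
  refine volume_toReal_pos (isCompact_polarBody hT.zero_mem_interior) ?_
  obtain ⟨ρ, hρ, h⟩ := exists_ball_subset_polarBody hT.1
  exact ⟨0, mem_interior_iff_mem_nhds.2 (mem_of_superset (ball_mem_nhds _ hρ) h)⟩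

theorem volume_convexHull_union_singleton {K : Set (Euc n)} (hK : IsCompact K) (w : Euc n) :
    volume (convexHull ℝ (K ∪ {w}))
      = volume (convexHull ℝ (K ∪ {w}) \ K) + ENNReal.ofReal (volume K).toReal := by
  rw [ENNReal.ofReal_toReal hK.measure_lt_top.ne,
    ← measure_sdiff_add_inter (convexHull ℝ (K ∪ {w})) hK.measurableSet,
    inter_eq_self_of_subset_right (subset_union_left.trans (subset_convexHull ℝ _))]

theorem mem_illuminationBody_iff {K : Set (Euc n)} (hK : IsCompact K)
    (hV : 0 < (volume K).toReal) {a : ℝ} (ha : 0 ≤ a) (w : Euc n) :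
    w ∈ illuminationBody K (a / (volume K).toReal) ↔
      volume (convexHull ℝ (K ∪ {w}) \ K) ≤ ENNReal.ofReal a := by
  have h : ENNReal.ofReal (1 + a / (volume K).toReal) * volume K
      = ENNReal.ofReal a + ENNReal.ofReal (volume K).toReal := by
    nth_rewrite 2 [← ENNReal.ofReal_toReal hK.measure_lt_top.ne]
    rw [← ENNReal.ofReal_mul (by positivity), ← ENNReal.ofReal_add ha hV.le]
    congr 1
    field_simp; ring
  rw [illuminationBody, mem_ofPred_eq, h, volume_convexHull_union_singleton hK]
  exact ENNReal.add_le_add_iff_right ENNReal.ofReal_ne_top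

theorem convexHull_union_smul_mono {K : Set (Euc n)} (h0 : (0 : Euc n) ∈ K) (y : Euc n) {s t : ℝ}
    (hs : 0 ≤ s) (hst : s ≤ t) :
    convexHull ℝ (K ∪ {s • y}) ⊆ convexHull ℝ (K ∪ {t • y}) := by
  refine convexHull_min ?_ (convex_convexHull ℝ _)
  refine union_subset (subset_union_left.trans (subset_convexHull ℝ _)) (singleton_subset_iff.2 ?_)
  rcases hs.eq_or_lt with rfl | hs0
  · rw [zero_smul]; exact subset_convexHull ℝ _ (Or.inl h0)
  have ht : 0 < t := hs0.trans_le hst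
  have := (convex_convexHull ℝ (K ∪ {t • y})).smul_mem_of_zero_mem
    (subset_convexHull ℝ _ (Or.inl h0)) (subset_convexHull ℝ _ (Or.inr rfl))
    (t := s / t) ⟨by positivity, (div_le_one ht).2 hst⟩
  rwa [smul_smul, div_mul_cancel₀ _ ht.ne'] at this

theorem eventually_scale {X : Type*} {l : Filter X} {P : ℝ × X → Prop} (hb : 0 < b)
    (h : ∀ᶠ q in 𝓝[>] (0 : ℝ) ×ˢ l, P q) :
    ∀ᶠ q in 𝓝[>] (0 : ℝ) ×ˢ l, P (b * q.1, q.2) := by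
  have : Tendsto (fun s : ℝ => b * s) (𝓝[>] 0) (𝓝[>] 0) := by
    refine tendsto_nhdsWithin_iff.2 ⟨?_, ?_⟩
    · have := (continuous_const_mul b).tendsto (0 : ℝ)
      rw [mul_zero] at this
      exact this.mono_left nhdsWithin_le_nhds
    · filter_upwards [self_mem_nhdsWithin] with s hs using mul_pos hb hs
  exact (this.prodMap tendsto_id).eventually h

theorem IsC2Body.inner_pos (hC2 : IsC2Body S u κ) (hS : IsSymConvexBody S)
    (hx₀ : x₀ ∈ frontier S) : 0 < ⟪x₀, u x₀⟫ :=
  inner_pos_of_isOuterNormalAt hS.zero_mem_interior (hC2 x₀ hx₀).1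

theorem IsC2Body.curvature_nonneg (hC2 : IsC2Body S u κ) (hS : IsSymConvexBody S)
    (hx₀ : x₀ ∈ frontier S) : 0 ≤ κ x₀ :=
  (exists_adapted_frame hS.1.isClosed hS.2.1 hS.zero_mem_interior hx₀ (hC2 x₀ hx₀).1
    (hC2 x₀ hx₀).2).1

theorem IsSymConvexBody.volume_pos {T : Set (Euc n)} (hT : IsSymConvexBody T) :
    0 < (volume T).toReal :=
  volume_toReal_pos hT.1 hT.2.2.1

theorem IsC2Body.Gfun_nonneg (hC2 : IsC2Body S u κ) (hS : IsSymConvexBody S)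
    (hx₀ : x₀ ∈ frontier S) : 0 ≤ Gfun S u κ x₀ :=
  _root_.Gfun_nonneg hS.volume_pos (hC2.curvature_nonneg hS hx₀) (hC2.inner_pos hS hx₀)

theorem IsC2Body.capConst_mul_Gfun (hC2 : IsC2Body S u κ) (hS : IsSymConvexBody S)
    (hx₀ : x₀ ∈ frontier S) :
    capConst d * (Gfun S u κ x₀ * ⟪x₀, u x₀⟫) ^ capExp d = √(κ x₀) * (volume S).toReal :=
  capConst_mul_Gfun_rpow hS.volume_pos (hC2.curvature_nonneg hS hx₀) (hC2.inner_pos hS hx₀)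

/-- Cutting off relative volume `s ^ ((n + 1) / 2)` near `x₀` leaves at least `1 - β s`. -/
theorem IsC2Body.eventually_le_of_volume_cap_le (hC2 : IsC2Body S u κ) (hS : IsSymConvexBody S)
    (hx₀ : x₀ ∈ frontier S) (hβ : Gfun S u κ x₀ < β) :
    ∀ᶠ q : ℝ × Euc (d + 1) in 𝓝[>] 0 ×ˢ 𝓝[frontier S] x₀, ∀ y ∈ polarBody S, ⟪q.2, y⟫ = 1 →
      ∀ c, volume (S ∩ {z | c ≤ ⟪y, z⟫}) ≤ ENNReal.ofReal (q.1 ^ capExp d) * volume S →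
        1 - β * q.1 ≤ c := by
  have hG := hC2.Gfun_nonneg hS hx₀
  have hm := hC2.inner_pos hS hx₀
  refine _root_.eventually_le_of_volume_cap_le hS.1 hS.2.1 hS.zero_mem_interior hx₀
    (hC2 x₀ hx₀).1 (hC2 x₀ hx₀).2 (hG.trans_lt hβ) ?_
  rw [← hC2.capConst_mul_Gfun hS hx₀]
  have := capConst_pos d
  have := capExp_pos d
  gcongr

theorem IsC2Body.eventually_volume_cap_le (hC2 : IsC2Body S u κ) (hS : IsSymConvexBody S)
    (hx₀ : x₀ ∈ frontier S) (hβ0 : 0 < β) (hβ : β < Gfun S u κ x₀) :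
    ∀ᶠ q : ℝ × Euc (d + 1) in 𝓝[>] 0 ×ˢ 𝓝[frontier S] x₀, ∀ y ∈ polarBody S, ⟪q.2, y⟫ = 1 →
      volume (S ∩ {z | 1 - β * q.1 ≤ ⟪y, z⟫}) ≤ ENNReal.ofReal (q.1 ^ capExp d) * volume S := by
  have hm := hC2.inner_pos hS hx₀
  refine _root_.eventually_volume_cap_le hS.1 hS.2.1 hS.zero_mem_interior hx₀
    (hC2 x₀ hx₀).1 (hC2 x₀ hx₀).2
    (pos_of_Gfun_pos (hC2.curvature_nonneg hS hx₀) (hβ0.trans hβ)) hβ0 ?_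
  rw [← hC2.capConst_mul_Gfun hS hx₀]
  have := capConst_pos d
  have := capExp_pos d
  gcongr

/-- The constant relating `Gfun` to the asymptotic volume of the caps of the illumination body. -/
def illumConst (S : Set (Euc (d + 1))) : ℝ :=
  capConst d * (2 ^ ((d : ℝ) / 2) * coneConst d) / (volume S).toReal

theorem illumConst_pos (hS : IsSymConvexBody S) : 0 < illumConst S := by
  have := hS.volume_pos
  have := capConst_pos d
  have := coneConst_pos d
  rw [illumConst]
  positivity

theorem IsC2Body.sqrt_mul_coneConst (hC2 : IsC2Body S u κ) (hS : IsSymConvexBody S)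
    (hx₀ : x₀ ∈ frontier S) :
    √(κ x₀) * (2 ^ ((d : ℝ) / 2) * coneConst d)
      = illumConst S * Gfun S u κ x₀ ^ capExp d * ⟪x₀, u x₀⟫ ^ capExp d := by
  have hV := hS.volume_pos
  have h := hC2.capConst_mul_Gfun hS hx₀
  rw [Real.mul_rpow (hC2.Gfun_nonneg hS hx₀) (hC2.inner_pos hS hx₀).le] at h
  rw [illumConst]
  field_simp
  linear_combination -h * coneConst d

theorem IsC2Body.eventually_mem_illuminationBody (hC2 : IsC2Body S u κ) (hS : IsSymConvexBody S)
    (hx₀ : x₀ ∈ frontier S) (hG : 0 < Gfun S u κ x₀) (hb : 0 < b) (hb1 : b * Gfun S u κ x₀ < 1) :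
    ∀ᶠ q : ℝ × Euc (d + 1) in 𝓝[>] 0 ×ˢ 𝓝[frontier S] x₀, ∀ y ∈ polarBody S, ⟪q.2, y⟫ = 1 →
      (1 + b * q.1) • y ∈ illuminationBody (polarBody S)
        (illumConst S * q.1 ^ capExp d / (volume (polarBody S)).toReal) := by
  have hm := hC2.inner_pos hS hx₀
  have hα := capExp_pos d
  have hc := illumConst_pos hS
  have hs : ∀ᶠ s in 𝓝[>] (0 : ℝ), 0 < s := self_mem_nhdsWithin
  have h : √(κ x₀) * (2 ^ ((d : ℝ) / 2) * coneConst d)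
      < illumConst S / b ^ capExp d * ⟪x₀, u x₀⟫ ^ capExp d := by
    rw [hC2.sqrt_mul_coneConst hS hx₀]
    refine mul_lt_mul_of_pos_right ?_ (by positivity)
    rw [lt_div_iff₀ (by positivity), mul_assoc, ← Real.mul_rpow hG.le hb.le]
    refine mul_lt_of_lt_one_right hc (Real.rpow_lt_one (by positivity) (by linarith) hα)
  filter_upwards [eventually_scale hb (eventually_volume_convexHull_diff_le hS.1.isClosed hS.2.1
    hS.zero_mem_interior hx₀ (hC2 x₀ hx₀).1 (hC2 x₀ hx₀).2
    (pos_of_Gfun_pos (hC2.curvature_nonneg hS hx₀) hG) h), hs.prod_inl _]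
  rintro ⟨s, x⟩ hq hs y hy hxy
  dsimp only at *
  rw [mem_illuminationBody_iff (isCompact_polarBody hS.zero_mem_interior)
    (volume_polarBody_toReal_pos hS) (by positivity)]
  refine (hq y hy hxy).trans (ENNReal.ofReal_le_ofReal (le_of_eq ?_))
  rw [Real.mul_rpow hb.le hs.le]
  have : 0 < b ^ capExp d := by positivity
  field_simp

theorem IsC2Body.eventually_le_of_mem_illuminationBody (hC2 : IsC2Body S u κ)
    (hS : IsSymConvexBody S) (hx₀ : x₀ ∈ frontier S) (hb : 0 < b) (hb1 : 1 < b * Gfun S u κ x₀) :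
    ∀ᶠ q : ℝ × Euc (d + 1) in 𝓝[>] 0 ×ˢ 𝓝[frontier S] x₀, ∀ y ∈ polarBody S, ⟪q.2, y⟫ = 1 →
      ∀ μ : ℝ, μ • y ∈ illuminationBody (polarBody S)
        (illumConst S * q.1 ^ capExp d / (volume (polarBody S)).toReal) → μ ≤ 1 + b * q.1 := by
  have hm := hC2.inner_pos hS hx₀
  have hα := capExp_pos d
  have hc := illumConst_pos hS
  have hG : 0 < Gfun S u κ x₀ := by
    by_contra hneg
    push Not at hneg
    nlinarith
  have hs : ∀ᶠ s in 𝓝[>] (0 : ℝ), 0 < s := self_mem_nhdsWithin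
  obtain ⟨Γ, hΓ1, hΓ2⟩ : ∃ Γ, illumConst S / b ^ capExp d < Γ ∧
      Γ < illumConst S * Gfun S u κ x₀ ^ capExp d := by
    refine exists_between ?_
    rw [div_lt_iff₀ (by positivity), mul_assoc, ← Real.mul_rpow hG.le hb.le]
    refine lt_mul_of_one_lt_right hc (Real.one_lt_rpow (by linarith) hα)
  have h : Γ * ⟪x₀, u x₀⟫ ^ capExp d < √(κ x₀) * (2 ^ ((d : ℝ) / 2) * coneConst d) := by
    rw [hC2.sqrt_mul_coneConst hS hx₀]
    exact mul_lt_mul_of_pos_right hΓ2 (by positivity)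
  filter_upwards [eventually_scale hb (eventually_le_volume_convexHull_diff hS.1.isClosed hS.2.1
    hS.zero_mem_interior hx₀ (hC2 x₀ hx₀).1 (hC2 x₀ hx₀).2
    (pos_of_Gfun_pos (hC2.curvature_nonneg hS hx₀) hG) h), hs.prod_inl _]
  rintro ⟨s, x⟩ hq hs y hy hxy μ hμ
  dsimp only at *
  by_contra hlt
  push Not at hlt
  rw [mem_illuminationBody_iff (isCompact_polarBody hS.zero_mem_interior)
    (volume_polarBody_toReal_pos hS) (by positivity)] at hμ
  have h0 : (0 : Euc (d + 1)) ∈ polarBody S := fun x _ => by rw [inner_zero_right]; norm_num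
  have key := ((hq y hy hxy).trans (measure_mono (sdiff_subset_sdiff_left
    (convexHull_union_smul_mono h0 y (by positivity) hlt.le)))).trans hμ
  have hsα : 0 < s ^ capExp d := by positivity
  rw [ENNReal.ofReal_le_ofReal_iff (by positivity), Real.mul_rpow hb.le hs.le, ← mul_assoc] at key
  have := le_of_mul_le_mul_right key hsα
  rw [div_lt_iff₀ (by positivity)] at hΓ1
  linarith

end Bodies

section Reduction

variable {d n : ℕ}

theorem IsCompact.eventually_forall_of_prod_nhdsWithin {ι X : Type*} [TopologicalSpace X]
    {l : Filter ι} {K : Set X} (hK : IsCompact K) {P : ι × X → Prop}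
    (h : ∀ x ∈ K, ∀ᶠ q : ι × X in l ×ˢ 𝓝[K] x, P q) :
    ∀ᶠ i in l, ∀ x ∈ K, P (i, x) := by
  refine hK.induction_on (p := fun T => ∀ᶠ i in l, ∀ x ∈ T, P (i, x)) (by simp)
    (fun A B hAB hB => hB.mono fun i hi x hx => hi x (hAB hx))
    (fun A B hA hB => ?_) (fun x hx => ?_)
  · filter_upwards [hA, hB] with i h1 h2 x hx using hx.elim (h1 x) (h2 x)
  · obtain ⟨pa, hpa, pb, hpb, hp⟩ := Filter.eventually_prod_iff.1 (h x hx)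
    exact ⟨{z | pb z}, hpb, hpa.mono fun i hi z hz => hp hi hz⟩

/-- Every nonzero vector is a positive multiple of a polar vector which is dual to a boundary
point. -/
theorem IsSymConvexBody.exists_dual_pair {S : Set (Euc n)} (hS : IsSymConvexBody S) {v : Euc n}
    (hv : v ≠ 0) :
    ∃ x ∈ frontier S, ∃ y ∈ polarBody S, ⟪x, y⟫ = 1 ∧ ∃ H > (0 : ℝ), v = H • y := by
  have h0 := hS.zero_mem_interior
  obtain ⟨x, hxS, hmax⟩ := hS.1.exists_isMaxOn ⟨0, interior_subset h0⟩
    (f := fun z => ⟪v, z⟫) (by fun_prop)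
  have hv2 : 0 < ⟪v, v⟫ := real_inner_self_pos.2 hv
  have key : ∀ z ∈ interior S, ⟪v, z⟫ < ⟪v, x⟫ := by
    intro z hz
    have hc : Tendsto (fun t : ℝ => z + t • v) (𝓝[>] 0) (𝓝 z) := by
      have : Continuous fun t : ℝ => z + t • v := by fun_prop
      have := this.tendsto 0
      rw [zero_smul, add_zero] at this
      exact this.mono_left nhdsWithin_le_nhds
    obtain ⟨t, ht, ht0⟩ := ((hc.eventually (mem_interior_iff_mem_nhds.1 hz)).and
      self_mem_nhdsWithin).exists
    have := hmax ht
    simp only [mem_ofPred_eq, inner_add_right, inner_smul_right] at this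
    have : 0 < t * ⟪v, v⟫ := mul_pos ht0 hv2
    linarith
  have hH : 0 < ⟪v, x⟫ := by simpa using key 0 h0
  refine ⟨x, ⟨subset_closure hxS, fun h => (key x h).false⟩, (⟪v, x⟫)⁻¹ • v, fun z hz => ?_, ?_,
    ⟪v, x⟫, hH, ?_⟩
  · rw [inner_smul_right, inv_mul_le_iff₀ hH, mul_one, real_inner_comm]
    exact hmax hz
  · rw [inner_smul_right, real_inner_comm, inv_mul_cancel₀]
    rw [real_inner_comm]; exact hH.ne'
  · rw [smul_smul, mul_inv_cancel₀ hH.ne', one_smul]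

theorem bodyDist_le {C₁ C₂ : Set (Euc n)} {a : ℝ} (ha : 1 ≤ a) (h₁ : a⁻¹ • C₁ ⊆ C₂)
    (h₂ : C₂ ⊆ a • C₁) : bodyDist C₁ C₂ ≤ a :=
  csInf_le ⟨1, fun _ h => h.1⟩ ⟨ha, h₁, h₂⟩

theorem bodyDist_nonneg (C₁ C₂ : Set (Euc n)) : 0 ≤ bodyDist C₁ C₂ :=
  Real.sInf_nonneg fun _ h => zero_le_one.trans h.1

theorem dualDist_le (C : Set (Euc n)) (δ : ℝ) {δ' : ℝ} (hδ' : 0 < δ') :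
    dualDist C δ ≤ bodyDist (floatingBody C δ)
      (polarBody (illuminationBody (polarBody C) δ')) :=
  csInf_le ⟨0, by rintro _ ⟨_, _, rfl⟩; exact bodyDist_nonneg _ _⟩ ⟨δ', hδ', rfl⟩

theorem bodyDist_floatingBody_polarBody_le {S I : Set (Euc n)} (hS : IsSymConvexBody S)
    {δ a : ℝ} (ha : 1 ≤ a)
    (h₁ : ∀ x ∈ frontier S, ∀ y ∈ polarBody S, ⟪x, y⟫ = 1 → ∃ μ > (0 : ℝ), μ • y ∈ I ∧
      ∀ c, volume (S ∩ {z | c ≤ ⟪y, z⟫}) ≤ ENNReal.ofReal δ * volume S → 1 ≤ a * c * μ)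
    (h₂ : ∀ x ∈ frontier S, ∀ y ∈ polarBody S, ⟪x, y⟫ = 1 → ∃ c,
      volume (S ∩ {z | c ≤ ⟪y, z⟫}) ≤ ENNReal.ofReal δ * volume S ∧
      ∀ μ > (0 : ℝ), μ • y ∈ I → μ * c ≤ a) :
    bodyDist (floatingBody S δ) (polarBody I) ≤ a := by
  have ha0 : 0 < a := zero_lt_one.trans_le ha
  refine bodyDist_le ha ?_ ?_
  · rintro _ ⟨z, hz, rfl⟩ w hw
    rcases eq_or_ne w 0 with rfl | hw0
    · rw [inner_zero_left]; norm_num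
    obtain ⟨x, hx, y, hy, hxy, H, hH, rfl⟩ := hS.exists_dual_pair hw0
    obtain ⟨c, hc, hc'⟩ := h₂ x hx y hy hxy
    have hy0 : y ≠ 0 := by rintro rfl; simp at hw0
    simp only [floatingBody, mem_iInter] at hz
    have hzc : ⟪y, z⟫ ≤ c := hz y hy0 c hc
    have := hc' H hH hw
    simp only
    rw [inner_smul_right, inv_mul_le_iff₀ ha0, mul_one, real_inner_smul_left]
    nlinarith
  · intro z hz
    refine (mem_smul_set_iff_inv_smul_mem₀ ha0.ne' _ _).2 ?_
    simp only [floatingBody, mem_iInter]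
    intro v hv c hc
    obtain ⟨x, hx, y, hy, hxy, H, hH, rfl⟩ := hS.exists_dual_pair hv
    obtain ⟨μ, hμ, hμI, h⟩ := h₁ x hx y hy hxy
    have hc' : {z | c / H ≤ ⟪y, z⟫} = {z | c ≤ ⟪H • y, z⟫} := by
      ext z
      rw [mem_ofPred_eq, mem_ofPred_eq, real_inner_smul_left, div_le_iff₀ hH, mul_comm]
    have h1 := h (c / H) (by rw [hc']; exact hc)
    have h2 := hz _ hμI
    rw [real_inner_smul_left] at h2
    change ⟪H • y, a⁻¹ • z⟫ ≤ c
    rw [inner_smul_right, inv_mul_le_iff₀ ha0, real_inner_smul_left]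
    have : μ * (H * ⟪y, z⟫) ≤ μ * (a * c) := by
      have : a * (c / H) * μ * H = μ * (a * c) := by field_simp
      nlinarith
    exact le_of_mul_le_mul_left this hμ

variable {S : Set (Euc (d + 1))} {u : Euc (d + 1) → Euc (d + 1)} {κ : Euc (d + 1) → ℝ}

theorem IsC2Body.exists_dual (hC2 : IsC2Body S u κ) (hS : IsSymConvexBody S) {x : Euc (d + 1)}
    (hx : x ∈ frontier S) : ∃ y ∈ polarBody S, ⟪x, y⟫ = 1 := by
  have hm := hC2.inner_pos hS hx
  refine ⟨(⟪x, u x⟫)⁻¹ • u x, fun z hz => ?_, ?_⟩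
  · rw [inner_smul_right, inv_mul_le_iff₀ hm, mul_one]
    exact (hC2 x hx).1.2 z hz
  · rw [inner_smul_right, inv_mul_cancel₀ hm.ne']

theorem IsC2Body.upperSemicontinuousOn_Gfun (hC2 : IsC2Body S u κ) (hS : IsSymConvexBody S) :
    UpperSemicontinuousOn (Gfun S u κ) (frontier S) := by
  intro x₀ hx₀ β' hβ'
  obtain ⟨β, hβ, hββ'⟩ := exists_between hβ'
  filter_upwards [(Filter.eventually_swap_iff.1
    (hC2.eventually_le_of_volume_cap_le hS hx₀ hβ)).curry, self_mem_nhdsWithin] with x hx hxS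
  refine lt_of_le_of_lt ?_ hββ'
  by_contra! hlt
  obtain ⟨γ, hγ, hγ'⟩ := exists_between hlt
  have h := (hC2.eventually_volume_cap_le hS hxS
    (((hC2.Gfun_nonneg hS hx₀).trans_lt hβ).trans hγ) hγ').curry
  obtain ⟨y, hy, hxy⟩ := hC2.exists_dual hS hxS
  obtain ⟨s, ⟨hs1, hs2⟩, hs0⟩ := ((hx.and h).and self_mem_nhdsWithin).exists
  have := hs1 y hy hxy _ (hs2.self_of_nhdsWithin hxS y hy hxy)
  simp only [Prod.swap] at this
  have hs0 : 0 < s := hs0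
  nlinarith

theorem IsSymConvexBody.isCompact_frontier (hS : IsSymConvexBody S) : IsCompact (frontier S) :=
  hS.1.of_isClosed_subset isClosed_frontier (hS.1.isClosed.frontier_subset)

theorem IsSymConvexBody.frontier_nonempty (hS : IsSymConvexBody S) : (frontier S).Nonempty := by
  obtain ⟨v, hv⟩ := exists_ne (0 : Euc (d + 1))
  obtain ⟨x, hx, -⟩ := hS.exists_dual_pair hv
  exact ⟨x, hx⟩

theorem IsC2Body.Gfun_le_sSup (hC2 : IsC2Body S u κ) (hS : IsSymConvexBody S) {x : Euc (d + 1)}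
    (hx : x ∈ frontier S) : Gfun S u κ x ≤ sSup (Gfun S u κ '' frontier S) :=
  le_csSup ((hC2.upperSemicontinuousOn_Gfun hS).bddAbove_of_isCompact hS.isCompact_frontier)
    (mem_image_of_mem _ hx)

theorem IsC2Body.sInf_le_Gfun (hC2 : IsC2Body S u κ) (hS : IsSymConvexBody S) {x : Euc (d + 1)}
    (hx : x ∈ frontier S) : sInf (Gfun S u κ '' frontier S) ≤ Gfun S u κ x :=
  csInf_le ⟨0, by rintro _ ⟨z, hz, rfl⟩; exact hC2.Gfun_nonneg hS hz⟩ (mem_image_of_mem _ hx)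

theorem IsC2Body.sInf_Gfun_nonneg (hC2 : IsC2Body S u κ) (hS : IsSymConvexBody S) :
    0 ≤ sInf (Gfun S u κ '' frontier S) :=
  Real.sInf_nonneg (by rintro _ ⟨z, hz, rfl⟩; exact hC2.Gfun_nonneg hS hz)

end Reduction

section Assembly

variable {d n : ℕ}

theorem eventually_pos_nhdsGT {f : ℝ → ℝ} (hf : Continuous f) (h : 0 < f 0) :
    ∀ᶠ s in 𝓝[>] (0 : ℝ), 0 < f s :=
  (hf.tendsto 0).mono_left nhdsWithin_le_nhds |>.eventually (lt_mem_nhds h)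

theorem eventually_one_le_mul_mul {p q r : ℝ} (h : 0 < p + q + r) :
    ∀ᶠ s in 𝓝[>] (0 : ℝ), 1 ≤ (1 + p * s) * (1 + q * s) * (1 + r * s) := by
  filter_upwards [eventually_pos_nhdsGT
    (f := fun s => (p + q + r) + (p * q + p * r + q * r) * s + p * q * r * s ^ 2) (by fun_prop)
    (by simpa using h), self_mem_nhdsWithin] with s hs hs0
  have hs0 : 0 < s := hs0
  nlinarith [mul_pos hs0 hs]

theorem eventually_mul_le_one_add {e β w : ℝ} (h : e - β < w) :
    ∀ᶠ s in 𝓝[>] (0 : ℝ), (1 + e * s) * (1 - β * s) ≤ 1 + w * s := by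
  filter_upwards [eventually_pos_nhdsGT (f := fun s => (w - (e - β)) + e * β * s) (by fun_prop)
    (by simpa using h), self_mem_nhdsWithin] with s hs hs0
  have hs0 : 0 < s := hs0
  nlinarith [mul_pos hs0 hs]

/-- Illumination bodies of the polar body, with parameter small enough, stay uniformly close to
the polar body in all directions. -/
theorem IsSymConvexBody.exists_forall_mem_illuminationBody_le {S : Set (Euc n)}
    (hS : IsSymConvexBody S) {r : ℝ} (hr : 0 < r) :
    ∃ δ > (0 : ℝ), ∀ x ∈ frontier S, ∀ y ∈ polarBody S, ⟪x, y⟫ = 1 →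
      ∀ μ : ℝ, μ • y ∈ illuminationBody (polarBody S) δ → μ ≤ 1 + r := by
  obtain ⟨ρ, hρ, hball⟩ := exists_ball_subset_polarBody hS.1
  obtain ⟨R, hR, hSR⟩ := hS.1.isBounded.exists_pos_norm_le
  set θ := r / (1 + r + R * ρ) with hθ
  have hθ0 : 0 < θ := by positivity
  have hθ1 : θ < 1 := by
    rw [hθ, div_lt_one (by positivity)]
    nlinarith [mul_pos hR hρ]
  have hθr : θ * (1 + r + R * ρ) = r := div_mul_cancel₀ _ (by positivity)
  have hW : 0 < (volume (ball (0 : Euc n) (θ * ρ))).toReal :=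
    ENNReal.toReal_pos (measure_ball_pos _ _ (by positivity)).ne' measure_ball_lt_top.ne
  have hV := volume_polarBody_toReal_pos hS
  set W := (volume (ball (0 : Euc n) (θ * ρ))).toReal with hWdef
  refine ⟨W / 2 / (volume (polarBody S)).toReal, by positivity, fun x hx y hy hxy μ hμ => ?_⟩
  rw [mem_illuminationBody_iff (isCompact_polarBody hS.zero_mem_interior) hV (by positivity)] at hμ
  by_contra! hlt
  have h0 : (0 : Euc n) ∈ polarBody S := hball (mem_ball_self hρ)
  have hxS : x ∈ S := hS.1.isClosed.frontier_subset hx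
  have hsub : ball (((1 - θ) * (1 + r)) • y) (θ * ρ)
      ⊆ convexHull ℝ (polarBody S ∪ {μ • y}) \ polarBody S := by
    intro p hp
    rw [mem_ball_iff_norm] at hp
    obtain ⟨b, hb, rfl⟩ : ∃ b : Euc n, ‖b‖ < ρ ∧ p = (1 - θ) • ((1 + r) • y) + θ • b := by
      refine ⟨θ⁻¹ • (p - ((1 - θ) * (1 + r)) • y), ?_, ?_⟩
      · rw [norm_smul, Real.norm_of_nonneg (by positivity), inv_mul_lt_iff₀ hθ0]
        exact hp
      · rw [smul_smul θ, mul_inv_cancel₀ hθ0.ne', one_smul, smul_smul]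
        abel
    constructor
    · refine convexHull_union_smul_mono h0 y (by positivity) hlt.le ?_
      have hs := subset_convexHull ℝ (polarBody S ∪ {(1 + r) • y})
      exact convex_iff_add_mem.1 (convex_convexHull ℝ (polarBody S ∪ {(1 + r) • y}))
        (hs (Or.inr rfl)) (hs (Or.inl (hball (by rwa [mem_ball_zero_iff])))) (by linarith) hθ0.le
        (by ring)
    · intro hpK
      have h1 := hpK x hxS
      rw [inner_add_right, inner_smul_right, inner_smul_right, inner_smul_right, hxy] at h1
      have h2 := (abs_le.1 (abs_real_inner_le_norm x b)).1
      have h3 : ‖x‖ * ‖b‖ ≤ R * ‖b‖ := mul_le_mul_of_nonneg_right (hSR x hxS) (norm_nonneg _)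
      have h4 : R * ‖b‖ < R * ρ := mul_lt_mul_of_pos_left hb hR
      nlinarith
  have h := (measure_mono hsub).trans hμ
  rw [Measure.addHaar_ball_center, ← ENNReal.ofReal_toReal
    (measure_ball_lt_top (x := (0 : Euc n)) (r := θ * ρ)).ne, ← hWdef,
    ENNReal.ofReal_le_ofReal_iff (by positivity)] at h
  linarith

theorem subset_illuminationBody {K : Set (Euc n)} (hK : Convex ℝ K) {δ : ℝ} (hδ : 0 ≤ δ) :
    K ⊆ illuminationBody K δ := by
  intro y hy
  rw [illuminationBody, mem_ofPred_eq, union_eq_self_of_subset_right (singleton_subset_iff.2 hy),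
    hK.convexHull_eq]
  refine le_mul_of_one_le_left' ?_
  rw [← ENNReal.ofReal_one]
  exact ENNReal.ofReal_le_ofReal (by linarith)

variable {S : Set (Euc (d + 1))} {u : Euc (d + 1) → Euc (d + 1)} {κ : Euc (d + 1) → ℝ}
  {x₀ : Euc (d + 1)} {A w ε : ℝ}

/-- The illumination body of the polar body paired with the floating body of parameter
`s ^ capExp d`. -/
def pairedIllumBody (S : Set (Euc (d + 1))) (A s : ℝ) : Set (Euc (d + 1)) :=
  illuminationBody (polarBody S)
    (illumConst S * (A * s) ^ capExp d / (volume (polarBody S)).toReal)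

theorem IsC2Body.eventually_exists_mem_pairedIllumBody (hC2 : IsC2Body S u κ)
    (hS : IsSymConvexBody S) (hx₀ : x₀ ∈ frontier S) (hG : 0 < Gfun S u κ x₀) (hA : 0 < A)
    (hw0 : 0 < w) (hw : Gfun S u κ x₀ - A / Gfun S u κ x₀ < w) :
    ∀ᶠ q : ℝ × Euc (d + 1) in 𝓝[>] 0 ×ˢ 𝓝[frontier S] x₀, ∀ y ∈ polarBody S, ⟪q.2, y⟫ = 1 →
      ∃ μ > (0 : ℝ), μ • y ∈ pairedIllumBody S A q.1 ∧
        ∀ c, volume (S ∩ {z | c ≤ ⟪y, z⟫}) ≤ ENNReal.ofReal (q.1 ^ capExp d) * volume S →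
          1 ≤ (1 + w * q.1) * c * μ := by
  obtain ⟨e, he, heA⟩ := exists_between
    (max_lt (by positivity : 0 < A / Gfun S u κ x₀) (by linarith : Gfun S u κ x₀ - w < _))
  rw [max_lt_iff] at he
  obtain ⟨β, hβ, hβ'⟩ := exists_between (by linarith [he.2] : Gfun S u κ x₀ < e + w)
  have hs : ∀ᶠ s in 𝓝[>] (0 : ℝ), 0 < s := self_mem_nhdsWithin
  have he0 : 0 < e / A := div_pos he.1 hA
  have heG : e / A * Gfun S u κ x₀ < 1 := by
    rw [lt_div_iff₀ hG] at heA
    rw [div_mul_eq_mul_div, div_lt_one hA]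
    exact heA
  filter_upwards [eventually_scale hA (hC2.eventually_mem_illuminationBody hS hx₀ hG he0 heG),
    hC2.eventually_le_of_volume_cap_le hS hx₀ hβ, hs.prod_inl _,
    (eventually_one_le_mul_mul (by linarith : 0 < w + (-β) + e)).prod_inl _]
  rintro ⟨s, x⟩ h1 h2 hs h3 y hy hxy
  dsimp only at *
  have he1 := he.1
  refine ⟨1 + e * s, by positivity, ?_, fun c hc => h3.trans ?_⟩
  · have := h1 y hy hxy
    rwa [← mul_assoc, div_mul_cancel₀ _ hA.ne'] at this
  · have := h2 y hy hxy c hc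
    have : 1 + -β * s ≤ c := by linarith
    gcongr

theorem IsC2Body.eventually_exists_cap (hC2 : IsC2Body S u κ)
    (hS : IsSymConvexBody S) (hx₀ : x₀ ∈ frontier S) (hG : 0 < Gfun S u κ x₀) (hA : 0 < A)
    (hw : A / Gfun S u κ x₀ - Gfun S u κ x₀ < w) :
    ∀ᶠ q : ℝ × Euc (d + 1) in 𝓝[>] 0 ×ˢ 𝓝[frontier S] x₀, ∀ y ∈ polarBody S, ⟪q.2, y⟫ = 1 →
      ∃ c, volume (S ∩ {z | c ≤ ⟪y, z⟫}) ≤ ENNReal.ofReal (q.1 ^ capExp d) * volume S ∧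
        ∀ μ > (0 : ℝ), μ • y ∈ pairedIllumBody S A q.1 → μ * c ≤ 1 + w * q.1 := by
  obtain ⟨β, hβ, hβG⟩ := exists_between
    (max_lt hG (by linarith : A / Gfun S u κ x₀ - w < Gfun S u κ x₀))
  rw [max_lt_iff] at hβ
  obtain ⟨e, he, he'⟩ := exists_between (by linarith [hβ.2] : A / Gfun S u κ x₀ < β + w)
  have he0 : 0 < e := (by positivity : 0 < A / Gfun S u κ x₀).trans he
  have heG : 1 < e / A * Gfun S u κ x₀ := by
    rw [div_lt_iff₀ hG] at he
    rw [div_mul_eq_mul_div, one_lt_div hA]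
    exact he
  filter_upwards [eventually_scale hA
    (hC2.eventually_le_of_mem_illuminationBody hS hx₀ (div_pos he0 hA) heG),
    hC2.eventually_volume_cap_le hS hx₀ hβ.1 hβG,
    (eventually_mul_le_nhdsGT (a := β) one_pos).prod_inl _,
    (eventually_mul_le_one_add (by linarith : e - β < w)).prod_inl _]
  rintro ⟨s, x⟩ h1 h2 hs h3 y hy hxy
  dsimp only at *
  refine ⟨1 - β * s, h2 y hy hxy, fun μ hμ hμI => le_trans ?_ h3⟩
  have := h1 y hy hxy μ hμI
  rw [← mul_assoc, div_mul_cancel₀ _ hA.ne'] at this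
  exact mul_le_mul_of_nonneg_right this (by linarith)

theorem IsC2Body.eventually_dualDist_le_of_pos (hC2 : IsC2Body S u κ) (hS : IsSymConvexBody S)
    (hpos : 0 < sInf (Gfun S u κ '' frontier S)) (hε : 0 < ε) :
    ∀ᶠ s in 𝓝[>] (0 : ℝ), dualDist S (s ^ capExp d) ≤
      1 + (sSup (Gfun S u κ '' frontier S) - sInf (Gfun S u κ '' frontier S) + ε) * s := by
  set M := sSup (Gfun S u κ '' frontier S)
  set m := sInf (Gfun S u κ '' frontier S)
  have hmG : ∀ x ∈ frontier S, m ≤ Gfun S u κ x := fun x hx => hC2.sInf_le_Gfun hS hx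
  have hGM : ∀ x ∈ frontier S, Gfun S u κ x ≤ M := fun x hx => hC2.Gfun_le_sSup hS hx
  obtain ⟨x₁, hx₁⟩ := hS.frontier_nonempty
  have hmM : m ≤ M := (hmG x₁ hx₁).trans (hGM x₁ hx₁)
  have hA : 0 < m * M := mul_pos hpos (hpos.trans_le hmM)
  have hw : 0 < M - m + ε := by linarith
  have hα := capExp_pos d
  filter_upwards [hS.isCompact_frontier.eventually_forall_of_prod_nhdsWithin fun x hx => by
      have hG : 0 < Gfun S u κ x := hpos.trans_le (hmG x hx)
      refine hC2.eventually_exists_mem_pairedIllumBody hS hx hG hA hw ?_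
      have : Gfun S u κ x - m * M / Gfun S u κ x ≤ M - m := by
        rw [sub_le_iff_le_add, ← sub_le_iff_le_add', le_div_iff₀ hG]
        nlinarith [mul_nonneg (add_pos hG hpos).le (sub_nonneg.2 (hGM x hx))]
      linarith,
    hS.isCompact_frontier.eventually_forall_of_prod_nhdsWithin fun x hx => by
      have hG : 0 < Gfun S u κ x := hpos.trans_le (hmG x hx)
      refine hC2.eventually_exists_cap hS hx hG hA (w := M - m + ε) ?_
      have : m * M / Gfun S u κ x - Gfun S u κ x ≤ M - m := by
        rw [sub_le_iff_le_add, div_le_iff₀ hG]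
        nlinarith [mul_nonneg (sub_nonneg.2 (hmG x hx))
          (by linarith [hGM x hx] : 0 ≤ M + Gfun S u κ x)]
      linarith, self_mem_nhdsWithin] with s h1 h2 hs
  have hs : 0 < s := hs
  have hc := illumConst_pos hS
  have hV := volume_polarBody_toReal_pos hS
  refine (dualDist_le S _ (δ' := illumConst S * (m * M * s) ^ capExp d /
    (volume (polarBody S)).toReal) (by positivity)).trans ?_
  exact bodyDist_floatingBody_polarBody_le hS (by nlinarith [mul_pos hw hs]) h1 h2

theorem IsC2Body.eventually_dualDist_le (hC2 : IsC2Body S u κ) (hS : IsSymConvexBody S)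
    (hε : 0 < ε) :
    ∀ᶠ s in 𝓝[>] (0 : ℝ), dualDist S (s ^ capExp d) ≤
      1 + (sSup (Gfun S u κ '' frontier S) + ε) * s := by
  set M := sSup (Gfun S u κ '' frontier S)
  have hGM : ∀ x ∈ frontier S, Gfun S u κ x ≤ M := fun x hx => hC2.Gfun_le_sSup hS hx
  obtain ⟨x₁, hx₁⟩ := hS.frontier_nonempty
  have hM : 0 ≤ M := (hC2.Gfun_nonneg hS hx₁).trans (hGM x₁ hx₁)
  filter_upwards [hS.isCompact_frontier.eventually_forall_of_prod_nhdsWithin fun x hx =>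
      hC2.eventually_le_of_volume_cap_le hS hx (β := M + ε / 2) (by linarith [hGM x hx]),
    eventually_one_le_mul_mul (by linarith : 0 < (M + ε) + (-(M + ε / 2)) + 0),
    self_mem_nhdsWithin] with s h1 h2 hs
  have hs : 0 < s := hs
  have hMs : 0 ≤ M * s := by positivity
  have hεs : 0 < ε * s := by positivity
  set r := min 1 (ε * s) / 3 with hr
  have hr0 : 0 < r := by rw [hr]; positivity
  have hr1 : r ≤ 1 / 3 := by rw [hr]; linarith [min_le_left 1 (ε * s)]
  have hr2 : 3 * r ≤ ε * s := by rw [hr]; linarith [min_le_right 1 (ε * s)]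
  obtain ⟨δ, hδ, h3⟩ := hS.exists_forall_mem_illuminationBody_le hr0
  refine (dualDist_le S _ hδ).trans (bodyDist_floatingBody_polarBody_le hS (by linarith) ?_ ?_)
  · intro x hx y hy hxy
    refine ⟨1, one_pos, subset_illuminationBody (convex_polarBody S) hδ.le (by rwa [one_smul]),
      fun c hc => h2.trans ?_⟩
    have := h1 x hx y hy hxy c hc
    rw [zero_mul, add_zero]
    have : 1 + -(M + ε / 2) * s ≤ c := by linarith
    gcongr
  · intro x hx y hy hxy
    refine ⟨1 + r, ?_, fun μ hμ hμI => ?_⟩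
    · have : S ∩ {z | 1 + r ≤ ⟪y, z⟫} = ∅ := by
        refine eq_empty_of_forall_notMem fun z hz => ?_
        have h4 := hy z hz.1
        have h5 : 1 + r ≤ ⟪y, z⟫ := hz.2
        rw [real_inner_comm] at h5
        linarith
      rw [this, measure_empty]
      exact zero_le
    · have := h3 x hx y hy hxy μ hμI
      nlinarith

theorem IsC2Body.eventually_dualDist_sub_one_div_le (hC2 : IsC2Body S u κ)
    (hS : IsSymConvexBody S) (hε : 0 < ε) :
    ∀ᶠ δ in 𝓝[>] (0 : ℝ), (dualDist S δ - 1) / δ ^ ((2 : ℝ) / (((d + 1 : ℕ) : ℝ) + 1)) ≤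
      sSup (Gfun S u κ '' frontier S) - sInf (Gfun S u κ '' frontier S) + ε := by
  have h : ∀ᶠ s in 𝓝[>] (0 : ℝ), dualDist S (s ^ capExp d) ≤
      1 + (sSup (Gfun S u κ '' frontier S) - sInf (Gfun S u κ '' frontier S) + ε) * s := by
    rcases (hC2.sInf_Gfun_nonneg hS).eq_or_lt with h0 | h0
    · rw [← h0, sub_zero]
      exact hC2.eventually_dualDist_le hS hε
    · exact hC2.eventually_dualDist_le_of_pos hS h0 hε
  set p := (2 : ℝ) / (((d + 1 : ℕ) : ℝ) + 1) with hp
  have hp0 : 0 < p := by positivity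
  have ht : Tendsto (fun δ : ℝ => δ ^ p) (𝓝[>] 0) (𝓝[>] 0) := by
    refine tendsto_nhdsWithin_iff.2 ⟨?_, ?_⟩
    · have := (Real.continuous_rpow_const hp0.le).tendsto (0 : ℝ)
      rw [Real.zero_rpow hp0.ne'] at this
      exact this.mono_left nhdsWithin_le_nhds
    · filter_upwards [self_mem_nhdsWithin] with δ hδ using Real.rpow_pos_of_pos hδ _
  filter_upwards [ht.eventually h, self_mem_nhdsWithin] with δ hδ hδ0
  have hδ0 : 0 < δ := hδ0
  rw [← Real.rpow_mul hδ0.le, hp, two_div_mul_capExp, Real.rpow_one, ← hp] at hδ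
  rw [div_le_iff₀ (by positivity)]
  linarith

theorem limsup_le_of_forall_eventually_le_add {X : Type*} {l : Filter X} {f : X → ℝ} {a : ℝ}
    (ha : 0 ≤ a) (h : ∀ ε > 0, ∀ᶠ x in l, f x ≤ a + ε) : limsup f l ≤ a := by
  refine le_of_forall_pos_le_add fun ε hε => ?_
  rw [limsup_eq]
  by_cases hb : BddBelow {b | ∀ᶠ x in l, f x ≤ b}
  · exact csInf_le hb (h ε hε)
  · rw [Real.sInf_of_not_bddBelow hb]
    linarith

end Assembly

/-- Theorem 1.2 (main1): for a centrally symmetric convex body `S ⊂ ℝⁿ` with `C²` boundary,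
`limsup_{δ→0} (d_S(δ) − 1)/δ^{2/(n+1)} ≤ G_max − G_min`. -/
theorem statement0 {n : ℕ} (hn : 2 ≤ n) (S : Set (Euc n))
    (u : Euc n → Euc n) (κ : Euc n → ℝ)
    (hS : IsSymConvexBody S) (hC2 : IsC2Body S u κ) :
    limsup (fun δ : ℝ => (dualDist S δ - 1) / δ ^ ((2:ℝ)/(n+1))) (𝓝[>] 0)
      ≤ sSup (Gfun S u κ '' frontier S) - sInf (Gfun S u κ '' frontier S) := by
  obtain ⟨d, rfl⟩ : ∃ d, n = d + 1 := ⟨n - 1, by omega⟩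
  obtain ⟨x, hx⟩ := hS.frontier_nonempty
  exact limsup_le_of_forall_eventually_le_add
    (sub_nonneg.2 ((hC2.sInf_le_Gfun hS hx).trans (hC2.Gfun_le_sSup hS hx)))
    fun ε hε => hC2.eventually_dualDist_sub_one_div_le hS hε
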